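/- Let W be an n-dimensional vector space and 𝓘=(I^1,…,I^s) an s-tuple of subsets of [n], each of cardinality r. Then for a generic point 𝓔 ∈ Fl(W)^s, the intersection ∩_{j=1}^{s} Ω°_{I^j}(E^j_•) has an open dense subset O such that for every V ∈ O, the induced s-tuple of flags 𝓔(V) ∈ Fl(V)^s is generic for intersection theory in V. -/

import Mathlib

noncomputable section

open Module Submodule

/-! ### Polynomial functions and the Zariski topology on a vector space -/

/-- Evaluation of a polynomial in linear functionals at a point of a vector space.
These are exactly the polynomial functions on a finite-dimensional vector space. -/
def mEval (k : Type*) {M : Type*} [Field k] [AddCommGroup M] [Module k M]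
    (x : M) (p : MvPolynomial (Module.Dual k M) k) : k :=
  MvPolynomial.eval (fun l : Module.Dual k M => l x) p

/-- The Zariski topology on a (finite-dimensional) vector space, generated by the
complements of zero sets of polynomial functions. -/
def mZariski (k M : Type*) [Field k] [AddCommGroup M] [Module k M] :
    TopologicalSpace M :=
  TopologicalSpace.generateFrom
    {U : Set M | ∃ p : MvPolynomial (Module.Dual k M) k, U = {x : M | mEval k x p ≠ 0}}

/-- The Zariski tangent space at a point `x` to a subset `A` of a vector space:
the common kernel of the differentials at `x` of all polynomial functions vanishing on `A`. -/
def mTangent (k : Type*) {M : Type*} [Field k] [AddCommGroup M] [Module k M]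
    (A : Set M) (x : M) : Submodule k M :=
  letI := Classical.decEq (Module.Dual k M)
  ⨅ p ∈ {p : MvPolynomial (Module.Dual k M) k | ∀ a ∈ A, mEval k a p = 0},
    LinearMap.ker (∑ l ∈ p.vars, mEval k x (MvPolynomial.pderiv l p) • (l : Module.Dual k M))

/-- `f : M → N` is a polynomial map on a subset `A ⊆ M`. -/
def IsPolyOn (k : Type*) {M N : Type*} [Field k] [AddCommGroup M] [Module k M]
    [AddCommGroup N] [Module k N] (A : Set M) (f : M → N) : Prop :=
  ∀ l : Module.Dual k N, ∃ p : MvPolynomial (Module.Dual k M) k, ∀ x ∈ A, l (f x) = mEval k x p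

/-- Dimension (topological Krull dimension) of a subset of a topological space. -/
def subDim {α : Type*} (t : TopologicalSpace α) (C : Set α) : WithBot ℕ∞ :=
  @topologicalKrullDim C (TopologicalSpace.induced (Subtype.val : C → α) t)

/-- The irreducible components of a subset `A` of a topological space
(for the subspace topology). -/
def subComponents {α : Type*} (t : TopologicalSpace α) (A : Set α) : Set (Set ↥A) :=
  @irreducibleComponents A (TopologicalSpace.induced (Subtype.val : A → α) t)

/-- Dimension of a subset `C` of a subspace `A` of a topological space. -/
def compDim {α : Type*} (t : TopologicalSpace α) (A : Set α) (C : Set ↥A) : WithBot ℕ∞ :=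
  subDim (TopologicalSpace.induced (Subtype.val : A → α) t) C

/-! ### Flags, Schubert cells and Schubert varieties -/

/-- A complete flag on a finite-dimensional vector space, recorded as the increasing
function sending `m` to the `m`-th member (of dimension `m`) of the flag. -/
def IsFlag {k M : Type*} [Field k] [AddCommGroup M] [Module k M]
    (E : ℕ → Submodule k M) : Prop :=
  Monotone E ∧ ∀ m : ℕ, finrank k ↥(E m) = min m (finrank k M)

/-- Membership of `V` in the (open) Schubert cell `Ω°_I(E_•) ⊆ Gr(r, M)` attached to the
subset `I ⊆ [n]` recorded by the strictly increasing tuple `i : Fin r → Fin n`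
(`0`-indexed: the `1`-based subset is `{i a + 1}`): `dim (V ∩ E_u) = #{a | i_a ≤ u}`. -/
def cellMem {k M : Type*} [Field k] [AddCommGroup M] [Module k M] {n r : ℕ}
    (i : Fin r → Fin n) (E : ℕ → Submodule k M) (V : Submodule k M) : Prop :=
  finrank k ↥V = r ∧
    ∀ u : ℕ, u ≤ n →
      finrank k ↥(V ⊓ E u) =
        (Finset.univ.filter (fun a : Fin r => (i a : ℕ) + 1 ≤ u)).card

/-- Membership of `V` in the (closed) Schubert variety `Ω_I(E_•) ⊆ Gr(r, M)`:
`dim (V ∩ E_{i_a}) ≥ a` for `a = 1, …, r`. -/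
def varMem {k M : Type*} [Field k] [AddCommGroup M] [Module k M] {n r : ℕ}
    (i : Fin r → Fin n) (E : ℕ → Submodule k M) (V : Submodule k M) : Prop :=
  finrank k ↥V = r ∧ ∀ a : Fin r, (a : ℕ) + 1 ≤ finrank k ↥(V ⊓ E ((i a : ℕ) + 1))

/-- The flag induced on a subspace `V` by a flag `E` on `M`: its `a`-th member is the
smallest subspace of the form `V ∩ E_u` of dimension `≥ a`. -/
def indSub {k M : Type*} [Field k] [AddCommGroup M] [Module k M]
    (E : ℕ → Submodule k M) (V : Submodule k M) : ℕ → Submodule k ↥V := fun a =>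
  ⨅ u ∈ {u : ℕ | a ≤ finrank k ↥(Submodule.comap V.subtype (E u))},
    Submodule.comap V.subtype (E u)

/-- The flag induced on the quotient `M ⧸ V` by a flag `E` on `M`: its `b`-th member is
the smallest subspace of the form `(E_u + V)/V` of dimension `≥ b`. -/
def indQuot {k M : Type*} [Field k] [AddCommGroup M] [Module k M]
    (E : ℕ → Submodule k M) (V : Submodule k M) : ℕ → Submodule k (M ⧸ V) := fun b =>
  ⨅ u ∈ {u : ℕ | b ≤ finrank k ↥(Submodule.map V.mkQ (E u))},
    Submodule.map V.mkQ (E u)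

/-- The flag spanned by a tuple of vectors (a complete flag when the tuple is a basis). -/
def spanFlag (k : Type*) {M : Type*} [Field k] [AddCommGroup M] [Module k M] {r : ℕ}
    (b : Fin r → M) : ℕ → Submodule k M := fun m =>
  Submodule.span k (b '' {a : Fin r | (a : ℕ) < m})

/-- `P` holds for a generic point of `Fl(M)^s` (`r = dim M`): there is a nonempty Zariski
open set of `s`-tuples of bases of `M` on which the associated tuples of complete flags
satisfy `P`. -/
def GenericFlags (k : Type*) {M : Type*} [Field k] [AddCommGroup M] [Module k M]
    (s r : ℕ) (P : (Fin s → ℕ → Submodule k M) → Prop) : Prop :=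
  ∃ U : Set (Fin s → Fin r → M),
    @IsOpen _ (mZariski k (Fin s → Fin r → M)) U ∧
    (∃ b ∈ U, ∀ j, LinearIndependent k (b j)) ∧
    ∀ b ∈ U, (∀ j, LinearIndependent k (b j)) → P (fun j => spanFlag k (b j))

/-- `P` holds for a generic point of `Fl(M)^s × Fl(Q)^s` (`r = dim M`, `q = dim Q`). -/
def GenericFlagPairs (k : Type*) {M Q : Type*} [Field k] [AddCommGroup M] [Module k M]
    [AddCommGroup Q] [Module k Q] (s r q : ℕ)
    (P : (Fin s → ℕ → Submodule k M) → (Fin s → ℕ → Submodule k Q) → Prop) : Prop :=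
  ∃ U : Set ((Fin s → Fin r → M) × (Fin s → Fin q → Q)),
    @IsOpen _ (mZariski k ((Fin s → Fin r → M) × (Fin s → Fin q → Q))) U ∧
    (∃ b ∈ U, (∀ j, LinearIndependent k (b.1 j)) ∧ ∀ j, LinearIndependent k (b.2 j)) ∧
    ∀ b ∈ U, ((∀ j, LinearIndependent k (b.1 j)) ∧ ∀ j, LinearIndependent k (b.2 j)) →
      P (fun j => spanFlag k (b.1 j)) (fun j => spanFlag k (b.2 j))

/-! ### The spaces `Hom_𝓘(V, Q, 𝓕, 𝓖)` -/

/-- The subspace `{φ : M →ₗ Q | φ(p) ⊆ q}` of `Hom(M, Q)`. -/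
def homConstraint {k M Q : Type*} [Field k] [AddCommGroup M] [Module k M]
    [AddCommGroup Q] [Module k Q] (p : Submodule k M) (q : Submodule k Q) :
    Submodule k (M →ₗ[k] Q) :=
  LinearMap.ker ((LinearMap.llcomp k ↥p Q (Q ⧸ q) q.mkQ).comp (LinearMap.lcomp k Q p.subtype))

/-- `Hom_𝓘(M, Q, F, G) = {φ | φ(F^j_a) ⊆ G^j_{i^j_a - a} for all a = 1, …, r, j = 1, …, s}`. -/
def homSpace {k M Q : Type*} [Field k] [AddCommGroup M] [Module k M]
    [AddCommGroup Q] [Module k Q] {n r s : ℕ} (I : Fin s → Fin r → Fin n)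
    (F : Fin s → ℕ → Submodule k M) (G : Fin s → ℕ → Submodule k Q) :
    Submodule k (M →ₗ[k] Q) :=
  ⨅ j : Fin s, ⨅ a : Fin r,
    homConstraint (F j ((a : ℕ) + 1)) (G j ((I j a : ℕ) - (a : ℕ)))

/-! ### Charts on the Grassmannian, tangent spaces to Schubert cells -/

/-- The graph of `ψ : V →ₗ C`, a point of the Grassmannian chart around `V`
determined by a complement `C` of `V`. -/
def graphMap {k M : Type*} [Field k] [AddCommGroup M] [Module k M]
    (V C : Submodule k M) (ψ : ↥V →ₗ[k] ↥C) : Submodule k M :=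
  LinearMap.range (V.subtype + C.subtype ∘ₗ ψ)

/-- The canonical identification `Hom(V, C) ≃ Hom(V, M/V)` (derivative of the chart). -/
def conjMap {k M : Type*} [Field k] [AddCommGroup M] [Module k M]
    (V C : Submodule k M) : (↥V →ₗ[k] ↥C) →ₗ[k] (↥V →ₗ[k] M ⧸ V) :=
  LinearMap.llcomp k ↥V ↥C (M ⧸ V) (V.mkQ ∘ₗ C.subtype)

/-- The tangent space at `V` to a set `S` of points of the Grassmannian `Gr(r, M)`,
computed in the chart determined by a complement `C` of `V` and viewed inside
`Hom(V, M/V)` via the canonical identification. -/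
def grTangent {k M : Type*} [Field k] [AddCommGroup M] [Module k M]
    (S : Set (Submodule k M)) (V C : Submodule k M) :
    Submodule k (↥V →ₗ[k] (M ⧸ V)) :=
  Submodule.map (conjMap V C)
    (mTangent k {ψ : ↥V →ₗ[k] ↥C | graphMap V C ψ ∈ S} 0)

/-- The Zariski topology on the Grassmannian of `r`-dimensional subspaces of `M`
(as a topology on `Submodule k M`), coinduced from the Stiefel parameterization by
spanning `r`-tuples. -/
def grTop (k : Type*) {M : Type*} [Field k] [AddCommGroup M] [Module k M] (r : ℕ) :
    TopologicalSpace (Submodule k M) :=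
  TopologicalSpace.coinduced (fun b : Fin r → M => Submodule.span k (Set.range b))
    (mZariski k (Fin r → M))

/-! ### Numerical quantities -/

/-- `codim ω_I = ∑_{a=1}^r (n - r + a - i_a)` (as an integer). -/
def codimZ (n r : ℕ) (i : Fin r → Fin n) : ℤ :=
  ∑ a : Fin r, ((n : ℤ) - (r : ℤ) + ((a : ℕ) : ℤ) - ((i a : ℕ) : ℤ))

/-- The quantity `∑_j ∑_{a ∈ K^j} (n - r + a - i^j_a) - d(n - r)` of Inequality `(†^𝓘_𝓚)`. -/
def daggerZ (n r d : ℕ) {s : ℕ} (I : Fin s → Fin r → Fin n)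
    (K : Fin s → Fin d → Fin r) : ℤ :=
  (∑ j : Fin s, ∑ t : Fin d,
      ((n : ℤ) - (r : ℤ) + ((K j t : ℕ) : ℤ) - ((I j (K j t) : ℕ) : ℤ)))
    - (d : ℤ) * ((n : ℤ) - (r : ℤ))

/-- The expected dimension `dim(S, M, 𝓕) = d(m - d) - ∑_j ∑_{t=1}^d (m - d + t - k^j_t)`
of an intersection of Schubert cells `Ω°_{K^j}` in `Gr(d, m)`. -/
def eDimZ {s : ℕ} (m d : ℕ) (K : Fin s → Fin d → Fin m) : ℤ :=
  (d : ℤ) * ((m : ℤ) - (d : ℤ)) -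
    ∑ j : Fin s, ∑ t : Fin d,
      ((m : ℤ) - (d : ℤ) + ((t : ℕ) : ℤ) - ((K j t : ℕ) : ℤ))

/-- `codim ω_I` as a natural number. -/
def codimN (n r : ℕ) (i : Fin r → Fin n) : ℕ :=
  ∑ a : Fin r, ((n - r + (a : ℕ)) - (i a : ℕ))

/-! ### The cohomology ring of the Grassmannian, Schubert classes -/

/-- The ideal `(h_{n-r+1}, …, h_n)` of the polynomial ring in `r` variables
(`h_m` the complete homogeneous symmetric polynomials). -/
def grassIdeal (r n : ℕ) : Ideal (MvPolynomial (Fin r) ℤ) :=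
  Ideal.span ((fun m : ℕ => MvPolynomial.hsymm (Fin r) ℤ m) '' Set.Icc (n - r + 1) n)

/-- A presentation of the cohomology (Chow) ring `H^*(Gr(r,n))`: products of Schubert
classes vanish here exactly when they vanish in `H^*(Gr(r,n))`. -/
abbrev grassRing (r n : ℕ) : Type :=
  MvPolynomial (Fin r) ℤ ⧸ grassIdeal r n

/-- `h_m` for an integer `m` (zero for negative `m`). -/
def hkZ (r : ℕ) (m : ℤ) : MvPolynomial (Fin r) ℤ :=
  if 0 ≤ m then MvPolynomial.hsymm (Fin r) ℤ m.toNat else 0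

/-- The Schur polynomial (Jacobi–Trudi determinant) of the partition
`λ_a = n - r + a - i_a` attached to the subset `I ⊆ [n]` recorded by `i`. -/
def schurI {n r : ℕ} (i : Fin r → Fin n) : MvPolynomial (Fin r) ℤ :=
  Matrix.det (Matrix.of fun a b : Fin r =>
    hkZ r ((n : ℤ) - (r : ℤ) + ((b : ℕ) : ℤ) - ((i a : ℕ) : ℤ)))

/-- The Schubert class `ω_I ∈ H^*(Gr(r,n))` of the subset `I ⊆ [n]` recorded by the
strictly increasing tuple `i : Fin r → Fin n`. -/
def omegaCls {n r : ℕ} (i : Fin r → Fin n) : grassRing r n :=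
  Ideal.Quotient.mk (grassIdeal r n) (schurI i)

/-- The class of a point in `H^*(Gr(r,n))`: the Schubert class of `I = {1, …, r}`. -/
def pointCls (r n : ℕ) (h : r ≤ n) : grassRing r n :=
  omegaCls (fun a : Fin r => Fin.castLE h a)

/-! ### Schur polynomials of partitions, Littlewood–Richardson coefficients -/

/-- The Schur polynomial of a partition with at most `r` parts, via Jacobi–Trudi. -/
def schurP {r : ℕ} (lam : Fin r → ℕ) : MvPolynomial (Fin r) ℤ :=
  Matrix.det (Matrix.of fun a b : Fin r =>
    hkZ r (((lam a : ℕ) : ℤ) - ((a : ℕ) : ℤ) + ((b : ℕ) : ℤ)))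

/-- The Vandermonde alternant `a_δ = det(x_a^{r-1-b})`. -/
def alternant (r : ℕ) : MvPolynomial (Fin r) ℤ :=
  Matrix.det (Matrix.of fun a b : Fin r => (MvPolynomial.X a) ^ (r - 1 - (b : ℕ)))

/-- The coefficient of the Schur polynomial `s_δ` in a symmetric polynomial `f`
(in `r` variables): the coefficient of the monomial `x^{δ + (r-1, …, 1, 0)}` in `f ⬝ a_δ`. -/
def schurCoeff (r : ℕ) (f : MvPolynomial (Fin r) ℤ) (δ : Fin r → ℕ) : ℤ :=
  MvPolynomial.coeff
    (Finsupp.equivFunOnFinite.symm (fun a : Fin r => δ a + (r - 1 - (a : ℕ))))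
    (f * alternant r)

/-- The Littlewood–Richardson coefficient `c^λ_{μ,ν}` (partitions with at most `r` parts):
the multiplicity of `V_λ` in `V_μ ⊗ V_ν`, i.e. of `s_λ` in `s_μ s_ν`. -/
def lrCoeff (r : ℕ) (lam mu nu : Fin r → ℕ) : ℤ :=
  schurCoeff r (schurP mu * schurP nu) lam

/-- The multiplicity of `V_δ` in `V_{Λ 1} ⊗ ⋯ ⊗ V_{Λ t}` (as `GL(r)`-representations),
i.e. of `s_δ` in `∏_j s_{Λ j}`. -/
def multiCoeff (r : ℕ) {t : ℕ} (Λ : Fin t → Fin r → ℕ) (δ : Fin r → ℕ) : ℤ :=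
  schurCoeff r (∏ j : Fin t, schurP (Λ j)) δ

/-- Generic Noether normalization. -/
theorem exists_generic_noether (A B : Type) [CommRing A] [IsDomain A] [CommRing B] [IsDomain B]
    [Algebra A B] [Algebra.FiniteType A B] (hinj : Function.Injective (algebraMap A B)) :
    ∃ (e : ℕ) (t : Fin e → B), AlgebraicIndependent A t ∧
      ∀ x : B, ∃ (F : Polynomial (MvPolynomial (Fin e) A)) (a : A), a ≠ 0 ∧
        F.leadingCoeff = MvPolynomial.C a ∧
        F.eval₂ (MvPolynomial.aeval t).toRingHom x = 0 := by
  classical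
  let K := FractionRing A
  let S := TensorProduct A K B
  let M := nonZeroDivisors A
  have hM : Algebra.algebraMapSubmonoid B M ≤ nonZeroDivisors B := by
    rintro _ ⟨a, ha, rfl⟩
    refine mem_nonZeroDivisors_of_ne_zero ?_
    rw [Ne, map_eq_zero_iff _ hinj]
    exact nonZeroDivisors.ne_zero ha
  let inc : B →ₐ[A] S := Algebra.TensorProduct.includeRight
  let : Algebra B S := Algebra.TensorProduct.rightAlgebra
  have hinc : ∀ b, algebraMap B S b = inc b := fun b => rfl
  have : IsLocalization (Algebra.algebraMapSubmonoid B M) S := inferInstance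
  have : IsDomain S := IsLocalization.isDomain_of_le_nonZeroDivisors S hM
  have hincinj : Function.Injective (algebraMap B S) := IsLocalization.injective S hM
  obtain ⟨e, g, ginj, gint⟩ := exists_integral_inj_algHom_of_fg K S
  have h1 : ∀ i : Fin e, ∃ (a : A) (b : B), a ≠ 0 ∧ algebraMap A S a * g (MvPolynomial.X i) = algebraMap B S b := by
    intro i
    obtain ⟨⟨b, m, a, ha, rfl⟩, hb⟩ := IsLocalization.surj (Algebra.algebraMapSubmonoid B M) (g (MvPolynomial.X i))
    refine ⟨a, b, nonZeroDivisors.ne_zero ha, ?_⟩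
    rw [← hb, mul_comm]
    congr 1
    simp [hinc]
  choose a b ha hb using h1
  have haK : ∀ i, algebraMap A K (a i) ≠ 0 := fun i => by
    rw [Ne, map_eq_zero_iff _ (IsFractionRing.injective A K)]; exact ha i
  let sc : MvPolynomial (Fin e) K ≃ₐ[K] MvPolynomial (Fin e) K := AlgEquiv.ofAlgHom
    (MvPolynomial.aeval fun i => MvPolynomial.C (algebraMap A K (a i)) * MvPolynomial.X i)
    (MvPolynomial.aeval fun i => MvPolynomial.C (algebraMap A K (a i))⁻¹ * MvPolynomial.X i)
    (by ext i; simp [← mul_assoc, ← MvPolynomial.C_mul, haK i])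
    (by ext i; simp [← mul_assoc, ← MvPolynomial.C_mul, haK i])
  let g' : MvPolynomial (Fin e) K →ₐ[K] S := g.comp sc.toAlgHom
  have g'inj : Function.Injective g' := by
    intro x y h
    exact sc.injective (ginj h)
  have g'int : g'.toRingHom.IsIntegral := by
    exact RingHom.IsIntegral.trans (sc.toAlgHom.toRingHom) g.toRingHom (RingHom.isIntegral_of_surjective _ sc.surjective) gint
  have g'X : ∀ i, g' (MvPolynomial.X i) = algebraMap B S (b i) := by
    intro i
    rw [← hb]
    simp only [g', sc, AlgHom.comp_apply]
    simp [MvPolynomial.algHom_C]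
    left
    rw [IsScalarTower.algebraMap_apply A K S]
  let Kt := MvPolynomial (Fin e) K
  let At := MvPolynomial (Fin e) A
  let : Algebra At Kt := MvPolynomial.algebraMvPolynomial
  have halg : ∀ p : At, algebraMap At Kt p = MvPolynomial.map (algebraMap A K) p := fun p => rfl
  have hcomp : (algebraMap B S).comp (MvPolynomial.aeval b).toRingHom = g'.toRingHom.comp (algebraMap At Kt) := by
    apply MvPolynomial.ringHom_ext
    · intro x
      simp [halg, hinc, MvPolynomial.algHom_C]
      rw [IsScalarTower.algebraMap_apply A K S]
    · intro i
      simp [halg, g'X]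
  have hAK : Function.Injective (algebraMap At Kt) := by
    intro x y h
    exact MvPolynomial.map_injective _ (IsFractionRing.injective A K) h
  refine ⟨e, b, ?_, ?_⟩
  · intro x y h
    apply hAK
    apply g'inj
    have := fun z => RingHom.congr_fun hcomp z
    simp only [RingHom.comp_apply] at this
    refine ((this x).symm.trans ?_).trans (this y)
    exact congrArg _ h
  · intro x
    obtain ⟨p, hp, hpx⟩ := g'int (algebraMap B S x)
    let N := M.map (MvPolynomial.C (σ := Fin e))
    have : IsLocalization N Kt := MvPolynomial.isLocalization M K
    obtain ⟨c, ⟨a', ha', rfl⟩, hc⟩ := IsLocalization.integerNormalization_spec N p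
    have hz := IsLocalization.integerNormalization_eval₂_eq_zero (M := N) g'.toRingHom p hpx
    rw [← hcomp, ← Polynomial.hom_eval₂] at hz
    refine ⟨_, a', nonZeroDivisors.ne_zero ha', ?_, hincinj (hz.trans (map_zero _).symm)⟩
    apply hAK
    rw [← Polynomial.leadingCoeff_map_of_injective hAK, hc, ← IsScalarTower.algebraMap_smul Kt, Polynomial.leadingCoeff_smul_of_smul_regular]
    · simp [hp.leadingCoeff]
      rfl
    · apply IsSMulRegular.of_ne_zero
      rw [Ne, map_eq_zero_iff _ hAK]
      exact fun h0 => nonZeroDivisors.ne_zero ha' (MvPolynomial.C_eq_zero.mp h0)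

theorem ringKrullDim_le_of_isIntegral {R S : Type} [CommRing R] [CommRing S] (f : R →+* S)
    (hf : f.IsIntegral) : ringKrullDim S ≤ ringKrullDim R := by
  algebraize [f]
  refine Order.krullDim_le_of_strictMono (PrimeSpectrum.comap (algebraMap R S)) ?_
  intro I J h
  exact Ideal.IsIntegral.comap_lt_comap (R := R) (I := I.asIdeal) (J := J.asIdeal) h

theorem ringKrullDim_eq_of_isIntegral {R S : Type} [CommRing R] [CommRing S] [IsDomain S]
    (f : R →+* S) (hf : f.IsIntegral) (hinj : Function.Injective f) :
    ringKrullDim S = ringKrullDim R := by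
  refine le_antisymm (ringKrullDim_le_of_isIntegral f hf) ?_
  algebraize [f]
  refine iSup_le fun l => ?_
  have : FaithfulSMul R S := (faithfulSMul_iff_algebraMap_injective R S).mpr hinj
  obtain ⟨P, hP, hl⟩ := Ideal.exists_ideal_over_prime_of_isIntegral (S := S) l.head.asIdeal (⊥ : Ideal S)
    (by rw [Ideal.comap_bot_of_injective (algebraMap R S) hinj]; exact bot_le)
  obtain ⟨hP, hl⟩ := hl
  have : P.LiesOver l.head.asIdeal := ⟨hl.symm⟩
  obtain ⟨L, h1, -, -⟩ := Ideal.exists_ltSeries_of_hasGoingUp l P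
  rw [← h1]
  exact le_iSup (fun l : LTSeries (PrimeSpectrum S) => (l.length : WithBot ℕ∞)) L

theorem ringKrullDim_mvPolynomial_field (k β : Type) [Field k] [Fintype β] :
    ringKrullDim (MvPolynomial β k) = (Fintype.card β : ℕ) := by
  rw [MvPolynomial.ringKrullDim_of_isNoetherianRing, ringKrullDim_eq_zero_of_field, zero_add,
    Nat.card_eq_fintype_card]

theorem ringKrullDim_eq_trdeg (k R : Type) [Field k] [CommRing R] [IsDomain R] [Algebra k R]
    [Algebra.FiniteType k R] :
    ∃ e : ℕ, ringKrullDim R = e ∧ Algebra.trdeg k R = e := by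
  obtain ⟨e, g, ginj, gint⟩ := exists_integral_inj_algHom_of_fg k R
  refine ⟨e, ?_, ?_⟩
  · rw [ringKrullDim_eq_of_isIntegral g.toRingHom gint ginj, ringKrullDim_mvPolynomial_field,
      Fintype.card_fin]
  · let _ : Algebra (MvPolynomial (Fin e) k) R := g.toRingHom.toAlgebra
    have : IsScalarTower k (MvPolynomial (Fin e) k) R := IsScalarTower.of_algebraMap_eq
      fun x => (g.commutes x).symm
    have : FaithfulSMul (MvPolynomial (Fin e) k) R := (faithfulSMul_iff_algebraMap_injective _ R).mpr ginj
    have : Algebra.IsIntegral (MvPolynomial (Fin e) k) R := ⟨gint⟩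
    rw [← _root_.trdeg_add_eq (R := k) (S := MvPolynomial (Fin e) k) (A := R),
      MvPolynomial.trdeg_of_isDomain, trdeg_eq_zero]
    simp

theorem ringKrullDim_le_of_injective (k : Type) {R D : Type} [Field k] [CommRing R] [CommRing D] [IsDomain R]
    [IsDomain D] [Algebra k R] [Algebra k D] [Algebra.FiniteType k R] [Algebra.FiniteType k D]
    (f : R →ₐ[k] D) (hf : Function.Injective f) : ringKrullDim R ≤ ringKrullDim D := by
  obtain ⟨e, h1, h2⟩ := ringKrullDim_eq_trdeg k R
  obtain ⟨e', h1', h2'⟩ := ringKrullDim_eq_trdeg k D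
  rw [h1, h1']
  have := trdeg_le_of_injective f hf
  rw [h2, h2'] at this
  exact_mod_cast this

/-- All maximal ideals of a polynomial ring over an algebraically closed field have full height. -/
theorem height_maximal_mvPolynomial {k β : Type} [Field k] [IsAlgClosed k] [Fintype β]
    (m : Ideal (MvPolynomial β k)) (hm : m.IsMaximal) : m.height = (Fintype.card β : ℕ) := by
  have key : ∀ m : Ideal (MvPolynomial β k), m.IsMaximal →
      m.height = (MvPolynomial.vanishingIdeal k {(0 : β → k)}).height := by
    intro m hm
    obtain ⟨x, rfl⟩ := MvPolynomial.isMaximal_iff_eq_vanishingIdeal_singleton.mp hm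
    let τ : MvPolynomial β k ≃ₐ[k] MvPolynomial β k := AlgEquiv.ofAlgHom
      (MvPolynomial.aeval fun i => MvPolynomial.X i - MvPolynomial.C (x i))
      (MvPolynomial.aeval fun i => MvPolynomial.X i + MvPolynomial.C (x i))
      (by ext i; simp [MvPolynomial.algHom_C]) (by ext i; simp [MvPolynomial.algHom_C])
    rw [← RingEquiv.height_comap τ.toRingEquiv]
    congr 1
    ext p
    simp only [Ideal.mem_comap, MvPolynomial.mem_vanishingIdeal_singleton_iff]
    have : (MvPolynomial.aeval x).comp τ.toAlgHom = MvPolynomial.aeval (R := k) (0 : β → k) := by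
      ext i
      simp [τ]
    have h2 := AlgHom.congr_fun this p
    rw [← h2]
    rfl
  have h := Ideal.sup_isMaximal_height_eq_ringKrullDim (R := MvPolynomial β k)
  rw [ringKrullDim_mvPolynomial_field] at h
  rw [key m hm]
  have h3 : (⨆ (I : Ideal (MvPolynomial β k)) (_ : I.IsMaximal), I.height) =
      (MvPolynomial.vanishingIdeal k {(0 : β → k)}).height := by
    apply le_antisymm
    · exact iSup₂_le fun I hI => (key I hI).le
    · rw [← key m hm]
      exact le_iSup₂ (f := fun (I : Ideal (MvPolynomial β k)) (_ : I.IsMaximal) => I.height) m hm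
  rw [h3] at h
  exact_mod_cast h

theorem card_le_ringKrullDim_minimalPrime {k α β : Type} [Field k] [IsAlgClosed k] [Fintype α]
    [Fintype β] (s : α → MvPolynomial β k) (P : Ideal (MvPolynomial β k))
    (hP : P ∈ (Ideal.span (Set.range s)).minimalPrimes) :
    ((Fintype.card β : ℕ) : WithBot ℕ∞) ≤
      ringKrullDim (MvPolynomial β k ⧸ P) + (Fintype.card α : ℕ) := by
  classical
  set I := Ideal.span (Set.range s) with hI
  have hPp : P.IsPrime := hP.1.1
  have hfin := Ideal.finite_minimalPrimes_of_isNoetherianRing (MvPolynomial β k) I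
  have h1 : ∃ g, g ∉ P ∧ ∀ Q ∈ I.minimalPrimes, Q ≠ P → g ∈ Q := by
    let T := hfin.toFinset.erase P
    have hle : ¬ (T.inf id ≤ P) := by
      rw [hPp.inf_le']
      rintro ⟨Q, hQ, hle⟩
      simp only [T, Finset.mem_erase, Set.Finite.mem_toFinset] at hQ
      have := hP.2 hQ.2.1 hle
      exact hQ.1 (le_antisymm hle this)
    obtain ⟨g, hg, hgP⟩ := SetLike.not_le_iff_exists.mp hle
    refine ⟨g, hgP, fun Q hQ hne => ?_⟩
    have : T.inf id ≤ Q := Finset.inf_le (f := id) (by simp [T, hne, hQ])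
    exact this hg
  obtain ⟨g, hgP, hg⟩ := h1
  have h2 : ∃ m : Ideal (MvPolynomial β k), m.IsMaximal ∧ P ≤ m ∧ g ∉ m := by
    by_contra hcon
    push Not at hcon
    apply hgP
    have hj : P.jacobson = P := IsJacobsonRing.out inferInstance hPp.isRadical
    rw [← hj, Ideal.jacobson, Ideal.mem_sInf]
    rintro m ⟨hm1, hm2⟩
    exact hcon m hm2 hm1
  obtain ⟨m, hm, hPm, hgm⟩ := h2
  have hIm : I ≤ m := hP.1.2.trans hPm
  have hsub : Set.range s ⊆ m := by rwa [← SetLike.coe_subset_coe, hI, SetLike.coe_subset_coe, Ideal.span_le] at hIm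
  have hmp := hm.isPrime
  have h3 := Ideal.height_le_height_add_encard_of_subset (Set.range s) (p := m) hsub
  rw [height_maximal_mvPolynomial m hm] at h3
  have henc : (Set.range s).encard ≤ (Fintype.card α : ℕ) := by
    rw [← Set.image_univ]
    refine (Set.encard_image_le s Set.univ).trans ?_
    simp [Set.encard_univ]
  let mb := m.map (Ideal.Quotient.mk I)
  have hker : RingHom.ker (Ideal.Quotient.mk I) ≤ m := by rwa [Ideal.mk_ker]
  have hmb : mb.IsPrime := Ideal.map_isPrime_of_surjective Ideal.Quotient.mk_surjective hker
  have h4 : (mb.height : WithBot ℕ∞) ≤ ringKrullDim (MvPolynomial β k ⧸ P) := by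
    rw [PrimeSpectrum.height_eq_orderHeight ⟨mb, hmb⟩, Order.height_eq_krullDim_Iic, ringKrullDim_quotient]
    have hmem : ∀ Q : Set.Iic (⟨mb, hmb⟩ : PrimeSpectrum (MvPolynomial β k ⧸ I)),
        PrimeSpectrum.comap (Ideal.Quotient.mk I) Q.1 ∈ PrimeSpectrum.zeroLocus (P : Set (MvPolynomial β k)) := by
      rintro ⟨Q, hQ⟩
      rw [PrimeSpectrum.mem_zeroLocus, SetLike.coe_subset_coe]
      have hle : (PrimeSpectrum.comap (Ideal.Quotient.mk I) Q).asIdeal ≤ m := by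
        have : Q.asIdeal ≤ mb := hQ
        refine (Ideal.comap_mono this).trans ?_
        rw [Ideal.comap_map_of_surjective' _ Ideal.Quotient.mk_surjective, sup_eq_left.mpr hker]
      have hI' : I ≤ (PrimeSpectrum.comap (Ideal.Quotient.mk I) Q).asIdeal := by
        intro x hx
        simp [Ideal.Quotient.eq_zero_iff_mem.mpr hx]
      obtain ⟨R, hR, hRle⟩ := Ideal.exists_minimalPrimes_le hI'
      by_cases hRP : R = P
      · rwa [← hRP]
      · exact absurd (hle (hRle (hg R hR hRP))) hgm
    refine Order.krullDim_le_of_strictMono (fun Q => ⟨_, hmem Q⟩) ?_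
    rintro ⟨Q, hQ⟩ ⟨Q', hQ'⟩ hlt
    have h5 : Q < Q' := hlt
    have h6 : Q.asIdeal < Q'.asIdeal := h5
    change Ideal.comap _ Q.asIdeal < Ideal.comap _ Q'.asIdeal
    refine lt_of_le_of_ne (Ideal.comap_mono h6.le) fun he => ?_
    exact h6.ne (Ideal.comap_injective_of_surjective _ Ideal.Quotient.mk_surjective he)
  have h7 : ((Fintype.card β : ℕ) : ℕ∞) ≤ mb.height + (Fintype.card α : ℕ) :=
    h3.trans (by gcongr)
  have h8 : ((Fintype.card β : ℕ) : WithBot ℕ∞) ≤ (mb.height : WithBot ℕ∞) + (Fintype.card α : ℕ) := by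
    exact_mod_cast h7
  refine h8.trans ?_
  gcongr

theorem isIntegralElem_of_leadingCoeff_isUnit {R S : Type} [CommRing R] [CommRing S] (f : R →+* S)
    (x : S) (p : Polynomial R) (hp : IsUnit p.leadingCoeff) (hx : p.eval₂ f x = 0) :
    f.IsIntegralElem x := by
  obtain ⟨u, hu⟩ := hp
  refine ⟨Polynomial.C (↑u⁻¹ : R) * p, ?_, ?_⟩
  · apply Polynomial.monic_C_mul_of_mul_leadingCoeff_eq_one
    rw [← hu]; simp
  · rw [Polynomial.eval₂_mul, hx, mul_zero]

theorem generic_fibre {k α β : Type} [Field k] [IsAlgClosed k] [Fintype α]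
    [Fintype β] (φ : α → MvPolynomial β k) (h : MvPolynomial β k) (hh : h ≠ 0) :
    ∃ f : MvPolynomial α k, f ≠ 0 ∧ ∀ y : α → k, MvPolynomial.eval y f ≠ 0 →
      ∀ P ∈ (Ideal.span (Set.range fun a => φ a - MvPolynomial.C (y a))).minimalPrimes,
        h ∉ P ∧ ringKrullDim (MvPolynomial β k ⧸ P) + (Fintype.card α : ℕ) =
          (Fintype.card β : ℕ) := by
  classical
  let A := MvPolynomial α k
  let B := MvPolynomial β k
  let ψ : A →ₐ[k] B := MvPolynomial.aeval φ
  have hψC : ∀ x, ψ (MvPolynomial.C x) = MvPolynomial.C x := fun x => MvPolynomial.aeval_C φ x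
  have hψX : ∀ a, ψ (MvPolynomial.X a) = φ a := fun a => MvPolynomial.aeval_X φ a
  -- evaluation modulo an ideal containing the fibre equations
  have hmod : ∀ (y : α → k) (P : Ideal B),
      Ideal.span (Set.range fun a => φ a - MvPolynomial.C (y a)) ≤ P → ∀ p : A,
      Ideal.Quotient.mk P (ψ p) = Ideal.Quotient.mk P (MvPolynomial.C (MvPolynomial.eval y p)) := by
    intro y P hP p
    have : (Ideal.Quotient.mk P).comp ψ.toRingHom =
        ((Ideal.Quotient.mk P).comp MvPolynomial.C).comp (MvPolynomial.eval y) := by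
      apply MvPolynomial.ringHom_ext
      · intro x
        have := hψC x
        simpa using congrArg (Ideal.Quotient.mk P) this
      · intro a
        have := hψX a
        simp only [AlgHom.toRingHom_eq_coe, RingHom.comp_apply, RingHom.coe_coe, MvPolynomial.eval_X]
        refine (congrArg (Ideal.Quotient.mk P) this).trans ?_
        rw [Ideal.Quotient.eq]
        exact hP (Ideal.subset_span ⟨a, rfl⟩)
    exact RingHom.congr_fun this p
  by_cases hψ : Function.Injective ψ
  swap
  · rw [injective_iff_map_eq_zero] at hψ
    push Not at hψ
    obtain ⟨f, hf0, hf⟩ := hψ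
    refine ⟨f, hf, fun y hy P hP => ?_⟩
    exfalso
    have h1 := hmod y P hP.1.2 f
    rw [hf0, map_zero, eq_comm, Ideal.Quotient.eq_zero_iff_mem] at h1
    apply hP.1.1.ne_top
    refine Ideal.eq_top_of_isUnit_mem _ h1 ?_
    exact (isUnit_iff_ne_zero.mpr hy).map MvPolynomial.C
  let _ : Algebra A B := ψ.toRingHom.toAlgebra
  have hAB : ∀ p : A, algebraMap A B p = ψ p := fun p => rfl
  have : IsScalarTower k A B := IsScalarTower.of_algebraMap_eq fun x => (ψ.commutes x).symm
  have : FaithfulSMul A B := (faithfulSMul_iff_algebraMap_injective A B).mpr hψ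
  have : Algebra.FiniteType A B := Algebra.FiniteType.of_restrictScalars_finiteType k A B
  obtain ⟨e, t, ht, hF⟩ := exists_generic_noether A B hψ
  choose F a ha hFl hF0 using hF
  let At := MvPolynomial (Fin e) A
  let θ : At →ₐ[A] B := MvPolynomial.aeval t
  have hθ : Function.Injective θ := ht
  let _ : Algebra At B := θ.toRingHom.toAlgebra
  have hθa : ∀ p : At, algebraMap At B p = θ p := fun p => rfl
  have : IsScalarTower A At B := IsScalarTower.of_algebraMap_eq fun x => (θ.commutes x).symm
  have : FaithfulSMul At B := (faithfulSMul_iff_algebraMap_injective At B).mpr hθ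
  have : Algebra.IsAlgebraic At B := by
    refine ⟨fun x => ⟨F x, ?_, hF0 x⟩⟩
    intro h0
    have := hFl x
    rw [h0, Polynomial.leadingCoeff_zero, eq_comm, MvPolynomial.C_eq_zero] at this
    exact ha x this
  have hcard : e + Fintype.card α = Fintype.card β := by
    have h1 := trdeg_add_eq k A (A := B)
    have h2 := trdeg_add_eq A At (A := B)
    have h0 : Algebra.trdeg At B = 0 := trdeg_eq_zero
    have h4 : Algebra.trdeg A At = _ := MvPolynomial.trdeg_of_isDomain
    have h5 : Algebra.trdeg k A = _ := MvPolynomial.trdeg_of_isDomain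
    have h6 : Algebra.trdeg k B = _ := MvPolynomial.trdeg_of_isDomain
    rw [h0, add_zero, h4] at h2
    rw [← h2, h5, h6] at h1
    simp only [Cardinal.mk_fintype, Cardinal.lift_id, Fintype.card_fin] at h1
    have h3 : Fintype.card α + e = Fintype.card β := by exact_mod_cast h1
    omega
  obtain ⟨q, hq0, hqh⟩ := (Algebra.IsAlgebraic.isAlgebraic (R := At) h).exists_nonzero_coeff_and_aeval_eq_zero
    (mem_nonZeroDivisors_of_ne_zero hh)
  obtain ⟨m, hm⟩ := MvPolynomial.exists_coeff_ne_zero hq0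
  refine ⟨(∏ b : β, a (MvPolynomial.X b)) * (q.coeff 0).coeff m,
    mul_ne_zero (Finset.prod_ne_zero_iff.mpr fun b _ => ha _) hm, fun y hy P hP => ?_⟩
  rw [map_mul, mul_ne_zero_iff, map_prod, Finset.prod_ne_zero_iff] at hy
  obtain ⟨hy1, hy2⟩ := hy
  have hPp : P.IsPrime := hP.1.1
  let D := B ⧸ P
  let π : B →ₐ[k] D := Ideal.Quotient.mkₐ k P
  let σ : MvPolynomial (Fin e) k →ₐ[k] D := MvPolynomial.aeval fun i => π (t i)
  let ε : At →+* MvPolynomial (Fin e) k := MvPolynomial.map (MvPolynomial.eval y)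
  have hθC : ∀ p, θ (MvPolynomial.C p) = ψ p := fun p => MvPolynomial.aeval_C t p
  have hθX : ∀ i, θ (MvPolynomial.X i) = t i := fun i => MvPolynomial.aeval_X t i
  have hεC : ∀ p, ε (MvPolynomial.C p) = MvPolynomial.C (MvPolynomial.eval y p) :=
    fun p => MvPolynomial.map_C _ p
  have hεX : ∀ i, ε (MvPolynomial.X i) = MvPolynomial.X i := fun i => MvPolynomial.map_X _ i
  have hπC : ∀ x, π (MvPolynomial.C x) = algebraMap k D x := fun x => rfl
  have hσ : π.toRingHom.comp θ.toRingHom = σ.toRingHom.comp ε := by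
    apply MvPolynomial.ringHom_ext
    · intro p
      change π (θ (MvPolynomial.C p)) = σ (ε (MvPolynomial.C p))
      rw [hεC, hθC, MvPolynomial.algHom_C]
      exact hmod y P hP.1.2 p
    · intro i
      change π (θ (MvPolynomial.X i)) = σ (ε (MvPolynomial.X i))
      rw [hεX, hθX]
      simp [σ]
  have hint : σ.toRingHom.IsIntegral := by
    have hX : ∀ p : B, σ.toRingHom.IsIntegralElem (π p) := by
      intro p
      induction p using MvPolynomial.induction_on with
      | C x => 
        have : π (MvPolynomial.C x) = σ.toRingHom (MvPolynomial.C x) := by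
          rw [hπC]
          exact (MvPolynomial.algHom_C σ x).symm
        rw [this]
        exact RingHom.isIntegralElem_map _
      | add p q hp hq => rw [map_add]; exact hp.add _ hq
      | mul_X p b hp =>
        rw [map_mul]
        refine hp.mul _ ?_
        have hlc : ε (F (MvPolynomial.X b)).leadingCoeff ≠ 0 := by
          rw [hFl, hεC]
          simpa using hy1 b (Finset.mem_univ _)
        refine isIntegralElem_of_leadingCoeff_isUnit _ _ ((F (MvPolynomial.X b)).map ε) ?_ ?_
        · rw [Polynomial.leadingCoeff_map_of_leadingCoeff_ne_zero _ hlc, hFl]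
          rw [hεC]
          exact (isUnit_iff_ne_zero.mpr (hy1 b (Finset.mem_univ _))).map MvPolynomial.C
        · rw [Polynomial.eval₂_map, ← hσ]
          have := Polynomial.hom_eval₂ (F (MvPolynomial.X b)) θ.toRingHom π.toRingHom (MvPolynomial.X b)
          refine this.symm.trans ?_
          have h2 := hF0 (MvPolynomial.X b)
          exact (congrArg π h2).trans (map_zero _)
    intro x
    obtain ⟨p, rfl⟩ := Ideal.Quotient.mk_surjective x
    exact hX p
  have hlow := card_le_ringKrullDim_minimalPrime _ P hP
  obtain ⟨δ, hδ, -⟩ := ringKrullDim_eq_trdeg k D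
  have hδ' : ringKrullDim (MvPolynomial β k ⧸ P) = δ := hδ
  have hup := ringKrullDim_le_of_isIntegral _ hint
  rw [ringKrullDim_mvPolynomial_field, Fintype.card_fin, hδ] at hup
  rw [hδ'] at hlow ⊢
  have h1 : δ ≤ e := by exact_mod_cast hup
  have h2 : Fintype.card β ≤ δ + Fintype.card α := by exact_mod_cast hlow
  have hδe : δ = e := by omega
  refine ⟨?_, by rw [hδe, ← hcard]; push_cast; rfl⟩
  have hσinj : Function.Injective σ := by
    rw [injective_iff_map_eq_zero]
    intro z hz
    by_contra hz0
    have h3 := ringKrullDim_succ_le_of_surjective σ.toRingHom.rangeRestrict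
      σ.toRingHom.rangeRestrict_surjective (mem_nonZeroDivisors_of_ne_zero hz0) (Subtype.ext hz)
    have h4 : (σ.toRingHom.range.subtype).IsIntegral := by
      have : (σ.toRingHom.range.subtype.comp σ.toRingHom.rangeRestrict).IsIntegral := hint
      exact RingHom.IsIntegral.tower_top _ _ this
    have h5 := ringKrullDim_le_of_isIntegral _ h4
    rw [ringKrullDim_mvPolynomial_field, Fintype.card_fin] at h3
    rw [hδ, hδe] at h5
    have h6 : ((e : ℕ) : WithBot ℕ∞) + 1 ≤ e := (by gcongr : ((e : ℕ) : WithBot ℕ∞) + 1 ≤ _ + 1).trans h3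
    have : e + 1 ≤ e := by exact_mod_cast h6
    omega
  intro hhP
  have h3 : π h = 0 := Ideal.Quotient.eq_zero_iff_mem.mpr hhP
  have h4 : π (Polynomial.aeval h q) = 0 := by rw [hqh, map_zero]
  have h5 : π (Polynomial.aeval h q) = σ (ε (q.coeff 0)) := by
    rw [Polynomial.aeval_def]
    have := Polynomial.hom_eval₂ q (algebraMap At B) π.toRingHom h
    refine this.trans ?_
    have h6 : π.toRingHom h = 0 := h3
    rw [h6, Polynomial.eval₂_at_zero]
    exact RingHom.congr_fun hσ (q.coeff 0)
  rw [h5] at h4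
  have h7 : ε (q.coeff 0) = 0 := hσinj (h4.trans (map_zero _).symm)
  apply hy2
  have := congrArg (MvPolynomial.coeff m) h7
  exact (MvPolynomial.coeff_map _ _ _).symm.trans this

section
open Topology

/-- The algebra of polynomial functions on a vector space. -/
def polyFun (k M : Type*) [Field k] [AddCommGroup M] [Module k M] : Subalgebra k (M → k) :=
  (MvPolynomial.aeval fun l : Module.Dual k M => (l : M → k)).range

section polyFun
variable {k M N : Type*} [Field k] [AddCommGroup M] [Module k M] [AddCommGroup N] [Module k N]

theorem aeval_dual_apply (p : MvPolynomial (Module.Dual k M) k) (x : M) :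
    (MvPolynomial.aeval (fun l : Module.Dual k M => (l : M → k)) p) x = mEval k x p := by
  have : ((Pi.evalAlgHom k (fun _ : M => k) x).comp
      (MvPolynomial.aeval fun l : Module.Dual k M => (l : M → k))) =
      MvPolynomial.aeval (fun l : Module.Dual k M => l x) := by
    ext l; simp
  have := DFunLike.congr_fun this p
  simpa [mEval, MvPolynomial.aeval_eq_eval] using this

theorem mem_polyFun {f : M → k} : f ∈ polyFun k M ↔ ∃ p, ∀ x, f x = mEval k x p := by
  constructor
  · rintro ⟨p, rfl⟩
    exact ⟨p, fun x => aeval_dual_apply p x⟩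
  · rintro ⟨p, hp⟩
    exact ⟨p, funext fun x => (aeval_dual_apply p x).trans (hp x).symm⟩

theorem mEval_mem_polyFun (p : MvPolynomial (Module.Dual k M) k) :
    (fun x => mEval k x p) ∈ polyFun k M := mem_polyFun.mpr ⟨p, fun _ => rfl⟩

theorem linear_mem_polyFun (l : M →ₗ[k] k) : (fun x => l x) ∈ polyFun k M :=
  mem_polyFun.mpr ⟨MvPolynomial.X l, fun x => by simp [mEval]⟩

theorem const_mem_polyFun (c : k) : (fun _ : M => c) ∈ polyFun k M :=
  (polyFun k M).algebraMap_mem c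

theorem comp_mem_of_mem_polyFun {X : Type*} {A : Subalgebra k (X → k)} {F : X → N}
    (hF : ∀ l : N →ₗ[k] k, (fun x => l (F x)) ∈ A) {f : N → k} (hf : f ∈ polyFun k N) :
    (fun x => f (F x)) ∈ A := by
  obtain ⟨p, hp⟩ := mem_polyFun.mp hf
  simp only [hp]
  clear hp hf
  induction p using MvPolynomial.induction_on with
  | C a =>
    simp only [mEval, MvPolynomial.eval_C]
    exact A.algebraMap_mem a
  | add p q hp hq =>
    simp only [mEval, map_add]
    exact A.add_mem hp hq
  | mul_X p l hp =>
    simp only [mEval, map_mul, MvPolynomial.eval_X]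
    exact A.mul_mem hp (hF l)

theorem comp_linear_mem_polyFun (L : M →ₗ[k] N) {f : N → k} (hf : f ∈ polyFun k N) :
    (fun x => f (L x)) ∈ polyFun k M :=
  comp_mem_of_mem_polyFun (fun l => linear_mem_polyFun (l ∘ₗ L)) hf

theorem dual_comp_mem_pi {X ι : Type*} [Finite ι] {A : Subalgebra k (X → k)} {F : X → ι → N}
    (hF : ∀ i, ∀ l : N →ₗ[k] k, (fun x => l (F x i)) ∈ A) (l : (ι → N) →ₗ[k] k) :
    (fun x => l (F x)) ∈ A := by
  classical
  let _ := Fintype.ofFinite ι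
  have : (fun x => l (F x)) = ∑ i, fun x => (l ∘ₗ LinearMap.single k (fun _ => N) i) (F x i) := by
    ext x
    conv_lhs => rw [← Finset.univ_sum_single (F x)]
    simp
  rw [this]
  exact A.sum_mem fun i _ => hF i _

theorem dual_comp_mem_self {X : Type*} {A : Subalgebra k (X → k)} {F : X → k}
    (hF : F ∈ A) (l : k →ₗ[k] k) : (fun x => l (F x)) ∈ A := by
  have : (fun x => l (F x)) = l 1 • F := by
    ext x
    have := l.map_smul (F x) 1
    simpa [mul_comm] using this
  rw [this]
  exact A.smul_mem hF _


theorem mem_polyFun_pi {β : Type*} [Finite β] {f : (β → k) → k} :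
    f ∈ polyFun k (β → k) ↔ ∃ p : MvPolynomial β k, ∀ x, f x = MvPolynomial.eval x p := by
  constructor
  · intro hf
    have hA : ∀ g : (β → k) → k, g ∈ (MvPolynomial.aeval (R := k)
        fun (b : β) (x : β → k) => x b).range ↔
        ∃ p : MvPolynomial β k, ∀ x, g x = MvPolynomial.eval x p := by
      have key : ∀ p x, (MvPolynomial.aeval (R := k) fun (b : β) (x : β → k) => x b) p x =
          MvPolynomial.eval x p := by
        intro p x
        induction p using MvPolynomial.induction_on with
        | C a => simp
        | add p q hp hq => simp [hp, hq]
        | mul_X p b hp => simp [hp]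
      intro g
      constructor
      · rintro ⟨p, rfl⟩; exact ⟨p, fun x => key p x⟩
      · rintro ⟨p, hp⟩; exact ⟨p, funext fun x => (key p x).trans (hp x).symm⟩
    rw [← hA]
    refine comp_mem_of_mem_polyFun (F := fun x : β → k => x) (fun l => ?_) hf
    refine dual_comp_mem_pi (fun b => dual_comp_mem_self ?_) l
    exact (hA _).mpr ⟨MvPolynomial.X b, fun x => by simp⟩
  · rintro ⟨p, hp⟩
    have : f = fun x => MvPolynomial.eval x p := funext hp
    rw [this]
    clear this hp
    induction p using MvPolynomial.induction_on with
    | C a => simpa using const_mem_polyFun a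
    | add p q hp hq =>
      simp only [map_add]
      exact (polyFun k _).add_mem hp hq
    | mul_X p b hp =>
      simp only [map_mul, MvPolynomial.eval_X]
      exact (polyFun k _).mul_mem hp
        (linear_mem_polyFun (LinearMap.proj b : (β → k) →ₗ[k] k))

theorem isOpen_mZariski_iff {U : Set M} : IsOpen[mZariski k M] U ↔
    ∀ x ∈ U, ∃ f ∈ polyFun k M, f x ≠ 0 ∧ ∀ y, f y ≠ 0 → y ∈ U := by
  have hb : @TopologicalSpace.IsTopologicalBasis M (mZariski k M)
      {U : Set M | ∃ p : MvPolynomial (Module.Dual k M) k, U = {x : M | mEval k x p ≠ 0}} := by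
    let _ := mZariski k M
    refine ⟨?_, ?_, rfl⟩
    · rintro _ ⟨p, rfl⟩ _ ⟨q, rfl⟩ x ⟨hp, hq⟩
      refine ⟨_, ⟨p * q, rfl⟩, ?_, ?_⟩
      · simpa [mEval] using And.intro hp hq
      · intro y hy
        simpa [mEval] using hy
    · rw [Set.eq_univ_iff_forall]
      intro x
      exact ⟨_, ⟨1, rfl⟩, by simp [mEval]⟩
  rw [@TopologicalSpace.IsTopologicalBasis.isOpen_iff M (mZariski k M) U _ hb]
  refine forall₂_congr fun x _ => ?_
  constructor
  · rintro ⟨_, ⟨p, rfl⟩, hx, hU⟩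
    exact ⟨_, mEval_mem_polyFun p, hx, fun y hy => hU hy⟩
  · rintro ⟨f, hf, hx, hU⟩
    obtain ⟨p, hp⟩ := mem_polyFun.mp hf
    refine ⟨_, ⟨p, rfl⟩, ?_, ?_⟩
    · simpa [← hp] using hx
    · intro y hy
      exact hU y (by rw [hp]; exact hy)

theorem isOpen_ne_zero_of_mem_polyFun {f : M → k} (hf : f ∈ polyFun k M) :
    IsOpen[mZariski k M] {x | f x ≠ 0} :=
  isOpen_mZariski_iff.mpr fun _ hx => ⟨f, hf, hx, fun _ hy => hy⟩

theorem continuous_mZariski_of_dual_comp_mem {F : M → N}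
    (hF : ∀ l : N →ₗ[k] k, (fun x => l (F x)) ∈ polyFun k M) :
    Continuous[mZariski k M, mZariski k N] F := by
  let _ := mZariski k M
  let _ := mZariski k N
  refine ⟨fun U hU => isOpen_mZariski_iff.mpr fun x hx => ?_⟩
  obtain ⟨f, hf, hfx, hfU⟩ := isOpen_mZariski_iff.mp hU (F x) hx
  exact ⟨_, comp_mem_of_mem_polyFun hF hf, hfx, fun y hy => hfU _ hy⟩

theorem continuous_mZariski_linear (L : M →ₗ[k] N) :
    Continuous[mZariski k M, mZariski k N] L :=
  continuous_mZariski_of_dual_comp_mem fun l => linear_mem_polyFun (l ∘ₗ L)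

theorem det_mem_of_entries {X ι : Type*} [Fintype ι] [DecidableEq ι] {A : Subalgebra k (X → k)}
    {F : X → Matrix ι ι k} (hF : ∀ i j, (fun x => F x i j) ∈ A) : (fun x => (F x).det) ∈ A := by
  have : (fun x => (F x).det) =
      ∑ σ : Equiv.Perm ι, Equiv.Perm.sign σ • ∏ i, fun x => F x (σ i) i := by
    ext x
    simp [Matrix.det_apply]
  rw [this]
  refine A.sum_mem fun σ _ => ?_
  rw [Units.smul_def]
  exact zsmul_mem (A.prod_mem fun i _ => hF _ _) _

theorem adjugate_mem_of_entries {X ι : Type*} [Fintype ι] [DecidableEq ι]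
    {A : Subalgebra k (X → k)} {F : X → Matrix ι ι k} (hF : ∀ i j, (fun x => F x i j) ∈ A)
    (i j : ι) : (fun x => (F x).adjugate i j) ∈ A := by
  simp only [Matrix.adjugate_apply]
  refine det_mem_of_entries fun a b => ?_
  by_cases h : a = j
  · subst h
    simp only [Matrix.updateRow_self]
    exact A.algebraMap_mem ((Pi.single i 1 : ι → k) b)
  · simpa only [Matrix.updateRow_ne h] using hF a b

theorem mul_mem_of_entries {X ι κ μ : Type*} [Fintype κ]
    {A : Subalgebra k (X → k)} {F : X → Matrix ι κ k} {G : X → Matrix κ μ k}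
    (hF : ∀ i j, (fun x => F x i j) ∈ A) (hG : ∀ i j, (fun x => G x i j) ∈ A)
    (i : ι) (j : μ) : (fun x => (F x * G x) i j) ∈ A := by
  have : (fun x => (F x * G x) i j) = ∑ t, (fun x => F x i t) * fun x => G x t j := by
    ext x
    simp [Matrix.mul_apply]
  rw [this]
  exact A.sum_mem fun t _ => A.mul_mem (hF _ _) (hG _ _)

end polyFun
end

section
open Topology

section zeroLocus
variable {k β : Type} [Field k] [Finite β]

theorem isClosed_zeroLocus (I : Ideal (MvPolynomial β k)) :
    IsClosed[mZariski k (β → k)] (MvPolynomial.zeroLocus k I) := by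
  let _ := mZariski k (β → k)
  refine ⟨isOpen_mZariski_iff.mpr fun x hx => ?_⟩
  rw [Set.mem_compl_iff, MvPolynomial.mem_zeroLocus_iff] at hx
  push Not at hx
  obtain ⟨p, hp, hpx⟩ := hx
  rw [MvPolynomial.aeval_eq_eval] at hpx
  refine ⟨_, mem_polyFun_pi.mpr ⟨p, fun _ => rfl⟩, hpx, fun y hy hyI => hy ?_⟩
  have := MvPolynomial.mem_zeroLocus_iff.mp hyI p hp
  rwa [MvPolynomial.aeval_eq_eval] at this

theorem zeroLocus_vanishingIdeal_of_isClosed {Z : Set (β → k)}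
    (hZ : IsClosed[mZariski k (β → k)] Z) :
    MvPolynomial.zeroLocus k (MvPolynomial.vanishingIdeal k Z) = Z := by
  let _ := mZariski k (β → k)
  refine subset_antisymm (fun x hx => ?_) (MvPolynomial.zeroLocus_vanishingIdeal_galoisConnection.l_u_le Z)
  by_contra hxZ
  obtain ⟨f, hf, hfx, hfU⟩ := isOpen_mZariski_iff.mp hZ.isOpen_compl x hxZ
  obtain ⟨p, hp⟩ := mem_polyFun_pi.mp hf
  apply hfx
  rw [hp, ← MvPolynomial.aeval_eq_eval]
  refine MvPolynomial.mem_zeroLocus_iff.mp hx p ?_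
  rw [MvPolynomial.mem_vanishingIdeal_iff]
  intro y hy
  by_contra h0
  rw [MvPolynomial.aeval_eq_eval, ← hp] at h0
  exact hfU y h0 hy

theorem isPrime_vanishingIdeal {Z : Set (β → k)}
    (hZ : @IsIrreducible _ (mZariski k (β → k)) Z) :
    (MvPolynomial.vanishingIdeal k Z).IsPrime := by
  let _ := mZariski k (β → k)
  refine ⟨?_, ?_⟩
  · rw [Ideal.ne_top_iff_one, MvPolynomial.mem_vanishingIdeal_iff]
    intro h
    obtain ⟨x, hx⟩ := hZ.nonempty
    simpa using h x hx
  · intro p q hpq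
    by_contra! hcon
    simp only [MvPolynomial.mem_vanishingIdeal_iff] at hcon hpq
    push Not at hcon
    obtain ⟨⟨x, hx, hpx⟩, y, hy, hqy⟩ := hcon
    simp only [MvPolynomial.aeval_eq_eval] at hpx hqy hpq
    obtain ⟨z, hz, hz1, hz2⟩ := hZ.isPreirreducible _ _
      (isOpen_ne_zero_of_mem_polyFun (mem_polyFun_pi.mpr ⟨p, fun _ => rfl⟩))
      (isOpen_ne_zero_of_mem_polyFun (mem_polyFun_pi.mpr ⟨q, fun _ => rfl⟩))
      ⟨x, hx, hpx⟩ ⟨y, hy, hqy⟩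
    have := hpq z hz
    rw [map_mul] at this
    exact (mul_ne_zero hz1 hz2) this

theorem isIrreducible_zeroLocus [IsAlgClosed k] (P : Ideal (MvPolynomial β k)) [hP : P.IsPrime] :
    @IsIrreducible _ (mZariski k (β → k)) (MvPolynomial.zeroLocus k P) := by
  let _ := mZariski k (β → k)
  have hv := MvPolynomial.IsPrime.vanishingIdeal_zeroLocus (K := k) P
  have hmem : ∀ p, p ∉ P → ∃ x ∈ MvPolynomial.zeroLocus k P, MvPolynomial.eval x p ≠ 0 := by
    intro p hp
    by_contra! hcon
    apply hp
    rw [← hv, MvPolynomial.mem_vanishingIdeal_iff]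
    exact hcon
  refine ⟨?_, ?_⟩
  · obtain ⟨x, hx, -⟩ := hmem 1 ((Ideal.ne_top_iff_one P).mp hP.ne_top)
    exact ⟨x, hx⟩
  · rintro U V hU hV ⟨x, hx, hxU⟩ ⟨y, hy, hyV⟩
    obtain ⟨f, hf, hfx, hfU⟩ := isOpen_mZariski_iff.mp hU x hxU
    obtain ⟨g, hg, hgy, hgV⟩ := isOpen_mZariski_iff.mp hV y hyV
    obtain ⟨p, hp⟩ := mem_polyFun_pi.mp hf
    obtain ⟨q, hq⟩ := mem_polyFun_pi.mp hg
    have hpP : p ∉ P := fun h => hfx (by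
      rw [hp]; exact MvPolynomial.mem_zeroLocus_iff.mp hx p h)
    have hqP : q ∉ P := fun h => hgy (by
      rw [hq]; exact MvPolynomial.mem_zeroLocus_iff.mp hy q h)
    obtain ⟨z, hz, hpq⟩ := hmem (p * q) (fun h => (hP.mem_or_mem h).elim hpP hqP)
    rw [map_mul, mul_ne_zero_iff, ← hp, ← hq] at hpq
    exact ⟨z, hz, hfU z hpq.1, hgV z hpq.2⟩

theorem exists_zeroLocus_eval_ne_zero [IsAlgClosed k] {P : Ideal (MvPolynomial β k)}
    [hP : P.IsPrime] {p : MvPolynomial β k} (hp : p ∉ P) :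
    ∃ x ∈ MvPolynomial.zeroLocus k P, MvPolynomial.eval x p ≠ 0 := by
  by_contra! hcon
  apply hp
  rw [← MvPolynomial.IsPrime.vanishingIdeal_zeroLocus (K := k) P,
    MvPolynomial.mem_vanishingIdeal_iff]
  exact hcon

theorem topologicalKrullDim_le_ringKrullDim_quotient {X : Type} [tX : TopologicalSpace X]
    (f : X → β → k) (hf : @IsInducing _ _ tX (mZariski k (β → k)) f)
    (Q : Ideal (MvPolynomial β k)) (hQ : ∀ x, f x ∈ MvPolynomial.zeroLocus k Q) :
    topologicalKrullDim X ≤ ringKrullDim (MvPolynomial β k ⧸ Q) := by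
  let _ := mZariski k (β → k)
  rw [ringKrullDim_quotient, ← Order.krullDim_orderDual]
  have hcl : ∀ Z : TopologicalSpace.IrreducibleCloseds X, ∀ x,
      f x ∈ MvPolynomial.zeroLocus k (MvPolynomial.vanishingIdeal k (f '' Z)) → x ∈ Z := by
    intro Z x hx
    obtain ⟨W, hW, hWZ⟩ := hf.isClosed_iff.mp Z.isClosed
    have h1 : MvPolynomial.vanishingIdeal k W ≤ MvPolynomial.vanishingIdeal k (f '' Z) := by
      apply MvPolynomial.zeroLocus_vanishingIdeal_galoisConnection.monotone_u
      rintro _ ⟨z, hz, rfl⟩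
      have : z ∈ f ⁻¹' W := by rw [hWZ]; exact hz
      exact this
    have h2 : f x ∈ MvPolynomial.zeroLocus k (MvPolynomial.vanishingIdeal k W) := by
      rw [MvPolynomial.mem_zeroLocus_iff] at hx ⊢
      exact fun p hp => hx p (h1 hp)
    rw [zeroLocus_vanishingIdeal_of_isClosed hW] at h2
    have : x ∈ f ⁻¹' W := h2
    rw [hWZ] at this
    exact this
  refine Order.krullDim_le_of_strictMono (fun Z => OrderDual.toDual
    ⟨⟨MvPolynomial.vanishingIdeal k (f '' Z),
      isPrime_vanishingIdeal (Z.isIrreducible.image f hf.continuous.continuousOn)⟩, ?_⟩) ?_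
  · rw [PrimeSpectrum.mem_zeroLocus]
    intro p hp
    change p ∈ MvPolynomial.vanishingIdeal k (f '' Z)
    rw [MvPolynomial.mem_vanishingIdeal_iff]
    rintro _ ⟨z, -, rfl⟩
    exact MvPolynomial.mem_zeroLocus_iff.mp (hQ z) p hp
  · intro Z Z' hZ
    refine lt_of_le_of_ne ?_ ?_
    · change MvPolynomial.vanishingIdeal k (f '' Z') ≤ MvPolynomial.vanishingIdeal k (f '' Z)
      intro p hp
      rw [MvPolynomial.mem_vanishingIdeal_iff] at hp ⊢
      exact fun x hx => hp x (Set.image_mono hZ.le hx)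
    · intro h
      have h' : MvPolynomial.vanishingIdeal k (f '' Z) = MvPolynomial.vanishingIdeal k (f '' Z') :=
        congrArg (fun t => (OrderDual.ofDual t).1.asIdeal) h
      refine hZ.not_ge fun x hx => hcl Z x ?_
      rw [h', MvPolynomial.mem_zeroLocus_iff]
      exact fun p hp => (MvPolynomial.mem_vanishingIdeal_iff.mp hp) _ ⟨x, hx, rfl⟩

theorem ringKrullDim_quotient_le_topologicalKrullDim [IsAlgClosed k] (P : Ideal (MvPolynomial β k)) 
    [P.IsPrime] {X : Type} [tX : TopologicalSpace X] (f : X → β → k)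
    (hf : @IsInducing _ _ tX (mZariski k (β → k)) f)
    (hP : Set.range f = MvPolynomial.zeroLocus k P) :
    ringKrullDim (MvPolynomial β k ⧸ P) ≤ topologicalKrullDim X := by
  let _ := mZariski k (β → k)
  rw [ringKrullDim_quotient, ← Order.krullDim_orderDual]
  have hsub : ∀ Q : PrimeSpectrum.zeroLocus (P : Set (MvPolynomial β k)),
      MvPolynomial.zeroLocus k Q.1.asIdeal ⊆ Set.range f := by
    intro Q
    rw [hP]
    exact MvPolynomial.zeroLocus_vanishingIdeal_galoisConnection.monotone_l
      ((PrimeSpectrum.mem_zeroLocus _ _).mp Q.2)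
  refine Order.krullDim_le_of_strictMono (fun Q =>
    ⟨f ⁻¹' MvPolynomial.zeroLocus k (OrderDual.ofDual Q).1.asIdeal, ?_,
      (isClosed_zeroLocus _).preimage hf.continuous⟩) ?_
  · have hirr := isIrreducible_zeroLocus (OrderDual.ofDual Q).1.asIdeal
    refine ⟨?_, ?_⟩
    · obtain ⟨y, hy⟩ := hirr.nonempty
      obtain ⟨x, rfl⟩ := hsub _ hy
      exact ⟨x, hy⟩
    · rintro U V hU hV ⟨x, hx, hxU⟩ ⟨y, hy, hyV⟩
      obtain ⟨U', hU', rfl⟩ := hf.isOpen_iff.mp hU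
      obtain ⟨V', hV', rfl⟩ := hf.isOpen_iff.mp hV
      obtain ⟨z, hz, hzU⟩ := hirr.isPreirreducible U' V' hU' hV' ⟨_, hx, hxU⟩ ⟨_, hy, hyV⟩
      obtain ⟨w, rfl⟩ := hsub _ hz
      exact ⟨w, hz, hzU⟩
  · intro Q Q' hQ
    have hle : (OrderDual.ofDual Q').1.asIdeal ≤ (OrderDual.ofDual Q).1.asIdeal := hQ.le
    refine lt_of_le_not_ge ?_ ?_
    · have h : MvPolynomial.zeroLocus k (OrderDual.ofDual Q).1.asIdeal ⊆
          MvPolynomial.zeroLocus k (OrderDual.ofDual Q').1.asIdeal :=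
        MvPolynomial.zeroLocus_vanishingIdeal_galoisConnection.monotone_l hle
      exact fun x (hx : f x ∈ _) => h hx
    · intro h
      have h1 : MvPolynomial.zeroLocus k (OrderDual.ofDual Q').1.asIdeal ⊆
          MvPolynomial.zeroLocus k (OrderDual.ofDual Q).1.asIdeal := by
        intro y hy
        obtain ⟨x, rfl⟩ := hsub (OrderDual.ofDual Q') hy
        exact h hy
      apply hQ.not_ge
      change (OrderDual.ofDual Q).1.asIdeal ≤ (OrderDual.ofDual Q').1.asIdeal
      rw [← MvPolynomial.IsPrime.vanishingIdeal_zeroLocus (K := k) (OrderDual.ofDual Q').1.asIdeal]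
      intro p hp
      rw [MvPolynomial.mem_vanishingIdeal_iff]
      exact fun x hx => MvPolynomial.mem_zeroLocus_iff.mp (h1 hx) p hp

theorem noetherianSpace_mZariski_pi : @TopologicalSpace.NoetherianSpace (β → k) (mZariski k (β → k)) := by
  let _ := mZariski k (β → k)
  refine ((TopologicalSpace.noetherianSpace_TFAE (β → k)).out 0 1).mpr ?_
  have hwf : WellFoundedLT (Ideal (MvPolynomial β k))ᵒᵈ := inferInstance
  refine StrictMono.wellFoundedLT (f := fun Z : TopologicalSpace.Closeds (β → k) =>
    OrderDual.toDual (MvPolynomial.vanishingIdeal k (Z : Set (β → k)))) ?_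
  intro Z Z' hZ
  refine lt_of_le_of_ne ?_ ?_
  · intro p hp
    change p ∈ MvPolynomial.vanishingIdeal k (Z : Set (β → k))
    have hp' : p ∈ MvPolynomial.vanishingIdeal k (Z' : Set (β → k)) := hp
    rw [MvPolynomial.mem_vanishingIdeal_iff] at hp' ⊢
    exact fun x hx => hp' x (hZ.le hx)
  · intro h
    have h' : MvPolynomial.vanishingIdeal k (Z : Set (β → k)) =
      MvPolynomial.vanishingIdeal k (Z' : Set (β → k)) := h
    apply hZ.ne
    apply TopologicalSpace.Closeds.ext
    rw [← zeroLocus_vanishingIdeal_of_isClosed Z.isClosed, h',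
      zeroLocus_vanishingIdeal_of_isClosed Z'.isClosed]

end zeroLocus
end

section
open Topology

theorem exists_mem_fibre_of_eval_ne_zero {k α β : Type} [Field k] [IsAlgClosed k] [Fintype α]
    [Fintype β] (φ : α → MvPolynomial β k) (h : MvPolynomial β k) (hh : h ≠ 0) :
    ∃ f : MvPolynomial α k, f ≠ 0 ∧ ∀ y : α → k, MvPolynomial.eval y f ≠ 0 →
      ∀ x, (∀ a, MvPolynomial.eval x (φ a) = y a) → ∀ g, MvPolynomial.eval x g ≠ 0 →
      ∃ x', (∀ a, MvPolynomial.eval x' (φ a) = y a) ∧ MvPolynomial.eval x' g ≠ 0 ∧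
        MvPolynomial.eval x' h ≠ 0 := by
  obtain ⟨f, hf, hfib⟩ := generic_fibre φ h hh
  refine ⟨f, hf, fun y hy x hx g hg => ?_⟩
  have hle : Ideal.span (Set.range fun a => φ a - MvPolynomial.C (y a)) ≤
      RingHom.ker (MvPolynomial.eval x) := by
    rw [Ideal.span_le]
    rintro _ ⟨a, rfl⟩
    simp [RingHom.mem_ker, hx]
  have hprime : (RingHom.ker (MvPolynomial.eval x)).IsPrime := RingHom.ker_isPrime _
  obtain ⟨P, hP, hPx⟩ := Ideal.exists_minimalPrimes_le hle
  have hPp : P.IsPrime := hP.1.1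
  have hgP : g ∉ P := fun hgP => hg (hPx hgP)
  have hhP := (hfib y hy P hP).1
  obtain ⟨x', hx', hgh⟩ := exists_zeroLocus_eval_ne_zero (p := g * h)
    (fun hm => (hPp.mem_or_mem hm).elim hgP hhP)
  rw [map_mul, mul_ne_zero_iff] at hgh
  refine ⟨x', fun a => ?_, hgh⟩
  have := MvPolynomial.mem_zeroLocus_iff.mp hx' _ (hP.1.2 (Ideal.subset_span ⟨a, rfl⟩))
  simpa [MvPolynomial.aeval_eq_eval, sub_eq_zero] using this

theorem mem_polyFun_comp_equivFun {k M : Type} {ι : Type} [Field k] [AddCommGroup M] [Module k M]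
    [Fintype ι] (b : Basis ι k M) {f : M → k} (hf : f ∈ polyFun k M) :
    ∃ p : MvPolynomial ι k, ∀ x, f x = MvPolynomial.eval (b.equivFun x) p := by
  obtain ⟨p, hp⟩ := mem_polyFun_pi.mp (comp_linear_mem_polyFun b.equivFun.symm.toLinearMap hf)
  refine ⟨p, fun x => ?_⟩
  rw [← hp]
  simp

theorem eval_equivFun_mem_polyFun {k M : Type} {ι : Type} [Field k] [AddCommGroup M] [Module k M]
    [Fintype ι] (b : Basis ι k M) (p : MvPolynomial ι k) :
    (fun x => MvPolynomial.eval (b.equivFun x) p) ∈ polyFun k M :=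
  comp_linear_mem_polyFun b.equivFun.toLinearMap (mem_polyFun_pi.mpr ⟨p, fun _ => rfl⟩)

theorem exists_ne_zero_of_polyFun_fibre {k M N : Type} [Field k] [IsAlgClosed k]
    [AddCommGroup M] [Module k M] [AddCommGroup N] [Module k N] [FiniteDimensional k M]
    [FiniteDimensional k N] (F : M → N) (hF : ∀ l : N →ₗ[k] k, (fun x => l (F x)) ∈ polyFun k M)
    {h : M → k} (hh : h ∈ polyFun k M) (hne : ∃ x, h x ≠ 0) :
    ∃ f ∈ polyFun k N, (∃ y, f y ≠ 0) ∧ ∀ x, f (F x) ≠ 0 → ∀ g ∈ polyFun k M, g x ≠ 0 →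
      ∃ x', F x' = F x ∧ g x' ≠ 0 ∧ h x' ≠ 0 := by
  let bM := Module.finBasis k M
  let bN := Module.finBasis k N
  choose φ hφ using fun a => mem_polyFun_comp_equivFun bM (hF (bN.coord a))
  obtain ⟨p, hp⟩ := mem_polyFun_comp_equivFun bM hh
  have hp0 : p ≠ 0 := by
    rintro rfl
    obtain ⟨x, hx⟩ := hne
    exact hx (by rw [hp, map_zero])
  obtain ⟨f, hf, hfib⟩ := exists_mem_fibre_of_eval_ne_zero φ p hp0
  refine ⟨_, eval_equivFun_mem_polyFun bN f, ?_, ?_⟩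
  · by_contra! hcon
    apply hf
    apply MvPolynomial.funext
    intro x
    have := hcon (bN.equivFun.symm x)
    simpa only [LinearEquiv.apply_symm_apply, map_zero] using this
  · intro x hx g hg hgx
    obtain ⟨q, hq⟩ := mem_polyFun_comp_equivFun bM hg
    obtain ⟨z, hz, hz1, hz2⟩ := hfib _ hx (bM.equivFun x)
      (fun a => by rw [← hφ]; rfl) q (by rwa [← hq])
    refine ⟨bM.equivFun.symm z, ?_, ?_, ?_⟩
    · apply bN.equivFun.injective
      ext a
      rw [← hz a]
      have := hφ a (bM.equivFun.symm z)
      rw [LinearEquiv.apply_symm_apply] at this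
      exact this
    · rw [hq, LinearEquiv.apply_symm_apply]; exact hz1
    · rw [hp, LinearEquiv.apply_symm_apply]; exact hz2

theorem topologicalKrullDim_le_of_isOpen_cover {X : Type} [TopologicalSpace X] {ι : Type}
    (U : ι → Set X) (hU : ∀ i, IsOpen (U i)) (hcov : ∀ x, ∃ i, x ∈ U i) (e : WithBot ℕ∞)
    (he : ∀ i, (U i).Nonempty → topologicalKrullDim (U i) ≤ e) : topologicalKrullDim X ≤ e := by
  refine iSup_le fun p => ?_
  obtain ⟨x, hx⟩ := p.head.isIrreducible.nonempty
  obtain ⟨i, hi⟩ := hcov x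
  refine le_trans ?_ (he i ⟨x, hi⟩)
  have hmeet : ∀ j, ((p j : Set X) ∩ U i).Nonempty := fun j =>
    ⟨x, p.monotone (Fin.zero_le j) hx, hi⟩
  let q : LTSeries (TopologicalSpace.IrreducibleCloseds (U i)) :=
    { length := p.length
      toFun := fun j => ⟨Subtype.val ⁻¹' (p j : Set X),
        (p j).isIrreducible.preimage (hU i).isOpenEmbedding_subtypeVal
          (by simpa [Set.inter_comm] using hmeet j),
        (p j).isClosed.preimage continuous_subtype_val⟩
      step := fun j => by
        have hlt : p j.castSucc < p j.succ := p.step j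
        have hstep : (p j.castSucc : Set X) ⊆ p j.succ := hlt.le
        change (_ : TopologicalSpace.IrreducibleCloseds (U i)) < _
        refine lt_of_le_not_ge ?_ ?_
        · exact fun y (hy : (y : X) ∈ p j.castSucc) => hstep hy
        intro hle
        apply hlt.not_ge
        have h1 := subset_closure_inter_of_isPreirreducible_of_isOpen
          (p j.succ).isIrreducible.isPreirreducible (hU i) (hmeet _)
        refine fun z hz => ?_
        refine (p j.castSucc).isClosed.closure_subset_iff.mpr ?_ (h1 hz)
        exact fun w hw => hle (show (⟨w, hw.2⟩ : U i) ∈ _ from hw.1) }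
  exact le_iSup_of_le q le_rfl

end

section
open Topology

theorem exists_minimalPrime_of_mem_irreducibleComponents {k β : Type} [Field k] [IsAlgClosed k]
    [Finite β] (I : Ideal (MvPolynomial β k)) (Z : Set (MvPolynomial.zeroLocus k I))
    (hZ : Z ∈ @irreducibleComponents _ (TopologicalSpace.induced Subtype.val (mZariski k (β → k)))) :
    ∃ P ∈ I.minimalPrimes, Subtype.val '' Z = MvPolynomial.zeroLocus k P := by
  let _ := mZariski k (β → k)
  have hZirr : IsIrreducible (Subtype.val '' Z) :=
    hZ.1.image _ continuous_subtype_val.continuousOn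
  have hZcl : IsClosed (Subtype.val '' Z) :=
    ((isClosed_zeroLocus I).isClosedEmbedding_subtypeVal).isClosedMap _
      (isClosed_of_mem_irreducibleComponents _ hZ)
  have hp := isPrime_vanishingIdeal hZirr
  have hIle : I ≤ MvPolynomial.vanishingIdeal k (Subtype.val '' Z) := by
    intro p hp
    rw [MvPolynomial.mem_vanishingIdeal_iff]
    rintro _ ⟨x, -, rfl⟩
    exact MvPolynomial.mem_zeroLocus_iff.mp x.2 p hp
  obtain ⟨P, hP, hPle⟩ := Ideal.exists_minimalPrimes_le hIle
  have hPp : P.IsPrime := hP.1.1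
  refine ⟨P, hP, subset_antisymm ?_ ?_⟩
  · intro x hx
    rw [MvPolynomial.mem_zeroLocus_iff]
    exact fun p hp => MvPolynomial.mem_vanishingIdeal_iff.mp (hPle hp) x hx
  · have hsub : MvPolynomial.zeroLocus k P ⊆ MvPolynomial.zeroLocus k I := by
      intro x hx
      rw [MvPolynomial.mem_zeroLocus_iff] at hx ⊢
      exact fun p hp => hx p (hP.1.2 hp)
    have hirr : IsIrreducible (Subtype.val ⁻¹' MvPolynomial.zeroLocus k P :
        Set (MvPolynomial.zeroLocus k I)) := by
      have h0 := isIrreducible_zeroLocus P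
      refine ⟨?_, ?_⟩
      · obtain ⟨x, hx⟩ := h0.nonempty
        exact ⟨⟨x, hsub hx⟩, hx⟩
      · rintro U V hU hV ⟨x, hx, hxU⟩ ⟨y, hy, hyV⟩
        obtain ⟨U', hU', rfl⟩ := isOpen_induced_iff.mp hU
        obtain ⟨V', hV', rfl⟩ := isOpen_induced_iff.mp hV
        obtain ⟨z, hz, hzU⟩ := h0.isPreirreducible U' V' hU' hV' ⟨_, hx, hxU⟩ ⟨_, hy, hyV⟩
        exact ⟨⟨z, hsub hz⟩, hz, hzU⟩
    have hle : Z ⊆ Subtype.val ⁻¹' MvPolynomial.zeroLocus k P := by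
      intro x hx
      change x.1 ∈ MvPolynomial.zeroLocus k P
      rw [MvPolynomial.mem_zeroLocus_iff]
      exact fun p hp => MvPolynomial.mem_vanishingIdeal_iff.mp (hPle hp) x ⟨x, hx, rfl⟩
    intro x hx
    exact ⟨⟨x, hsub hx⟩, hZ.2 hirr hle hx, rfl⟩

section chart
variable {k T β γ : Type} [Field k] [IsAlgClosed k] [TopologicalSpace T] [Finite β] [Finite γ]

theorem chart_dim_bounds (I : Ideal (MvPolynomial β k)) (e : WithBot ℕ∞)
    (hI : ∀ P ∈ I.minimalPrimes, ringKrullDim (MvPolynomial β k ⧸ P) = e)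
    (τ : MvPolynomial.zeroLocus k I → T)
    (hτ : @IsOpenEmbedding _ _ (TopologicalSpace.induced Subtype.val (mZariski k (β → k))) _ τ)
    (U : Set T) (hU : IsOpen U) (hτU : Set.range τ ⊆ U) (hdense : U ⊆ closure (Set.range τ))
    (ζ : U → γ → k) (hζ : @IsInducing _ _ _ (mZariski k (γ → k)) ζ)
    (π : γ → MvPolynomial β k)
    (hπ : ∀ z c, ζ ⟨τ z, hτU ⟨z, rfl⟩⟩ c = MvPolynomial.eval z.1 (π c))
    (C : Set T) (hC : C ∈ irreducibleComponents T) (hCU : (C ∩ U).Nonempty) :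
    topologicalKrullDim (Subtype.val ⁻¹' U : Set C) ≤ e ∧ e ≤ topologicalKrullDim C := by
  let _ := mZariski k (β → k)
  let _ := mZariski k (γ → k)
  have hNn : TopologicalSpace.NoetherianSpace (γ → k) := noetherianSpace_mZariski_pi
  have hUn : TopologicalSpace.NoetherianSpace U := hζ.noetherianSpace
  have hCU' : Subtype.val ⁻¹' C ∈ irreducibleComponents U :=
    preimage_mem_irreducibleComponents hC hU.isOpenEmbedding_subtypeVal (by simpa using hCU)
  have hCτ : (C ∩ Set.range τ).Nonempty := by
    obtain ⟨o, ho, ⟨x, hx⟩, hoC⟩ :=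
      TopologicalSpace.NoetherianSpace.exists_isOpen_nonempty_subset_irreducibleComponent _ hCU'
    obtain ⟨o', ho', rfl⟩ := isOpen_induced_iff.mp ho
    obtain ⟨y, hy1, hy2⟩ := mem_closure_iff.mp (hdense x.2) o' ho' hx
    exact ⟨y, hoC (show (⟨y, hτU hy2⟩ : U) ∈ _ from hy1), hy2⟩
  have hZ := preimage_mem_irreducibleComponents hC hτ hCτ
  obtain ⟨P, hP, hPZ⟩ := exists_minimalPrime_of_mem_irreducibleComponents I _ hZ
  have hPp : P.IsPrime := hP.1.1
  constructor
  · let π' : MvPolynomial γ k →ₐ[k] MvPolynomial β k := MvPolynomial.aeval π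
    have hπ' : ∀ z q, MvPolynomial.eval (ζ ⟨τ z, hτU ⟨z, rfl⟩⟩) q =
        MvPolynomial.eval z.1 (π' q) := by
      intro z q
      have : ζ ⟨τ z, hτU ⟨z, rfl⟩⟩ = fun c => MvPolynomial.eval z.1 (π c) := funext (hπ z)
      rw [this]
      induction q using MvPolynomial.induction_on with
      | C a => simp [π']
      | add p q hp hq => simp only [map_add, hp, hq]
      | mul_X p c hp => simp only [map_mul, hp, MvPolynomial.eval_X]; simp [π']
    have hdim : ringKrullDim (MvPolynomial γ k ⧸ P.comap π') ≤ e := by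
      rw [← hI P hP]
      have : (P.comap π').IsPrime := Ideal.comap_isPrime π' P
      have hinj : Function.Injective (Ideal.quotientMapₐ P π' (le_refl (P.comap π'))) :=
        Ideal.quotientMap_injective' (f := (π' : MvPolynomial γ k →+* MvPolynomial β k))
          (H := le_refl (P.comap π')) (le_refl (P.comap π'))
      exact ringKrullDim_le_of_injective k _ hinj
    refine le_trans ?_ hdim
    refine topologicalKrullDim_le_ringKrullDim_quotient
      (fun x : (Subtype.val ⁻¹' U : Set C) => ζ ⟨x.1.1, x.2⟩) ?_ _ ?_
    · refine hζ.comp ?_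
      rw [← IsInducing.subtypeVal.of_comp_iff]
      have h1 : IsInducing (fun x : (Subtype.val ⁻¹' U : Set C) => (x.1 : T)) :=
        IsInducing.subtypeVal.comp IsInducing.subtypeVal
      exact h1
    · intro x
      rw [MvPolynomial.mem_zeroLocus_iff]
      intro q hq
      rw [MvPolynomial.aeval_eq_eval]
      by_contra hqx
      have hO : IsOpen {y : U | MvPolynomial.eval (ζ y) q ≠ 0} :=
        (isOpen_ne_zero_of_mem_polyFun
          (mem_polyFun_pi.mpr ⟨q, fun _ => rfl⟩)).preimage hζ.continuous
      have hO' := hU.isOpenEmbedding_subtypeVal.isOpenMap _ hO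
      obtain ⟨z, hzC, ⟨y, hy, rfl⟩, w, hw⟩ := hC.1.isPreirreducible _ _ hO' hτ.isOpen_range
        ⟨x.1.1, x.1.2, ⟨⟨x.1.1, x.2⟩, hqx, rfl⟩⟩ hCτ
      have hy' : y = ⟨τ w, hτU ⟨w, rfl⟩⟩ := Subtype.ext hw.symm
      apply hy
      rw [hy', hπ']
      have hw' : w.1 ∈ MvPolynomial.zeroLocus k P := by
        rw [← hPZ]
        refine ⟨w, ?_, rfl⟩
        change τ w ∈ C
        rw [hw]
        exact hzC
      have := MvPolynomial.mem_zeroLocus_iff.mp hw' _ (Ideal.mem_comap.mp hq)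
      rwa [MvPolynomial.aeval_eq_eval] at this
  · rw [← hI P hP]
    refine (ringKrullDim_quotient_le_topologicalKrullDim P
      (fun x : τ ⁻¹' C => x.1.1) (IsInducing.subtypeVal.comp IsInducing.subtypeVal) ?_).trans ?_
    · rw [← hPZ]
      ext y
      constructor
      · rintro ⟨x, rfl⟩
        exact ⟨x.1, x.2, rfl⟩
      · rintro ⟨x, hx, rfl⟩
        exact ⟨⟨x, hx⟩, rfl⟩
    · refine IsInducing.topologicalKrullDim_le (f := fun x : τ ⁻¹' C => (⟨τ x.1, x.2⟩ : C)) ?_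
      rw [← IsInducing.subtypeVal.of_comp_iff]
      exact hτ.isInducing.comp IsInducing.subtypeVal

theorem topologicalKrullDim_irreducibleComponent_eq {ι : Type} {β γ : ι → Type}
    [∀ i, Finite (β i)] [∀ i, Finite (γ i)] (I : ∀ i, Ideal (MvPolynomial (β i) k))
    (e : WithBot ℕ∞)
    (hI : ∀ i, ∀ P ∈ (I i).minimalPrimes, ringKrullDim (MvPolynomial (β i) k ⧸ P) = e)
    (τ : ∀ i, MvPolynomial.zeroLocus k (I i) → T)
    (hτ : ∀ i, @IsOpenEmbedding _ _
      (TopologicalSpace.induced Subtype.val (mZariski k (β i → k))) _ (τ i))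
    (U : ι → Set T) (hU : ∀ i, IsOpen (U i)) (hcov : ∀ x, ∃ i, x ∈ U i)
    (hτU : ∀ i, Set.range (τ i) ⊆ U i) (hdense : ∀ i, U i ⊆ closure (Set.range (τ i)))
    (ζ : ∀ i, U i → γ i → k) (hζ : ∀ i, @IsInducing _ _ _ (mZariski k (γ i → k)) (ζ i))
    (π : ∀ i, γ i → MvPolynomial (β i) k)
    (hπ : ∀ i z c, ζ i ⟨τ i z, hτU i ⟨z, rfl⟩⟩ c = MvPolynomial.eval z.1 (π i c))
    (C : Set T) (hC : C ∈ irreducibleComponents T) : topologicalKrullDim C = e := by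
  have key := fun i => chart_dim_bounds (I i) e (hI i) (τ i) (hτ i) (U i) (hU i) (hτU i)
    (hdense i) (ζ i) (hζ i) (π i) (hπ i) C hC
  apply le_antisymm
  · refine topologicalKrullDim_le_of_isOpen_cover (fun i => (Subtype.val ⁻¹' U i : Set C))
      (fun i => (hU i).preimage continuous_subtype_val) (fun x => hcov x.1) e ?_
    rintro i ⟨x, hx⟩
    exact (key i ⟨x.1, x.2, hx⟩).1
  · obtain ⟨x, hx⟩ := hC.1.nonempty
    obtain ⟨i, hi⟩ := hcov x
    exact (key i ⟨x, hx, hi⟩).2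

end chart
end

section
open Topology
open Matrix

section flags
variable {k : Type} [Field k]

/-- The row space of a matrix. -/
def rowSpan {d n : ℕ} (A : Matrix (Fin d) (Fin n) k) : Submodule k (Fin n → k) :=
  span k (Set.range A.row)

/-- The rows of `x` vanish to the right of the positions prescribed by `i`. -/
def IsEchelon {r n : ℕ} (i : Fin r → Fin n) (x : Matrix (Fin r) (Fin n) k) : Prop :=
  ∀ a u, i a < u → x a u = 0

theorem mem_span_image_iff_vecMul {r n : ℕ} {w : Matrix (Fin r) (Fin n) k} {S : Set (Fin r)}
    {v : Fin n → k} :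
    v ∈ span k (w.row '' S) ↔ ∃ c : Fin r → k, (∀ a, a ∉ S → c a = 0) ∧ v = c ᵥ* w := by
  rw [Finsupp.mem_span_image_iff_linearCombination]
  constructor
  · rintro ⟨l, hl, rfl⟩
    refine ⟨l, fun a ha => ?_, ?_⟩
    · by_contra h
      exact ha (hl (by simpa using h))
    · rw [Finsupp.linearCombination_apply, Finsupp.sum_fintype _ _ (by simp)]
      exact (Matrix.vecMul_eq_sum (l : Fin r → k) w).symm
  · rintro ⟨c, hc, rfl⟩
    refine ⟨Finsupp.equivFunOnFinite.symm c, ?_, ?_⟩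
    · intro a ha
      by_contra h
      simp [hc a h] at ha
    · rw [Finsupp.linearCombination_apply, Finsupp.sum_fintype _ _ (by simp)]
      exact (Matrix.vecMul_eq_sum c w).symm

theorem mem_rowSpan_iff {r n : ℕ} {w : Matrix (Fin r) (Fin n) k} {v : Fin n → k} :
    v ∈ rowSpan w ↔ ∃ c : Fin r → k, v = c ᵥ* w := by
  rw [rowSpan, ← Set.image_univ, mem_span_image_iff_vecMul]
  simp

theorem row_mem_rowSpan {r n : ℕ} (w : Matrix (Fin r) (Fin n) k) (a : Fin r) : w.row a ∈ rowSpan w :=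
  subset_span ⟨a, rfl⟩

theorem row_mul_eq_vecMul {m n o : Type*} [Fintype n] (A : Matrix m n k) (B : Matrix n o k) (i : m) :
    (A * B).row i = A.row i ᵥ* B :=
  Matrix.mul_apply_eq_vecMul A B i

theorem rowSpan_mul_le {r d n : ℕ} (c : Matrix (Fin r) (Fin d) k) (w : Matrix (Fin d) (Fin n) k) :
    rowSpan (c * w) ≤ rowSpan w := by
  refine span_le.mpr ?_
  rintro _ ⟨a, rfl⟩
  exact mem_rowSpan_iff.mpr ⟨c.row a, row_mul_eq_vecMul _ _ _⟩

theorem rowSpan_mul {d n : ℕ} {c : Matrix (Fin d) (Fin d) k} (hc : IsUnit c.det)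
    (w : Matrix (Fin d) (Fin n) k) : rowSpan (c * w) = rowSpan w := by
  refine le_antisymm (rowSpan_mul_le c w) ?_
  have := rowSpan_mul_le c⁻¹ (c * w)
  rwa [← Matrix.mul_assoc, Matrix.nonsing_inv_mul _ hc, Matrix.one_mul] at this


theorem finrank_rowSpan {d n : ℕ} {w : Matrix (Fin d) (Fin n) k} (hw : LinearIndependent k w.row) :
    finrank k (rowSpan w) = d := by
  exact (finrank_span_eq_card hw).trans (Fintype.card_fin d)

theorem linearIndependent_of_finrank_rowSpan {d n : ℕ} {w : Matrix (Fin d) (Fin n) k}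
    (hw : finrank k (rowSpan w) = d) : LinearIndependent k w.row := by
  rw [linearIndependent_iff_card_eq_finrank_span, Fintype.card_fin]
  exact hw.symm

theorem vecMul_injective_of_linearIndependent {d n : ℕ} {w : Matrix (Fin d) (Fin n) k}
    (hw : LinearIndependent k w.row) {c c' : Fin d → k} (h : c ᵥ* w = c' ᵥ* w) : c = c' := by
  exact Matrix.vecMul_injective_iff.mpr hw h

theorem exists_mul_eq_of_rowSpan_eq {d n : ℕ} {w w' : Matrix (Fin d) (Fin n) k}
    (hw : LinearIndependent k w'.row) (h : rowSpan w = rowSpan w') :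
    ∃ c : Matrix (Fin d) (Fin d) k, IsUnit c.det ∧ w' = c * w := by
  have h1 : ∀ a, ∃ c : Fin d → k, w'.row a = c ᵥ* w := fun a =>
    mem_rowSpan_iff.mp (h ▸ row_mem_rowSpan w' a)
  have h2 : ∀ a, ∃ c : Fin d → k, w.row a = c ᵥ* w' := fun a =>
    mem_rowSpan_iff.mp (h ▸ row_mem_rowSpan w a)
  choose c hc using h1
  choose c' hc' using h2
  have e1 : w' = Matrix.of c * w := by
    exact Matrix.ext_row fun a => (hc a).trans (row_mul_eq_vecMul _ _ _).symm
  have e2 : w = Matrix.of c' * w' := by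
    exact Matrix.ext_row fun a => (hc' a).trans (row_mul_eq_vecMul _ _ _).symm
  refine ⟨Matrix.of c, ?_, e1⟩
  have e3 : Matrix.of c * Matrix.of c' = 1 := by
    refine Matrix.ext_row fun a => ?_
    apply vecMul_injective_of_linearIndependent hw
    rw [← row_mul_eq_vecMul, ← row_mul_eq_vecMul, Matrix.mul_assoc, ← e2, ← e1,
      Matrix.one_mul]
  exact Matrix.isUnit_det_of_right_inverse e3

theorem mem_spanFlag_iff {n : ℕ} {g : Matrix (Fin n) (Fin n) k} (hg : IsUnit g.det) {m : ℕ}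
    {v : Fin n → k} :
    v ∈ spanFlag k g.row m ↔ ∀ u : Fin n, m ≤ u → (v ᵥ* g⁻¹) u = 0 := by
  rw [spanFlag, mem_span_image_iff_vecMul]
  constructor
  · rintro ⟨c, hc, rfl⟩ u hu
    rw [Matrix.vecMul_vecMul, Matrix.mul_nonsing_inv _ hg, Matrix.vecMul_one]
    exact hc u (by simpa using hu)
  · intro h
    refine ⟨v ᵥ* g⁻¹, fun a ha => h a (by simpa using ha), ?_⟩
    rw [Matrix.vecMul_vecMul, Matrix.nonsing_inv_mul _ hg, Matrix.vecMul_one]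

theorem exists_linearIndependent_mem {M : Type} [AddCommGroup M] [Module k M]
    [FiniteDimensional k M] {r : ℕ} (S : Fin r → Submodule k M)
    (hS : ∀ a : Fin r, (a : ℕ) + 1 ≤ finrank k (S a)) :
    ∃ w : Fin r → M, LinearIndependent k w ∧ ∀ a : Fin r, w a ∈ S a := by
  induction r with
  | zero => exact ⟨Fin.elim0, linearIndependent_empty_type, fun a => a.elim0⟩
  | succ r ih =>
    obtain ⟨w, hw, hwS⟩ := ih (fun a => S a.castSucc) (fun a => by simpa using hS a.castSucc)
    obtain ⟨x, hx, hxw⟩ : ∃ x ∈ S (Fin.last r), x ∉ span k (Set.range w) := by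
      by_contra! hcon
      have h1 : finrank k (S (Fin.last r)) ≤ finrank k (span k (Set.range w)) :=
        Submodule.finrank_mono hcon
      have h2 := hS (Fin.last r)
      rw [finrank_span_eq_card hw, Fintype.card_fin] at h1
      simp at h2
      omega
    refine ⟨Fin.snoc w x, hw.finSnoc hxw, fun a => ?_⟩
    induction a using Fin.lastCases with
    | last => simpa using hx
    | cast a => simpa using hwS a

theorem isEchelon_iff_mem_spanFlag {n r : ℕ} {g : Matrix (Fin n) (Fin n) k} (hg : IsUnit g.det)
    {i : Fin r → Fin n} {w : Matrix (Fin r) (Fin n) k} :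
    IsEchelon i (w * g⁻¹) ↔ ∀ a, w.row a ∈ spanFlag k g.row ((i a : ℕ) + 1) := by
  simp only [mem_spanFlag_iff hg, ← row_mul_eq_vecMul, Nat.succ_le_iff]
  rfl

theorem varMem_spanFlag_iff {n r : ℕ} {g : Matrix (Fin n) (Fin n) k} (hg : IsUnit g.det)
    {i : Fin r → Fin n} (hi : StrictMono i) {V : Submodule k (Fin n → k)} :
    varMem i (spanFlag k g.row) V ↔ ∃ w : Matrix (Fin r) (Fin n) k,
      LinearIndependent k w.row ∧ rowSpan w = V ∧ IsEchelon i (w * g⁻¹) := by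
  constructor
  · rintro ⟨hr, h⟩
    obtain ⟨w, hw, hwS⟩ := exists_linearIndependent_mem
      (fun a => V ⊓ spanFlag k g.row ((i a : ℕ) + 1)) h
    refine ⟨Matrix.of w, hw, ?_, ?_⟩
    · refine Submodule.eq_of_le_of_finrank_eq (span_le.mpr ?_) ?_
      · rintro _ ⟨a, rfl⟩
        exact (hwS a).1
      · rw [hr]
        exact finrank_rowSpan hw
    · rw [isEchelon_iff_mem_spanFlag hg]
      exact fun a => (hwS a).2
  · rintro ⟨w, hw, rfl, hech⟩
    rw [isEchelon_iff_mem_spanFlag hg] at hech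
    refine ⟨finrank_rowSpan hw, fun a => ?_⟩
    have h1 : LinearIndependent k (fun b : Fin ((a : ℕ) + 1) => w ⟨b, by omega⟩) := by
      refine hw.comp (fun b : Fin ((a : ℕ) + 1) => (⟨b, by omega⟩ : Fin r)) fun b c hbc => ?_
      simpa [Fin.ext_iff] using hbc
    have h2 := finrank_span_eq_card h1
    rw [Fintype.card_fin] at h2
    rw [← h2]
    refine Submodule.finrank_mono (span_le.mpr ?_)
    rintro _ ⟨b, rfl⟩
    refine ⟨row_mem_rowSpan w _, ?_⟩
    refine span_mono (Set.image_mono ?_) (hech ⟨b, by omega⟩)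
    intro c hc
    have h3 : i ⟨b, by omega⟩ ≤ i a := hi.monotone (by rw [Fin.le_def]; exact Nat.lt_succ_iff.mp b.2)
    simp only [Set.mem_ofPred_eq] at hc ⊢
    rw [Fin.le_def] at h3
    omega

theorem inv_lowerTriangular {n : ℕ} {t : Matrix (Fin n) (Fin n) k}
    (ht : ∀ a b, a < b → t a b = 0) (hdet : IsUnit t.det) : ∀ a b, a < b → t⁻¹ a b = 0 := by
  let _ := t.invertibleOfIsUnitDet hdet
  have h1 : t.BlockTriangular (OrderDual.toDual : Fin n → (Fin n)ᵒᵈ) := fun a b hab => ht a b hab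
  have h2 := Matrix.blockTriangular_inv_of_blockTriangular h1
  exact fun a b hab => h2 hab

theorem spanFlag_mul_of_lowerTriangular {n : ℕ} {t q : Matrix (Fin n) (Fin n) k}
    (ht : ∀ a b, a < b → t a b = 0) (hdet : IsUnit t.det) :
    spanFlag k (t * q).row = spanFlag k q.row := by
  have key : ∀ t q : Matrix (Fin n) (Fin n) k, (∀ a b, a < b → t a b = 0) → ∀ m,
      spanFlag k (t * q).row m ≤ spanFlag k q.row m := by
    intro t q ht m
    refine span_le.mpr ?_
    rintro _ ⟨a, ha, rfl⟩
    refine mem_span_image_iff_vecMul.mpr ⟨t.row a, fun b hb => ht a b ?_, row_mul_eq_vecMul _ _ _⟩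
    simp only [Set.mem_ofPred_eq, not_lt] at ha hb
    rw [Fin.lt_def]
    omega
  funext m
  refine le_antisymm (key t q ht m) ?_
  have := key t⁻¹ (t * q) (inv_lowerTriangular ht hdet) m
  rwa [← Matrix.mul_assoc, Matrix.nonsing_inv_mul _ hdet, Matrix.one_mul] at this

theorem det_of_lowerTriangular_ne_zero {n : ℕ} {t : Matrix (Fin n) (Fin n) k}
    (ht : ∀ a b, a < b → t a b = 0) (hd : ∀ a, t a a ≠ 0) : IsUnit t.det := by
  rw [Matrix.det_of_isLowerTriangular t (fun a b hab => ht a b hab), isUnit_iff_ne_zero]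
  exact Finset.prod_ne_zero_iff.mpr fun a _ => hd a

end flags
end

section
open Topology
open Matrix

section cells
variable {k : Type} [Field k]

theorem vecMul_mem_spanFlag_iff {n r : ℕ} {g : Matrix (Fin n) (Fin n) k} (hg : IsUnit g.det)
    {i : Fin r → Fin n} (hi : StrictMono i) {w : Matrix (Fin r) (Fin n) k}
    (hech : IsEchelon i (w * g⁻¹)) (hne : ∀ a, (w * g⁻¹) a (i a) ≠ 0) {c : Fin r → k} {m : ℕ} :
    c ᵥ* w ∈ spanFlag k g.row m ↔ ∀ a, m ≤ i a → c a = 0 := by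
  rw [mem_spanFlag_iff hg, Matrix.vecMul_vecMul]
  constructor
  · intro h a
    induction a using WellFoundedGT.induction with
    | ind a ih =>
      intro ha
      have h1 := h (i a) ha
      rw [Matrix.vecMul, dotProduct, Finset.sum_eq_single a] at h1
      · exact (mul_eq_zero.mp h1).resolve_right (hne a)
      · intro b _ hb
        rcases lt_or_gt_of_ne hb with hb | hb
        · rw [hech b (i a) (hi hb), mul_zero]
        · rw [ih b hb (ha.trans (Fin.le_def.mp (hi hb).le)), zero_mul]
      · simp
  · intro h u hu
    rw [Matrix.vecMul, dotProduct]
    refine Finset.sum_eq_zero fun a _ => ?_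
    by_cases ha : m ≤ i a
    · rw [h a ha, zero_mul]
    · rw [hech a u (Fin.lt_def.mpr (by omega)), mul_zero]

theorem linearIndependent_of_strict_echelon {n r : ℕ} {g : Matrix (Fin n) (Fin n) k}
    (hg : IsUnit g.det) {i : Fin r → Fin n} (hi : StrictMono i) {w : Matrix (Fin r) (Fin n) k}
    (hech : IsEchelon i (w * g⁻¹)) (hne : ∀ a, (w * g⁻¹) a (i a) ≠ 0) :
    LinearIndependent k w.row := by
  refine Matrix.vecMul_injective_iff.mp ((injective_iff_map_eq_zero w.vecMulLinear).mpr ?_)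
  intro c hc
  have : c ᵥ* w ∈ spanFlag k g.row 0 := by
    rw [show c ᵥ* w = 0 from hc]
    exact zero_mem _
  exact funext fun a => (vecMul_mem_spanFlag_iff hg hi hech hne).mp this a (Nat.zero_le _)

theorem finrank_rowSpan_inf_spanFlag {n r : ℕ} {g : Matrix (Fin n) (Fin n) k}
    (hg : IsUnit g.det) {i : Fin r → Fin n} (hi : StrictMono i) {w : Matrix (Fin r) (Fin n) k}
    (hech : IsEchelon i (w * g⁻¹)) (hne : ∀ a, (w * g⁻¹) a (i a) ≠ 0) (u : ℕ) :
    finrank k ↥(rowSpan w ⊓ spanFlag k g.row u) =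
      (Finset.univ.filter (fun a : Fin r => (i a : ℕ) + 1 ≤ u)).card := by
  have hw := linearIndependent_of_strict_echelon hg hi hech hne
  have h1 : rowSpan w ⊓ spanFlag k g.row u =
      span k (w.row '' {a | (i a : ℕ) + 1 ≤ u}) := by
    ext v
    rw [mem_span_image_iff_vecMul, Submodule.mem_inf, mem_rowSpan_iff]
    constructor
    · rintro ⟨⟨c, rfl⟩, hc⟩
      refine ⟨c, fun a ha => (vecMul_mem_spanFlag_iff hg hi hech hne).mp hc a ?_, rfl⟩
      simpa [Nat.lt_succ_iff] using ha
    · rintro ⟨c, hc, rfl⟩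
      refine ⟨⟨c, rfl⟩, (vecMul_mem_spanFlag_iff hg hi hech hne).mpr fun a ha => hc a ?_⟩
      simpa [Nat.lt_succ_iff] using ha
  have h2 : LinearIndependent k (fun a : {a : Fin r | (i a : ℕ) + 1 ≤ u} => w.row a) :=
    hw.comp Subtype.val Subtype.val_injective
  have h3 := finrank_span_eq_card h2
  rw [h1, Set.image_eq_range, h3, Fintype.card_subtype]
  rfl

theorem cellMem_rowSpan {n r : ℕ} {g : Matrix (Fin n) (Fin n) k}
    (hg : IsUnit g.det) {i : Fin r → Fin n} (hi : StrictMono i) {w : Matrix (Fin r) (Fin n) k}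
    (hech : IsEchelon i (w * g⁻¹)) (hne : ∀ a, (w * g⁻¹) a (i a) ≠ 0) :
    cellMem i (spanFlag k g.row) (rowSpan w) :=
  ⟨finrank_rowSpan (linearIndependent_of_strict_echelon hg hi hech hne),
    fun u _ => finrank_rowSpan_inf_spanFlag hg hi hech hne u⟩

theorem card_filter_succ_le {n r : ℕ} {i : Fin r → Fin n} (hi : StrictMono i) (a : Fin r) :
    (Finset.univ.filter (fun b : Fin r => (i b : ℕ) + 1 ≤ (i a : ℕ) + 1)).card = (a : ℕ) + 1 := by
  rw [← Fin.card_Iic a]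
  refine congrArg _ ?_
  ext b
  simp [Fin.le_def.symm, hi.le_iff_le]

theorem card_filter_le {n r : ℕ} {i : Fin r → Fin n} (hi : StrictMono i) (a : Fin r) :
    (Finset.univ.filter (fun b : Fin r => (i b : ℕ) + 1 ≤ (i a : ℕ))).card = (a : ℕ) := by
  conv_rhs => rw [← Fin.card_Iio a]
  congr 1
  ext b
  simp [Fin.lt_def.symm, hi.lt_iff_lt]

theorem varMem_of_cellMem {M : Type} [AddCommGroup M] [Module k M] {n r : ℕ}
    {i : Fin r → Fin n} (hi : StrictMono i) {E : ℕ → Submodule k M} {V : Submodule k M}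
    (h : cellMem i E V) : varMem i E V :=
  ⟨h.1, fun a => by rw [h.2 _ (i a).2, card_filter_succ_le hi]⟩

theorem exists_strict_echelon_of_cellMem {n r : ℕ} {g : Matrix (Fin n) (Fin n) k}
    (hg : IsUnit g.det) {i : Fin r → Fin n} (hi : StrictMono i) {V : Submodule k (Fin n → k)}
    (h : cellMem i (spanFlag k g.row) V) :
    ∃ w : Matrix (Fin r) (Fin n) k, LinearIndependent k w.row ∧ rowSpan w = V ∧
      IsEchelon i (w * g⁻¹) ∧ ∀ a, (w * g⁻¹) a (i a) ≠ 0 := by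
  obtain ⟨w, hw, rfl, hech⟩ := (varMem_spanFlag_iff hg hi).mp (varMem_of_cellMem hi h)
  refine ⟨w, hw, rfl, hech, fun a ha => ?_⟩
  have h0 := h.2 (i a) (i a).2.le
  rw [card_filter_le hi] at h0
  have h1 : LinearIndependent k (fun b : Fin ((a : ℕ) + 1) => w.row ⟨b, by omega⟩) := by
    refine hw.comp (fun b : Fin ((a : ℕ) + 1) => (⟨b, by omega⟩ : Fin r)) fun b c hbc => ?_
    simpa [Fin.ext_iff] using hbc
  have h2 := finrank_span_eq_card h1
  rw [Fintype.card_fin] at h2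
  have h3 : span k (Set.range fun b : Fin ((a : ℕ) + 1) => w.row ⟨b, by omega⟩) ≤
      rowSpan w ⊓ spanFlag k g.row (i a) := by
    refine span_le.mpr ?_
    rintro _ ⟨b, rfl⟩
    refine ⟨row_mem_rowSpan w _, ?_⟩
    rw [SetLike.mem_coe, mem_spanFlag_iff hg]
    intro u hu
    rw [← row_mul_eq_vecMul]
    have hb : (⟨b, by omega⟩ : Fin r) ≤ a := Fin.le_def.mpr (Nat.lt_succ_iff.mp b.2)
    rcases eq_or_lt_of_le (Fin.le_def.mpr hu : i a ≤ u) with hu' | hu'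
    · rcases eq_or_lt_of_le hb with hb | hb
      · rw [hb, ← hu']
        exact ha
      · exact hech _ _ (hu' ▸ hi hb)
    · exact hech _ _ ((hi.monotone hb).trans_lt hu')
  have h4 := Submodule.finrank_mono h3
  omega

theorem exists_rowSpan_equiv {n r : ℕ} {A : Matrix (Fin r) (Fin n) k}
    (hA : LinearIndependent k A.row) {V : Submodule k (Fin n → k)} (hV : rowSpan A = V) :
    ∃ θ : (Fin r → k) ≃ₗ[k] V, ∀ c, (θ c : Fin n → k) = c ᵥ* A := by
  have h : ∀ c, A.vecMulLinear c ∈ V := fun c => hV ▸ mem_rowSpan_iff.mpr ⟨c, rfl⟩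
  refine ⟨LinearEquiv.ofBijective (A.vecMulLinear.codRestrict V h) ⟨?_, ?_⟩, fun c => rfl⟩
  · intro c c' hcc
    exact vecMul_injective_of_linearIndependent hA (congrArg Subtype.val hcc)
  · rintro ⟨v, hv⟩
    obtain ⟨c, hc⟩ := mem_rowSpan_iff.mp (hV.symm ▸ hv : v ∈ rowSpan A)
    exact ⟨c, Subtype.ext hc.symm⟩

/-- The flag induced on a point of a Schubert cell, in the coordinates given by a basis. -/
theorem comap_indSub_spanFlag {n r : ℕ} {g : Matrix (Fin n) (Fin n) k}
    (hg : IsUnit g.det) {i : Fin r → Fin n} (hi : StrictMono i) {A : Matrix (Fin r) (Fin n) k}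
    {q : Matrix (Fin r) (Fin r) k} (hq : IsUnit q.det)
    (hech : IsEchelon i (q * A * g⁻¹)) (hne : ∀ a, (q * A * g⁻¹) a (i a) ≠ 0)
    {V : Submodule k (Fin n → k)} (hV : rowSpan A = V)
    (θ : (Fin r → k) ≃ₗ[k] V) (hθ : ∀ c, (θ c : Fin n → k) = c ᵥ* A) (a : ℕ) :
    Submodule.comap θ.toLinearMap (indSub (spanFlag k g.row) V a) = spanFlag k q.row a := by
  have hV' : rowSpan (q * A) = V := (rowSpan_mul hq A).trans hV
  have hdim : ∀ u, finrank k ↥(Submodule.comap V.subtype (spanFlag k g.row u)) =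
      (Finset.univ.filter (fun a : Fin r => (i a : ℕ) + 1 ≤ u)).card := by
    intro u
    rw [← finrank_rowSpan_inf_spanFlag hg hi hech hne u, hV',
      ← Submodule.map_comap_subtype]
    exact (Submodule.equivMapOfInjective _ V.injective_subtype _).finrank_eq
  ext c
  rw [Submodule.mem_comap, mem_spanFlag_iff hq, indSub]
  simp only [Submodule.mem_iInf, Set.mem_ofPred_eq, hdim, Submodule.mem_comap]
  have hc : (θ c : Fin n → k) = (c ᵥ* q⁻¹) ᵥ* (q * A) := by
    rw [hθ, Matrix.vecMul_vecMul, ← Matrix.mul_assoc, Matrix.nonsing_inv_mul _ hq, Matrix.one_mul]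
  change (∀ u, _ → (θ c : Fin n → k) ∈ _) ↔ _
  simp only [hc, vecMul_mem_spanFlag_iff hg hi hech hne]
  constructor
  · intro h b hb
    exact h (i b) (by rwa [card_filter_le hi]) b le_rfl
  · intro h u hu b hb
    refine h b (hu.trans ?_)
    rw [← card_filter_le hi b]
    refine Finset.card_le_card fun b' => ?_
    simp only [Finset.mem_filter, Finset.mem_univ, true_and]
    omega

end cells
end

section
open Topology
open Matrix

section ratFun
variable {k X M N : Type} [Field k] [AddCommGroup M] [Module k M] [AddCommGroup N] [Module k N]

/-- The functions that become members of `A` after multiplication by a power of `Δ`, on the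
locus where `Δ` does not vanish. -/
def ratFun (A : Subalgebra k (X → k)) (Δ : A) : Subalgebra k (X → k) where
  carrier := {F | ∃ N : ℕ, ∃ P ∈ A, ∀ x, Δ.1 x ≠ 0 → P x = Δ.1 x ^ N * F x}
  mul_mem' := by
    rintro F G ⟨N, P, hP, hF⟩ ⟨N', P', hP', hG⟩
    refine ⟨N + N', P * P', A.mul_mem hP hP', fun x hx => ?_⟩
    simp only [Pi.mul_apply, hF x hx, hG x hx]
    ring
  add_mem' := by
    rintro F G ⟨N, P, hP, hF⟩ ⟨N', P', hP', hG⟩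
    refine ⟨N + N', Δ.1 ^ N' * P + Δ.1 ^ N * P', A.add_mem (A.mul_mem (A.pow_mem Δ.2 _) hP)
      (A.mul_mem (A.pow_mem Δ.2 _) hP'), fun x hx => ?_⟩
    simp only [Pi.mul_apply, Pi.add_apply, Pi.pow_apply, hF x hx, hG x hx]
    ring
  algebraMap_mem' c := ⟨0, _, A.algebraMap_mem c, fun x _ => by simp⟩

theorem le_ratFun (A : Subalgebra k (X → k)) (Δ : A) : A ≤ ratFun A Δ := fun F hF =>
  ⟨0, F, hF, fun x _ => by simp⟩

theorem inv_mem_ratFun {A : Subalgebra k (X → k)} {Δ : A} {D E : X → k} (hE : E ∈ A)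
    (h : ∀ x, Δ.1 x = D x * E x) : (fun x => (D x)⁻¹) ∈ ratFun A Δ := by
  refine ⟨1, E, hE, fun x hx => ?_⟩
  have : D x ≠ 0 := fun h0 => hx (by rw [h, h0, zero_mul])
  rw [h, pow_one]
  field_simp

theorem inv_mem_of_entries {ι : Type} [Fintype ι] [DecidableEq ι]
    {A : Subalgebra k (X → k)} {F : X → Matrix ι ι k} (hF : ∀ i j, (fun x => F x i j) ∈ A)
    (hd : (fun x => (F x).det⁻¹) ∈ A) (i j : ι) : (fun x => (F x)⁻¹ i j) ∈ A := by
  have : (fun x => (F x)⁻¹ i j) = (fun x => (F x).det⁻¹) * fun x => (F x).adjugate i j := by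
    ext x
    simp [Matrix.inv_def]
  rw [this]
  exact A.mul_mem hd (adjugate_mem_of_entries hF i j)

theorem isOpen_of_mem_ratFun {Δ : polyFun k M} {F : M → k} (hF : F ∈ ratFun _ Δ) :
    IsOpen[mZariski k M] {x | Δ.1 x ≠ 0 ∧ F x ≠ 0} := by
  obtain ⟨m, P, hP, h⟩ := hF
  convert isOpen_ne_zero_of_mem_polyFun (Subalgebra.mul_mem _ Δ.2 hP) using 1
  ext x
  simp only [Set.mem_ofPred_eq, Pi.mul_apply, mul_ne_zero_iff]
  refine and_congr_right fun hx => ?_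
  rw [h x hx]
  simp [hx]

theorem isOpen_preimage_of_ratFun {Δ : polyFun k M} {F : M → N}
    (hF : ∀ l : N →ₗ[k] k, (fun x => l (F x)) ∈ ratFun _ Δ) {U : Set N}
    (hU : IsOpen[mZariski k N] U) : IsOpen[mZariski k M] {x | Δ.1 x ≠ 0 ∧ F x ∈ U} := by
  let _ := mZariski k M
  rw [isOpen_iff_mem_nhds]
  rintro x ⟨hx, hxU⟩
  obtain ⟨f, hf, hfx, hfU⟩ := isOpen_mZariski_iff.mp hU (F x) hxU
  exact Filter.mem_of_superset
    ((isOpen_of_mem_ratFun (comp_mem_of_mem_polyFun hF hf)).mem_nhds ⟨hx, hfx⟩)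
    fun y hy => ⟨hy.1, hfU _ hy.2⟩

end ratFun

section grTop
variable {k M N : Type} [Field k] [AddCommGroup M] [Module k M] [AddCommGroup N] [Module k N]

theorem continuous_map_grTop (e : M ≃ₗ[k] N) (d : ℕ) :
    Continuous[grTop k d, grTop k d] (Submodule.map e.toLinearMap) := by
  let _ := mZariski k (Fin d → M)
  let _ := mZariski k (Fin d → N)
  refine continuous_iff_coinduced_le.mpr ?_
  rw [grTop, coinduced_compose]
  have h : (Submodule.map e.toLinearMap ∘ fun b : Fin d → M => span k (Set.range b)) =
      (fun b : Fin d → N => span k (Set.range b)) ∘ (LinearMap.compLeft e.toLinearMap (Fin d)) := by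
    ext1 b
    simp only [Function.comp_apply, Submodule.map_span, ← Set.range_comp]
    rfl
  rw [h, ← coinduced_compose]
  exact coinduced_mono (continuous_iff_coinduced_le.mp (continuous_mZariski_linear _))

/-- A linear equivalence induces a homeomorphism of Grassmannians. -/
def grHomeomorph (e : M ≃ₗ[k] N) (d : ℕ) :
    @Homeomorph (Submodule k M) (Submodule k N) (grTop k d) (grTop k d) :=
  letI := grTop k (M := M) d
  letI := grTop k (M := N) d
  { toFun := Submodule.map e.toLinearMap
    invFun := Submodule.map e.symm.toLinearMap
    left_inv := fun S => by
      rw [← Submodule.map_comp]; simp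
    right_inv := fun S => by
      rw [← Submodule.map_comp]; simp
    continuous_toFun := continuous_map_grTop e d
    continuous_invFun := continuous_map_grTop e.symm d }

theorem continuous_rowSpan (d n : ℕ) :
    @Continuous _ _ (mZariski k (Fin d → Fin n → k)) (grTop k d)
      (fun A => rowSpan (Matrix.of A)) :=
  continuous_iff_coinduced_le.mpr le_rfl

theorem isOpen_rowSpan_image {d n : ℕ} {Ω : Set (Fin d → Fin n → k)}
    (hΩ : IsOpen[mZariski k (Fin d → Fin n → k)] Ω)
    (hli : ∀ A ∈ Ω, LinearIndependent k A) :
    IsOpen[grTop k d] ((fun A : Fin d → Fin n → k => rowSpan (Matrix.of A)) '' Ω) := by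
  let _ := mZariski k (Fin d → Fin n → k)
  change IsOpen ((fun A : Fin d → Fin n → k => rowSpan (Matrix.of A)) ⁻¹' _)
  let L : Matrix (Fin d) (Fin d) k → (Fin d → Fin n → k) →ₗ[k] (Fin d → Fin n → k) := fun c =>
    (Matrix.ofLinearEquiv k).symm.toLinearMap ∘ₗ mulLeftLinearMap (Fin n) k c ∘ₗ
      (Matrix.ofLinearEquiv k).toLinearMap
  have hL : ∀ c A, Matrix.of (L c A) = c * Matrix.of A := fun c A => rfl
  have : ((fun A : Fin d → Fin n → k => rowSpan (Matrix.of A)) ⁻¹'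
      ((fun A : Fin d → Fin n → k => rowSpan (Matrix.of A)) '' Ω)) =
      ⋃ c : {c : Matrix (Fin d) (Fin d) k // IsUnit c.det}, L c.1 ⁻¹' Ω := by
    ext B
    simp only [Set.mem_preimage, Set.mem_image, Set.mem_iUnion, Subtype.exists]
    constructor
    · rintro ⟨A, hA, hAB⟩
      obtain ⟨c, hc, h⟩ := exists_mul_eq_of_rowSpan_eq (w := Matrix.of B) (w' := Matrix.of A)
        (hli A hA) hAB.symm
      refine ⟨c, hc, ?_⟩
      rw [show L c B = A from h.symm]
      exact hA
    · rintro ⟨c, hc, hB⟩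
      exact ⟨L c B, hB, by rw [hL, rowSpan_mul hc]⟩
  rw [this]
  exact isOpen_iUnion fun c => IsOpen.preimage (continuous_mZariski_linear (L c.1)) hΩ

end grTop
end

section
open Topology
open Matrix

section
variable {k : Type} [Field k]

theorem exists_mul_ne_zero_of_polyFun [Infinite k] {M : Type} [AddCommGroup M] [Module k M]
    [FiniteDimensional k M] {f g : M → k} (hf : f ∈ polyFun k M) (hg : g ∈ polyFun k M)
    (hf0 : ∃ x, f x ≠ 0) (hg0 : ∃ x, g x ≠ 0) : ∃ x, f x ≠ 0 ∧ g x ≠ 0 := by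
  let b := Module.finBasis k M
  obtain ⟨p, hp⟩ := mem_polyFun_comp_equivFun b hf
  obtain ⟨q, hq⟩ := mem_polyFun_comp_equivFun b hg
  have hp0 : p ≠ 0 := by
    rintro rfl
    obtain ⟨x, hx⟩ := hf0
    exact hx (by rw [hp]; simp)
  have hq0 : q ≠ 0 := by
    rintro rfl
    obtain ⟨x, hx⟩ := hg0
    exact hx (by rw [hq]; simp)
  obtain ⟨z, hz⟩ : ∃ z, MvPolynomial.eval z (p * q) ≠ 0 := by
    by_contra! hcon
    exact mul_ne_zero hp0 hq0 (MvPolynomial.funext fun z => by rw [hcon z, map_zero])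
  rw [map_mul, mul_ne_zero_iff] at hz
  refine ⟨b.equivFun.symm z, ?_, ?_⟩
  · rw [hp, b.equivFun.apply_symm_apply]; exact hz.1
  · rw [hq, b.equivFun.apply_symm_apply]; exact hz.2

theorem exists_polyFun_ne_zero_of_finite [Infinite k] {M ι : Type} [AddCommGroup M] [Module k M]
    [FiniteDimensional k M] [Finite ι] (f : ι → M → k) (hf : ∀ i, f i ∈ polyFun k M)
    (h0 : ∀ i, ∃ x, f i x ≠ 0) :
    ∃ F ∈ polyFun k M, (∃ x, F x ≠ 0) ∧ ∀ x, F x ≠ 0 → ∀ i, f i x ≠ 0 := by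
  classical
  let _ := Fintype.ofFinite ι
  have key : ∀ S : Finset ι, ∃ F ∈ polyFun k M, (∃ x, F x ≠ 0) ∧ ∀ x, F x ≠ 0 → ∀ i ∈ S, f i x ≠ 0 := by
    intro S
    induction S using Finset.induction_on with
    | empty => exact ⟨1, one_mem _, ⟨0, one_ne_zero⟩, by simp⟩
    | insert i S _ ih =>
      obtain ⟨F, hF, hF0, hFS⟩ := ih
      obtain ⟨x, hx⟩ := exists_mul_ne_zero_of_polyFun hF (hf i) hF0 (h0 i)
      refine ⟨F * f i, mul_mem hF (hf i), ⟨x, mul_ne_zero hx.1 hx.2⟩, fun y hy i' hi' => ?_⟩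
      rw [Pi.mul_apply, mul_ne_zero_iff] at hy
      rcases Finset.mem_insert.mp hi' with rfl | hi'
      · exact hy.2
      · exact hFS y hy.1 i' hi'
  obtain ⟨F, hF, hF0, h⟩ := key Finset.univ
  exact ⟨F, hF, hF0, fun x hx i => h x hx i (Finset.mem_univ i)⟩

theorem exists_isUnit_det_extension {n r : ℕ} (hr : r ≤ n) {A : Matrix (Fin r) (Fin n) k}
    (hA : LinearIndependent k A.row) :
    ∃ γ : Matrix (Fin n) (Fin n) k, IsUnit γ.det ∧ ∀ a, γ.row (Fin.castLE hr a) = A.row a := by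
  let b := Basis.sumExtend hA
  have hb : ∀ a, b (Sum.inl a) = A.row a := fun a => by
    simp only [b, Basis.sumExtend, Basis.reindex_apply, Basis.extend_apply_self]
    rfl
  have : Finite (Fin r ⊕ Basis.sumExtendIndex hA) := Module.Finite.finite_basis b
  have : Finite (Basis.sumExtendIndex hA) :=
    Finite.of_injective (Sum.inr : _ → Fin r ⊕ Basis.sumExtendIndex hA) Sum.inr_injective
  have hcard := Module.finrank_eq_nat_card_basis b
  rw [Module.finrank_fin_fun, Nat.card_sum, Nat.card_fin] at hcard
  let e : Basis.sumExtendIndex hA ≃ Fin (n - r) := Finite.equivFinOfCardEq (by omega)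
  let e' : Fin r ⊕ Basis.sumExtendIndex hA ≃ Fin n :=
    ((Equiv.refl _).sumCongr e).trans (finSumFinEquiv.trans (finCongr (by omega)))
  have he : ∀ a, e' (Sum.inl a) = Fin.castLE hr a := fun a => by ext; simp [e']
  refine ⟨Matrix.of fun u => b (e'.symm u), ?_, fun a => ?_⟩
  · rw [← Matrix.isUnit_iff_isUnit_det, ← Matrix.linearIndependent_rows_iff_isUnit]
    exact b.linearIndependent.comp _ e'.symm.injective
  · rw [← he, ← hb]
    change b (e'.symm (e' _)) = _
    rw [Equiv.symm_apply_apply]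

end
end

section
open Topology
open Matrix

section
variable {k : Type} [Field k]

theorem le_apply_of_strictMono {r n : ℕ} {i : Fin r → Fin n} (hi : StrictMono i) (a : Fin r) :
    (a : ℕ) ≤ i a := by
  obtain ⟨a, ha⟩ := a
  induction a with
  | zero => exact Nat.zero_le _
  | succ a ih =>
    have h1 := ih (by omega)
    have h2 : i ⟨a, by omega⟩ < i ⟨a + 1, ha⟩ := hi (by simp [Fin.lt_def])
    rw [Fin.lt_def] at h2
    simp only at h1 ⊢
    omega

/-- The first `r` rows of a square matrix. -/
def topRows {r n : ℕ} (hr : r ≤ n) (γ : Matrix (Fin n) (Fin n) k) : Matrix (Fin r) (Fin n) k :=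
  γ.submatrix (Fin.castLE hr) id

/-- The upper left `r × r` block. -/
def topLeft {r n : ℕ} (hr : r ≤ n) (p : Matrix (Fin n) (Fin n) k) : Matrix (Fin r) (Fin r) k :=
  p.submatrix (Fin.castLE hr) (Fin.castLE hr)

open Classical in
/-- Erase the entries in the first rows that violate the echelon condition. -/
def echelonMask {r n : ℕ} (hr : r ≤ n) (i : Fin r → Fin n) (m : Fin n → Fin n → k) :
    Matrix (Fin n) (Fin n) k :=
  Matrix.of fun a u => if ∃ b, Fin.castLE hr b = a ∧ i b < u then 0 else m a u

/-- Erase the upper right block. -/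
def blockMask {n : ℕ} (r : ℕ) (p : Fin n → Fin n → k) : Matrix (Fin n) (Fin n) k :=
  Matrix.of fun a u => if (a : ℕ) < r ∧ r ≤ (u : ℕ) then 0 else p a u

theorem isEchelon_topRows_echelonMask {r n : ℕ} (hr : r ≤ n) (i : Fin r → Fin n)
    (m : Fin n → Fin n → k) : IsEchelon i (topRows hr (echelonMask hr i m)) := by
  intro a u hu
  simp only [topRows, echelonMask, Matrix.submatrix_apply, Matrix.of_apply, id]
  exact if_pos ⟨a, rfl, hu⟩

theorem echelonMask_eq {r n : ℕ} (hr : r ≤ n) {i : Fin r → Fin n} {m : Matrix (Fin n) (Fin n) k}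
    (h : IsEchelon i (topRows hr m)) : echelonMask hr i (fun a u => m a u) = m := by
  ext a u
  simp only [echelonMask, Matrix.of_apply]
  split_ifs with hc
  · obtain ⟨b, rfl, hb⟩ := hc
    exact (h b u hb).symm
  · rfl

theorem blockMask_eq {n r : ℕ} {p : Matrix (Fin n) (Fin n) k}
    (h : ∀ a u : Fin n, (a : ℕ) < r → r ≤ (u : ℕ) → p a u = 0) :
    blockMask r (fun a u => p a u) = p := by
  ext a u
  simp only [blockMask, Matrix.of_apply]
  split_ifs with hc
  · exact (h a u hc.1 hc.2).symm
  · rfl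

theorem topRows_blockMask_mul {r n : ℕ} (hr : r ≤ n) (p : Fin n → Fin n → k)
    (γ : Matrix (Fin n) (Fin n) k) :
    topRows hr (blockMask r p * γ) = topLeft hr (blockMask r p) * topRows hr γ := by
  ext a c
  simp only [topRows, topLeft, Matrix.submatrix_apply, Matrix.mul_apply, id]
  refine (Fintype.sum_of_injective (Fin.castLE hr) (Fin.castLE_injective hr) _ _ ?_ ?_).symm
  · intro u hu
    have : r ≤ (u : ℕ) := by
      by_contra! h
      exact hu ⟨⟨u, h⟩, rfl⟩
    rw [blockMask, Matrix.of_apply, if_pos ⟨a.2, this⟩, zero_mul]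
  · exact fun b => rfl

theorem topRows_mul {r n : ℕ} (hr : r ≤ n) (p γ : Matrix (Fin n) (Fin n) k) :
    topRows hr (p * γ) = topRows hr p * γ := rfl

section mem
variable {X : Type} {A : Subalgebra k (X → k)} {r n : ℕ} (hr : r ≤ n)

theorem echelonMask_mem {m : X → Fin n → Fin n → k} (hm : ∀ a u, (fun x => m x a u) ∈ A)
    (i : Fin r → Fin n) (a u : Fin n) : (fun x => echelonMask hr i (m x) a u) ∈ A := by
  simp only [echelonMask, Matrix.of_apply]
  split_ifs
  · exact A.zero_mem
  · exact hm a u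

theorem blockMask_mem {p : X → Fin n → Fin n → k} (hp : ∀ a u, (fun x => p x a u) ∈ A)
    (a u : Fin n) : (fun x => blockMask r (p x) a u) ∈ A := by
  simp only [blockMask, Matrix.of_apply]
  split_ifs
  · exact A.zero_mem
  · exact hp a u

end mem

theorem echelonMask_one {r n : ℕ} (hr : r ≤ n) {i : Fin r → Fin n} (hi : StrictMono i) :
    echelonMask hr i (fun a u => (1 : Matrix (Fin n) (Fin n) k) a u) = 1 := by
  refine echelonMask_eq hr fun a u hu => ?_
  simp only [topRows, Matrix.submatrix_apply]
  refine Matrix.one_apply_ne fun h => ?_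
  have := le_apply_of_strictMono hi a
  have h' : (a : ℕ) = u := congrArg Fin.val h
  rw [Fin.lt_def] at hu
  omega

theorem topLeft_blockMask_one {r n : ℕ} (hr : r ≤ n) :
    topLeft hr (blockMask r fun a u => (1 : Matrix (Fin n) (Fin n) k) a u) = 1 := by
  rw [blockMask_eq]
  · ext a b
    simp [topLeft, Matrix.one_apply, Fin.ext_iff]
  · intro a u ha hu
    exact Matrix.one_apply_ne fun h => by rw [h] at ha; omega

theorem exists_topLeft_blockMask_eq {r n : ℕ} (hr : r ≤ n) (q : Fin r → Fin r → k) :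
    ∃ p : Fin n → Fin n → k, topLeft hr (blockMask r p) = Matrix.of q := by
  refine ⟨fun a u => if h : (a : ℕ) < r ∧ (u : ℕ) < r then q ⟨a, h.1⟩ ⟨u, h.2⟩ else 0, ?_⟩
  ext a b
  simp [topLeft, blockMask]

end
end

section
open Topology
open Matrix

section
variable {k : Type} [Field k]

/-- The parameters for a tuple of flags together with a point of the intersection of the
associated Schubert varieties. -/
abbrev IncidenceSpace (k : Type) (s n : ℕ) : Type :=
  (Fin n → Fin n → k) × (Fin s → Fin n → Fin n → k) × (Fin s → Fin n → Fin n → k)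

section
variable {s n : ℕ}

theorem fst_entry_mem (a b : Fin n) :
    (fun x : IncidenceSpace k s n => x.1 a b) ∈ polyFun k (IncidenceSpace k s n) :=
  linear_mem_polyFun (⟨⟨fun x => x.1 a b, fun _ _ => rfl⟩, fun _ _ => rfl⟩ :
    IncidenceSpace k s n →ₗ[k] k)

theorem snd_fst_entry_mem (j : Fin s) (a b : Fin n) :
    (fun x : IncidenceSpace k s n => x.2.1 j a b) ∈ polyFun k (IncidenceSpace k s n) :=
  linear_mem_polyFun (⟨⟨fun x => x.2.1 j a b, fun _ _ => rfl⟩, fun _ _ => rfl⟩ :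
    IncidenceSpace k s n →ₗ[k] k)

theorem snd_snd_entry_mem (j : Fin s) (a b : Fin n) :
    (fun x : IncidenceSpace k s n => x.2.2 j a b) ∈ polyFun k (IncidenceSpace k s n) :=
  linear_mem_polyFun (⟨⟨fun x => x.2.2 j a b, fun _ _ => rfl⟩, fun _ _ => rfl⟩ :
    IncidenceSpace k s n →ₗ[k] k)

/-- The tuple of bases attached to a point of the incidence space. -/
def incidenceFlags {r : ℕ} (hr : r ≤ n) (I : Fin s → Fin r → Fin n)
    (x : IncidenceSpace k s n) : Fin s → Fin n → Fin n → k := fun j =>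
  ((echelonMask hr (I j) (x.2.1 j)).adjugate * (blockMask r (x.2.2 j) * Matrix.of x.1)).row

theorem incidenceFlags_mem {r : ℕ} (hr : r ≤ n) (I : Fin s → Fin r → Fin n)
    (l : (Fin s → Fin n → Fin n → k) →ₗ[k] k) :
    (fun x => l (incidenceFlags hr I x)) ∈ polyFun k (IncidenceSpace k s n) := by
  refine dual_comp_mem_pi (fun j => dual_comp_mem_pi fun a => dual_comp_mem_pi fun b =>
    dual_comp_mem_self ?_) l
  exact mul_mem_of_entries
    (fun a b => adjugate_mem_of_entries (echelonMask_mem hr (snd_fst_entry_mem j) (I j)) a b)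
    (fun a b => mul_mem_of_entries (blockMask_mem (snd_snd_entry_mem j)) fst_entry_mem a b) a b

theorem topRows_mul_inv_of_incidenceFlags {r : ℕ} (hr : r ≤ n) {I : Fin s → Fin r → Fin n}
    {x : IncidenceSpace k s n} {g : Fin s → Matrix (Fin n) (Fin n) k}
    (h : incidenceFlags hr I x = fun j => (g j).row) (j : Fin s) (hg : IsUnit (g j).det) :
    (echelonMask hr (I j) (x.2.1 j)).det •
      (topLeft hr (blockMask r (x.2.2 j)) * topRows hr (Matrix.of x.1) * (g j)⁻¹) =
      topRows hr (echelonMask hr (I j) (x.2.1 j)) := by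
  have h1 : (echelonMask hr (I j) (x.2.1 j)).adjugate * (blockMask r (x.2.2 j) * Matrix.of x.1) =
    g j := congrFun h j
  have h2 : (echelonMask hr (I j) (x.2.1 j)).det • (blockMask r (x.2.2 j) * Matrix.of x.1) =
      echelonMask hr (I j) (x.2.1 j) * g j := by
    rw [← h1, ← Matrix.mul_assoc, Matrix.mul_adjugate, Matrix.smul_mul, Matrix.one_mul]
  rw [← topRows_blockMask_mul, ← Matrix.smul_mul]
  have h3 : (echelonMask hr (I j) (x.2.1 j)).det • topRows hr
      (blockMask r (x.2.2 j) * Matrix.of x.1) =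
      topRows hr (echelonMask hr (I j) (x.2.1 j) * g j) := congrArg (topRows hr) h2
  rw [h3, topRows_mul, Matrix.mul_assoc, Matrix.mul_nonsing_inv _ hg, Matrix.mul_one]

end

theorem exists_generic_incidence [Infinite k] {s n r : ℕ} (hr : r ≤ n)
    {I : Fin s → Fin r → Fin n} (hI : ∀ j, StrictMono (I j))
    {h : (Fin s → Fin r → Fin r → k) → k} (hh : h ∈ polyFun k _) (h0 : ∃ q, h q ≠ 0) :
    ∃ F ∈ polyFun k (IncidenceSpace k s n), (∃ x, F x ≠ 0) ∧ ∀ x, F x ≠ 0 →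
      h (fun j => (topLeft hr (blockMask r (x.2.2 j))).row) ≠ 0 ∧
      (∀ j, (topLeft hr (blockMask r (x.2.2 j))).det ≠ 0) ∧
      (∀ j, (echelonMask hr (I j) (x.2.1 j)).det ≠ 0) ∧
      ∀ j a, echelonMask hr (I j) (x.2.1 j) (Fin.castLE hr a) (I j a) ≠ 0 := by
  have hq : ∀ j a b, (fun x : IncidenceSpace k s n => topLeft hr (blockMask r (x.2.2 j)) a b) ∈
      polyFun k (IncidenceSpace k s n) := fun j a b =>
    blockMask_mem (snd_snd_entry_mem j) (Fin.castLE hr a) (Fin.castLE hr b)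
  have hm : ∀ j a b, (fun x : IncidenceSpace k s n => echelonMask hr (I j) (x.2.1 j) a b) ∈
      polyFun k (IncidenceSpace k s n) := fun j a b =>
    echelonMask_mem hr (snd_fst_entry_mem j) (I j) a b
  let Φ : (Unit ⊕ Fin s ⊕ Fin s ⊕ (Fin s × Fin r)) → IncidenceSpace k s n → k :=
    Sum.elim (fun _ x => h (fun j => (topLeft hr (blockMask r (x.2.2 j))).row))
      (Sum.elim (fun j x => (topLeft hr (blockMask r (x.2.2 j))).det)
        (Sum.elim (fun j x => (echelonMask hr (I j) (x.2.1 j)).det)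
          (fun ja x => echelonMask hr (I ja.1) (x.2.1 ja.1) (Fin.castLE hr ja.2) (I ja.1 ja.2))))
  have hΦ : ∀ i, Φ i ∈ polyFun k (IncidenceSpace k s n) := by
    rintro (_ | j | j | ⟨j, a⟩)
    · exact comp_mem_of_mem_polyFun (fun l => dual_comp_mem_pi (fun j => dual_comp_mem_pi fun a =>
        dual_comp_mem_pi fun b => dual_comp_mem_self (hq j a b)) l) hh
    · exact det_mem_of_entries (hq j)
    · exact det_mem_of_entries (hm j)
    · exact hm j _ _
  have hΦ0 : ∀ i, ∃ x, Φ i x ≠ 0 := by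
    rintro (_ | j | j | ⟨j, a⟩)
    · obtain ⟨q, hq0⟩ := h0
      choose p hp using fun j => exists_topLeft_blockMask_eq hr (q j)
      refine ⟨(0, 0, p), ?_⟩
      simp only [Φ, Sum.elim_inl, hp]
      exact hq0
    · refine ⟨(0, 0, fun _ a u => (1 : Matrix (Fin n) (Fin n) k) a u), ?_⟩
      simp [Φ, topLeft_blockMask_one]
    · refine ⟨(0, fun _ a u => (1 : Matrix (Fin n) (Fin n) k) a u, 0), ?_⟩
      simp [Φ, echelonMask_one hr (hI j)]
    · refine ⟨(0, fun _ _ _ => 1, 0), ?_⟩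
      simp only [Φ, Sum.elim_inr, echelonMask, Matrix.of_apply]
      rw [if_neg]
      · exact one_ne_zero
      · rintro ⟨b, hb, hlt⟩
        rw [Fin.castLE_injective hr hb] at hlt
        exact lt_irrefl _ hlt
  obtain ⟨F, hF, hF0, hFx⟩ := exists_polyFun_ne_zero_of_finite Φ hΦ hΦ0
  refine ⟨F, hF, hF0, fun x hx => ⟨?_, fun j => ?_, fun j => ?_, fun j a => ?_⟩⟩
  · exact hFx x hx (Sum.inl ())
  · exact hFx x hx (Sum.inr (Sum.inl j))
  · exact hFx x hx (Sum.inr (Sum.inr (Sum.inl j)))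
  · exact hFx x hx (Sum.inr (Sum.inr (Sum.inr (j, a))))

theorem exists_incidenceFlags_eq {s n r : ℕ} (hs : 0 < s) (hr : r ≤ n)
    {I : Fin s → Fin r → Fin n} (hI : ∀ j, StrictMono (I j))
    {g : Fin s → Matrix (Fin n) (Fin n) k} (hg : ∀ j, IsUnit (g j).det)
    {V : Submodule k (Fin n → k)} (hV : ∀ j, varMem (I j) (spanFlag k (g j).row) V) :
    ∃ x : IncidenceSpace k s n, incidenceFlags hr I x = (fun j => (g j).row) ∧
      rowSpan (topRows hr (Matrix.of x.1)) = V := by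
  choose w hw hwV hech using fun j => (varMem_spanFlag_iff (hg j) (hI j)).mp (hV j)
  have hli : ∀ j, LinearIndependent k (w j * (g j)⁻¹).row := by
    intro j
    refine Matrix.vecMul_injective_iff.mp fun c c' hcc => ?_
    refine vecMul_injective_of_linearIndependent (hw j) ?_
    have := congrArg (· ᵥ* g j) hcc
    simpa [Matrix.vecMul_vecMul, Matrix.mul_assoc, Matrix.nonsing_inv_mul _ (hg j)] using this
  obtain ⟨γ, hγ, hγw⟩ := exists_isUnit_det_extension hr (hw ⟨0, hs⟩)
  choose m hm hmx using fun j => exists_isUnit_det_extension hr (hli j)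
  have hγV : rowSpan (topRows hr γ) = V := by
    rw [← hwV ⟨0, hs⟩]
    exact congrArg rowSpan (Matrix.ext_row hγw)
  have hmT : ∀ j, topRows hr (m j) = w j * (g j)⁻¹ := fun j => Matrix.ext_row (hmx j)
  let p : Fin s → Matrix (Fin n) (Fin n) k := fun j => (m j).det⁻¹ • (m j * g j * γ⁻¹)
  have hmask : ∀ j, echelonMask hr (I j) (fun a u => m j a u) = m j := fun j =>
    echelonMask_eq hr (by rw [hmT]; exact hech j)
  have hpmask : ∀ j, blockMask r (fun a u => p j a u) = p j := by
    intro j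
    refine blockMask_eq fun a u ha hu => ?_
    have h1 : topRows hr (m j * g j) = w j := by
      rw [topRows_mul, hmT, Matrix.mul_assoc, Matrix.nonsing_inv_mul _ (hg j), Matrix.mul_one]
    have h2 : (w j).row ⟨a, ha⟩ ∈ rowSpan (topRows hr γ) := by
      rw [hγV, ← hwV j]
      exact row_mem_rowSpan _ _
    obtain ⟨c, hc⟩ := mem_rowSpan_iff.mp h2
    have h3 : (m j * g j * γ⁻¹) a u = 0 := by
      have h4 : (m j * g j * γ⁻¹) a = (w j).row ⟨a, ha⟩ ᵥ* γ⁻¹ := by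
        rw [← h1]
        exact row_mul_eq_vecMul (m j * g j) γ⁻¹ a
      rw [h4, hc, Matrix.vecMul_vecMul, ← topRows_mul, Matrix.mul_nonsing_inv _ hγ]
      change ∑ b, c b * topRows hr (1 : Matrix (Fin n) (Fin n) k) b u = 0
      refine Finset.sum_eq_zero fun b _ => ?_
      have : topRows hr (1 : Matrix (Fin n) (Fin n) k) b u = 0 := by
        refine Matrix.one_apply_ne fun h => ?_
        have h' : (b : ℕ) = u := congrArg Fin.val h
        omega
      rw [this, mul_zero]
    simp [p, h3]
  refine ⟨(fun a u => γ a u, fun j a u => m j a u, fun j a u => p j a u), ?_, hγV⟩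
  funext j
  have hof : Matrix.of (fun a u => γ a u) = γ := rfl
  simp only [incidenceFlags, hmask, hpmask, hof]
  congr 1
  have hdet : (m j).det ≠ 0 := (hm j).ne_zero
  simp only [p]
  rw [Matrix.smul_mul, Matrix.mul_assoc (m j * g j), Matrix.nonsing_inv_mul _ hγ, Matrix.mul_one,
    Matrix.mul_smul, ← Matrix.mul_assoc, Matrix.adjugate_mul, Matrix.smul_mul, Matrix.one_mul,
    smul_smul, inv_mul_cancel₀ hdet, one_smul]

/-- For generic flags, points with a generic relative position of the induced flags are dense in
an intersection of Schubert varieties. -/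
theorem exists_dense_strict_echelon [IsAlgClosed k] {s n r : ℕ} (hs : 0 < s) (hr : r ≤ n)
    {I : Fin s → Fin r → Fin n} (hI : ∀ j, StrictMono (I j))
    {h : (Fin s → Fin r → Fin r → k) → k} (hh : h ∈ polyFun k _) (h0 : ∃ q, h q ≠ 0) :
    ∃ f ∈ polyFun k (Fin s → Fin n → Fin n → k), (∃ y, f y ≠ 0) ∧
      ∀ g : Fin s → Matrix (Fin n) (Fin n) k, f (fun j => (g j).row) ≠ 0 →
        (∀ j, IsUnit (g j).det) → ∀ V, (∀ j, varMem (I j) (spanFlag k (g j).row) V) →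
        ∀ U, IsOpen[grTop k r] U → V ∈ U →
        ∃ (A : Matrix (Fin r) (Fin n) k) (q : Fin s → Matrix (Fin r) (Fin r) k),
          rowSpan A ∈ U ∧ h (fun j => (q j).row) ≠ 0 ∧ (∀ j, IsUnit (q j).det) ∧
          ∀ j, IsEchelon (I j) (q j * A * (g j)⁻¹) ∧ ∀ a, (q j * A * (g j)⁻¹) a (I j a) ≠ 0 := by
  obtain ⟨F, hF, hF0, hFx⟩ := exists_generic_incidence hr hI hh h0
  obtain ⟨f, hf, hf0, hfib⟩ := exists_ne_zero_of_polyFun_fibre (incidenceFlags (k := k) hr I)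
    (incidenceFlags_mem hr I) hF hF0
  refine ⟨f, hf, hf0, fun g hfg hg V hV U hU hVU => ?_⟩
  obtain ⟨x, hxg, hxV⟩ := exists_incidenceFlags_eq hs hr hI hg hV
  have hcont : Continuous[mZariski k (IncidenceSpace k s n), grTop k r]
      (fun x : IncidenceSpace k s n => rowSpan (topRows hr (Matrix.of x.1))) := by
    let _ := mZariski k (IncidenceSpace k s n)
    let _ := mZariski k (Fin r → Fin n → k)
    let _ := grTop k (M := Fin n → k) r
    refine (continuous_rowSpan r n).comp (g := fun A => rowSpan (Matrix.of A))
      (f := fun x : IncidenceSpace k s n => fun a : Fin r => x.1 (Fin.castLE hr a)) ?_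
    exact continuous_mZariski_of_dual_comp_mem fun l => dual_comp_mem_pi (fun a =>
      dual_comp_mem_pi fun b => dual_comp_mem_self (fst_entry_mem _ _)) l
  let _ := mZariski k (IncidenceSpace k s n)
  let _ := grTop k (M := Fin n → k) r
  obtain ⟨w, hw, hwx, hwU⟩ := isOpen_mZariski_iff.mp (hU.preimage hcont) x
    (show rowSpan _ ∈ U from hxV.symm ▸ hVU)
  obtain ⟨x', hx', hwx', hFx'⟩ := hfib x (hxg ▸ hfg) w hw hwx
  obtain ⟨e1, e2, e3, e4⟩ := hFx x' hFx'
  refine ⟨_, fun j => topLeft hr (blockMask r (x'.2.2 j)), hwU x' hwx', e1,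
    fun j => (e2 j).isUnit, fun j => ?_⟩
  have key := topRows_mul_inv_of_incidenceFlags hr (hx'.trans hxg) j (hg j)
  have hech := isEchelon_topRows_echelonMask hr (I j) (x'.2.1 j)
  rw [← key] at hech
  refine ⟨fun a u hu => ?_, fun a ha => ?_⟩
  · have := hech a u hu
    rw [Matrix.smul_apply, smul_eq_mul] at this
    exact (mul_eq_zero.mp this).resolve_left (e3 j)
  · refine e4 j a ?_
    have := congrFun (congrFun key a) (I j a)
    rw [Matrix.smul_apply, ha, smul_zero] at this
    exact this.symm

end
end

section
open Topology
open Matrix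

section chart
variable {k : Type} [Field k] {d r : ℕ}

open Classical in
/-- The matrix whose columns indexed by `J` form the identity matrix and whose other entries
are given by `ψ`. -/
def chartMat (J : Fin d → Fin r) (ψ : Fin d × {u // u ∉ Set.range J} → k) :
    Matrix (Fin d) (Fin r) k :=
  Matrix.of fun a u => if h : u ∈ Set.range J then (if J a = u then 1 else 0) else ψ (a, ⟨u, h⟩)

/-- The entries of a matrix outside of the columns indexed by `J`, after normalizing these
columns to the identity matrix. -/
def chartCoord (J : Fin d → Fin r) (A : Matrix (Fin d) (Fin r) k) :
    Fin d × {u // u ∉ Set.range J} → k :=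
  fun x => ((A.submatrix id J)⁻¹ * A) x.1 x.2

theorem chartMat_apply_of_notMem (J : Fin d → Fin r) (ψ : Fin d × {u // u ∉ Set.range J} → k)
    (a : Fin d) (u : {u // u ∉ Set.range J}) : chartMat J ψ a u = ψ (a, u) := by
  rw [chartMat, Matrix.of_apply, dif_neg u.2]

theorem chartMat_submatrix {J : Fin d → Fin r} (hJ : Function.Injective J)
    (ψ : Fin d × {u // u ∉ Set.range J} → k) : (chartMat J ψ).submatrix id J = 1 := by
  ext a b
  simp [chartMat, Matrix.one_apply, hJ.eq_iff]

theorem eq_chartMat {J : Fin d → Fin r} (hJ : Function.Injective J) {A : Matrix (Fin d) (Fin r) k}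
    (hA : A.submatrix id J = 1) : A = chartMat J fun x => A x.1 x.2 := by
  ext a u
  by_cases h : u ∈ Set.range J
  · obtain ⟨b, rfl⟩ := h
    have h := hA.trans (chartMat_submatrix hJ (k := k) fun x => A x.1 x.2.1).symm
    exact congrFun (congrFun h a) b
  · exact (chartMat_apply_of_notMem J (fun x => A x.1 x.2) a ⟨u, h⟩).symm

theorem mul_submatrix_id {l m n o : Type} [Fintype m] (A : Matrix l m k) (B : Matrix m n k)
    (J : o → n) : (A * B).submatrix id J = A * B.submatrix id J := rfl

theorem chartMat_chartCoord {J : Fin d → Fin r} (hJ : Function.Injective J)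
    {A : Matrix (Fin d) (Fin r) k} (hA : IsUnit (A.submatrix id J).det) :
    (A.submatrix id J)⁻¹ * A = chartMat J (chartCoord J A) :=
  eq_chartMat hJ (by rw [mul_submatrix_id, Matrix.nonsing_inv_mul _ hA])

theorem linearIndependent_of_submatrix {J : Fin d → Fin r} {A : Matrix (Fin d) (Fin r) k}
    (hA : IsUnit (A.submatrix id J).det) : LinearIndependent k A.row := by
  rw [← Matrix.vecMul_injective_iff]
  intro x y h
  have h' : x ᵥ* A.submatrix id J = y ᵥ* A.submatrix id J := by
    ext b
    exact congrFun h (J b)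
  exact Matrix.vecMul_injective_of_isUnit ((Matrix.isUnit_iff_isUnit_det _).mpr hA) h'

theorem linearIndependent_chartMat {J : Fin d → Fin r} (hJ : Function.Injective J)
    (ψ : Fin d × {u // u ∉ Set.range J} → k) : LinearIndependent k (chartMat J ψ).row :=
  linearIndependent_of_submatrix (J := J) (by rw [chartMat_submatrix hJ]; simp)

theorem rowSpan_chartMat_chartCoord {J : Fin d → Fin r} (hJ : Function.Injective J)
    {A : Matrix (Fin d) (Fin r) k} (hA : IsUnit (A.submatrix id J).det) :
    rowSpan (chartMat J (chartCoord J A)) = rowSpan A := by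
  rw [← chartMat_chartCoord hJ hA]
  exact rowSpan_mul (by rw [Matrix.isUnit_nonsing_inv_det_iff]; exact hA) A

theorem chartCoord_mul_chartMat {J : Fin d → Fin r} (hJ : Function.Injective J)
    {c : Matrix (Fin d) (Fin d) k} (hc : IsUnit c.det)
    (ψ : Fin d × {u // u ∉ Set.range J} → k) : chartCoord J (c * chartMat J ψ) = ψ := by
  ext ⟨a, u⟩
  rw [chartCoord, mul_submatrix_id, chartMat_submatrix hJ, Matrix.mul_one, ← Matrix.mul_assoc,
    Matrix.nonsing_inv_mul _ hc, Matrix.one_mul]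
  exact chartMat_apply_of_notMem J ψ a u

theorem chartMat_mul (J : Fin d → Fin r)
    (ψ : Fin d × {u // u ∉ Set.range J} → k) {n : ℕ} (g : Matrix (Fin r) (Fin n) k) (a : Fin d)
    (c : Fin n) : (chartMat J ψ * g) a c =
      g (J a) c + ∑ u : {u // u ∉ Set.range J}, ψ (a, u) * g u c := by
  classical
  rw [Matrix.mul_apply, ← Fintype.sum_subtype_add_sum_subtype (fun u => u ∈ Set.range J)]
  congr 1
  · rw [Finset.sum_eq_single ⟨J a, a, rfl⟩]
    · simp [chartMat]
    · rintro ⟨u, hu⟩ - hne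
      rw [chartMat, Matrix.of_apply, dif_pos hu, if_neg, zero_mul]
      exact fun h => hne (Subtype.ext h.symm)
    · simp
  · refine Finset.sum_congr ?_ fun u _ => ?_
    · ext; simp
    · rw [chartMat_apply_of_notMem]

theorem chartMat_mem {X : Type} {A : Subalgebra k (X → k)} (J : Fin d → Fin r)
    {ψ : X → Fin d × {u // u ∉ Set.range J} → k} (hψ : ∀ c, (fun x => ψ x c) ∈ A)
    (a : Fin d) (u : Fin r) : (fun x => chartMat J (ψ x) a u) ∈ A := by
  simp only [chartMat, Matrix.of_apply]
  split_ifs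
  · exact A.one_mem
  · exact A.zero_mem
  · exact hψ _

theorem coord_mem_polyFun {β : Type} (b : β) : (fun x : β → k => x b) ∈ polyFun k (β → k) :=
  linear_mem_polyFun (LinearMap.proj (R := k) (φ := fun _ : β => k) b)

theorem entry_mem_polyFun {α β : Type} (a : α) (b : β) :
    (fun x : α → β → k => x a b) ∈ polyFun k (α → β → k) :=
  linear_mem_polyFun (LinearMap.proj (R := k) (φ := fun _ : β => k) b ∘ₗ
    LinearMap.proj (φ := fun _ : α => β → k) a)

theorem isOpenEmbedding_rowSpan_chartMat {J : Fin d → Fin r} (hJ : Function.Injective J) :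
    @IsOpenEmbedding _ _ (mZariski k (Fin d × {u // u ∉ Set.range J} → k)) (grTop k d)
      (fun ψ => rowSpan (chartMat J ψ)) := by
  let _ := mZariski k (Fin d × {u // u ∉ Set.range J} → k)
  let _ := grTop k (M := Fin r → k) d
  let _ := mZariski k (Fin d → Fin r → k)
  refine .of_continuous_injective_isOpenMap ?_ ?_ ?_
  · refine (continuous_rowSpan (k := k) d r).comp
      (f := fun ψ => fun a u => chartMat J ψ a u) ?_
    refine continuous_mZariski_of_dual_comp_mem ?_
    exact dual_comp_mem_pi fun a => dual_comp_mem_pi fun u => dual_comp_mem_self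
      (chartMat_mem J coord_mem_polyFun a u)
  · intro ψ ψ' h
    obtain ⟨c, hc, h'⟩ := exists_mul_eq_of_rowSpan_eq (linearIndependent_chartMat hJ ψ') h
    have := chartCoord_mul_chartMat hJ hc ψ
    rw [← h'] at this
    have h2 := chartCoord_mul_chartMat hJ (c := 1) (by simp) ψ'
    rw [Matrix.one_mul] at h2
    rw [← this, h2]
  · intro V hV
    let Δ : polyFun k (Fin d → Fin r → k) := ⟨fun A => ((Matrix.of A).submatrix id J).det,
      det_mem_of_entries fun a b => entry_mem_polyFun a (J b)⟩
    have hopen := isOpen_preimage_of_ratFun (Δ := Δ)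
      (F := fun A : Fin d → Fin r → k => chartCoord J (Matrix.of A)) (U := V) ?_ hV
    · convert isOpen_rowSpan_image hopen ?_ using 1
      · ext S
        constructor
        · rintro ⟨ψ, hψ, rfl⟩
          refine ⟨fun a u => chartMat J ψ a u, ⟨?_, ?_⟩, rfl⟩
          · change ((chartMat J ψ).submatrix id J).det ≠ 0
            rw [chartMat_submatrix hJ]
            simp
          · have h2 := chartCoord_mul_chartMat hJ (c := 1) (by simp) ψ
            rw [Matrix.one_mul] at h2
            change chartCoord J (chartMat J ψ) ∈ V
            rwa [h2]
        · rintro ⟨A, ⟨hA, hV⟩, rfl⟩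
          exact ⟨_, hV, rowSpan_chartMat_chartCoord hJ (isUnit_iff_ne_zero.mpr hA)⟩
      · exact fun A hA => linearIndependent_of_submatrix (J := J) (A := Matrix.of A)
          (isUnit_iff_ne_zero.mpr hA.1)
    · refine dual_comp_mem_pi fun x => dual_comp_mem_self ?_
      have hle : ∀ a u, (fun A : Fin d → Fin r → k => A a u) ∈ ratFun _ Δ := fun a u =>
        le_ratFun _ _ (entry_mem_polyFun a u)
      refine mul_mem_of_entries (F := fun A : Fin d → Fin r → k => ((Matrix.of A).submatrix id J)⁻¹)
        (G := fun A : Fin d → Fin r → k => Matrix.of A) (fun a b => ?_) hle x.1 x.2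
      exact inv_mem_of_entries (F := fun A : Fin d → Fin r → k => (Matrix.of A).submatrix id J)
        (fun a b => hle a (J b))
        (inv_mem_ratFun (E := fun _ => 1) (Subalgebra.one_mem _) fun A => (mul_one _).symm) a b

theorem exists_isUnit_submatrix_det {A : Matrix (Fin d) (Fin r) k}
    (hA : LinearIndependent k A.row) :
    ∃ J : Fin d → Fin r, Function.Injective J ∧ IsUnit (A.submatrix id J).det := by
  obtain ⟨κ, a, ha, hspan, hli⟩ := exists_linearIndependent' k A.col
  have hrank : finrank k (span k (Set.range A.col)) = d := by
    rw [← Matrix.rank_eq_finrank_span_cols, hA.rank_matrix, Fintype.card_fin]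
  have : Finite κ := Finite.of_injective a ha
  have := Fintype.ofFinite κ
  have hcard : Fintype.card κ = d := by
    rw [← hrank, ← hspan, finrank_span_eq_card hli]
  let e : Fin d ≃ κ := (finCongr hcard.symm).trans (Fintype.equivFin κ).symm
  refine ⟨a ∘ e, ha.comp e.injective, ?_⟩
  rw [← Matrix.det_transpose, ← Matrix.isUnit_iff_isUnit_det,
    ← Matrix.linearIndependent_rows_iff_isUnit]
  exact hli.comp e e.injective

end chart
end

section
open Topology
open Matrix

section fibre
variable {k : Type} [Field k] {s d r : ℕ} (K : Fin s → Fin d → Fin r) (J : Fin d → Fin r)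

/-- The coordinates of the space parametrizing tuples of flags together with a point, in the
chart indexed by `J`, of the corresponding intersection of Schubert varieties. -/
abbrev FibreIndex : Type :=
  (Fin d × {u // u ∉ Set.range J}) ⊕ (Σ j : Fin s,
    ({x : Fin d × Fin r // x.2 ∉ Set.range (K j) ∧ x.2 < K j x.1} ⊕
      ((Fin d × Fin d) ⊕ ({u // u ∉ Set.range (K j)} × Fin r))))

variable {K J}

/-- The point of the Grassmannian chart. -/
def fibreChart (z : FibreIndex K J → k) : Fin d × {u // u ∉ Set.range J} → k :=
  fun c => z (.inl c)

/-- The free entries of the reduced echelon matrix. -/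
def fibreEchelon (z : FibreIndex K J → k) (j : Fin s) :
    Fin d × {u // u ∉ Set.range (K j)} → k :=
  fun x => if h : x.2.1 < K j x.1 then z (.inr ⟨j, .inl ⟨(x.1, x.2), x.2.2, h⟩⟩) else 0

/-- The change of basis matrix. -/
def fibreBase (z : FibreIndex K J → k) (j : Fin s) : Matrix (Fin d) (Fin d) k :=
  Matrix.of fun a b => z (.inr ⟨j, .inr (.inl (a, b))⟩)

/-- The free rows of the flag. -/
def fibreRows (z : FibreIndex K J → k) (j : Fin s) :
    Matrix {u // u ∉ Set.range (K j)} (Fin r) k :=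
  Matrix.of fun v c => z (.inr ⟨j, .inr (.inr (v, c))⟩)

open Classical in
/-- The tuple of flags. -/
def fibreFlags (z : FibreIndex K J → k) (x : Fin s × Fin r × Fin r) : k :=
  if h : x.2.1 ∈ Set.range (K x.1) then
    (fibreBase z x.1 * chartMat J (fibreChart z)) h.choose x.2.2 -
      ∑ u, fibreEchelon z x.1 (h.choose, u) * fibreRows z x.1 u x.2.2
  else fibreRows z x.1 ⟨x.2.1, h⟩ x.2.2

theorem fibreFlags_eq_iff (hK : ∀ j, Function.Injective (K j)) {z : FibreIndex K J → k}
    {g : Fin s → Matrix (Fin r) (Fin r) k} :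
    (∀ x, fibreFlags z x = g x.1 x.2.1 x.2.2) ↔
      ∀ j, (∀ v c, fibreRows z j v c = g j v c) ∧
        chartMat (K j) (fibreEchelon z j) * g j = fibreBase z j * chartMat J (fibreChart z) := by
  have key : ∀ j a c, fibreFlags z (j, K j a, c) =
      (fibreBase z j * chartMat J (fibreChart z)) a c -
      ∑ u, fibreEchelon z j (a, u) * fibreRows z j u c := by
    intro j a c
    have h : K j a ∈ Set.range (K j) := ⟨a, rfl⟩
    rw [fibreFlags, dif_pos h, hK j h.choose_spec]
  have key2 : ∀ j (v : {u // u ∉ Set.range (K j)}) c, fibreFlags z (j, v.1, c) =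
      fibreRows z j v c := by
    intro j v c
    rw [fibreFlags, dif_neg v.2]
  constructor
  · intro h j
    have h1 : ∀ v c, fibreRows z j v c = g j v c := fun v c => by
      rw [← key2, h]
    refine ⟨h1, ?_⟩
    ext a c
    rw [chartMat_mul, ← h (j, K j a, c), key]
    simp only [h1]
    ring
  · rintro h ⟨j, v, c⟩
    by_cases hv : v ∈ Set.range (K j)
    · obtain ⟨a, rfl⟩ := hv
      rw [key, ← (h j).2, chartMat_mul]
      simp only [(h j).1]
      ring
    · rw [key2 j ⟨v, hv⟩, (h j).1]

/-- The square block of the normalized matrix relevant for the `j`-th flag. -/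
def chartBlock (K : Fin s → Fin d → Fin r) (J : Fin d → Fin r)
    (g : Fin s → Matrix (Fin r) (Fin r) k) (ψ : Fin d × {u // u ∉ Set.range J} → k)
    (j : Fin s) : Matrix (Fin d) (Fin d) k :=
  (chartMat J ψ * (g j)⁻¹).submatrix id (K j)

/-- The point of the fibre determined by a point of the chart. -/
def fibreSection (K : Fin s → Fin d → Fin r) (J : Fin d → Fin r)
    (g : Fin s → Matrix (Fin r) (Fin r) k) (ψ : Fin d × {u // u ∉ Set.range J} → k) :
    FibreIndex K J → k
  | .inl c => ψ c
  | .inr ⟨j, .inl x⟩ => ((chartBlock K J g ψ j)⁻¹ * (chartMat J ψ * (g j)⁻¹)) x.1.1 x.1.2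
  | .inr ⟨j, .inr (.inl x)⟩ => (chartBlock K J g ψ j)⁻¹ x.1 x.2
  | .inr ⟨j, .inr (.inr x)⟩ => g j x.1 x.2

theorem isEchelon_chartMat_fibreEchelon (z : FibreIndex K J → k) (j : Fin s) : IsEchelon (K j) (chartMat (K j) (fibreEchelon z j)) := by
  intro a u hu
  by_cases h : u ∈ Set.range (K j)
  · rw [chartMat, Matrix.of_apply, dif_pos h, if_neg hu.ne]
  · rw [chartMat_apply_of_notMem _ _ a ⟨u, h⟩, fibreEchelon, dif_neg hu.not_gt]

theorem fibreFlags_eq_iff_eq_fibreSection (hK : ∀ j, StrictMono (K j)) {z : FibreIndex K J → k}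
    {g : Fin s → Matrix (Fin r) (Fin r) k} (hg : ∀ j, IsUnit (g j).det) :
    (∀ x, fibreFlags z x = g x.1 x.2.1 x.2.2) ↔
      (∀ j, IsUnit (chartBlock K J g (fibreChart z) j).det) ∧
      (∀ j, IsEchelon (K j) ((chartBlock K J g (fibreChart z) j)⁻¹ *
        (chartMat J (fibreChart z) * (g j)⁻¹))) ∧
      z = fibreSection K J g (fibreChart z) := by
  rw [fibreFlags_eq_iff fun j => (hK j).injective]
  constructor
  · intro h
    have hm : ∀ j, chartMat (K j) (fibreEchelon z j) =
        fibreBase z j * (chartMat J (fibreChart z) * (g j)⁻¹) := fun j => by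
      rw [← Matrix.mul_assoc, ← (h j).2, Matrix.mul_assoc, Matrix.mul_nonsing_inv _ (hg j),
        Matrix.mul_one]
    have h1 : ∀ j, fibreBase z j * chartBlock K J g (fibreChart z) j = 1 := fun j => by
      rw [chartBlock, ← mul_submatrix_id, ← hm, chartMat_submatrix (hK j).injective]
    have h2 : ∀ j, (chartBlock K J g (fibreChart z) j)⁻¹ = fibreBase z j := fun j =>
      Matrix.inv_eq_left_inv (h1 j)
    refine ⟨fun j => Matrix.isUnit_det_of_left_inverse (h1 j), fun j => ?_, ?_⟩
    · rw [h2, ← hm]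
      exact isEchelon_chartMat_fibreEchelon z j
    · ext (c | ⟨j, ⟨⟨a, u⟩, hu, hua⟩ | ⟨a, b⟩ | ⟨v, c⟩⟩)
      · rfl
      · simp only [fibreSection]
        rw [h2, ← hm, chartMat_apply_of_notMem _ _ a ⟨u, hu⟩, fibreEchelon, dif_pos hua]
      · simp only [fibreSection]
        rw [h2]
        rfl
      · exact (h j).1 v c
  · rintro ⟨h1, h2, h3⟩ j
    set ψ := fibreChart z with hψ
    have hB : fibreBase z j = (chartBlock K J g ψ j)⁻¹ := by
      ext a b
      rw [h3]
      rfl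
    have hx : chartMat (K j) (fibreEchelon z j) =
        (chartBlock K J g ψ j)⁻¹ * (chartMat J ψ * (g j)⁻¹) := by
      rw [eq_chartMat (hK j).injective
        (A := (chartBlock K J g ψ j)⁻¹ * (chartMat J ψ * (g j)⁻¹)) (by
          rw [mul_submatrix_id]
          exact Matrix.nonsing_inv_mul _ (h1 j))]
      congr 1
      ext ⟨a, u⟩
      rw [fibreEchelon]
      split_ifs with h
      · rw [h3]
        rfl
      · refine (h2 j a u ?_).symm
        refine lt_of_le_of_ne (not_lt.mp h) fun h' => u.2 ⟨a, h'⟩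
    refine ⟨fun v c => ?_, ?_⟩
    · rw [h3]
      rfl
    · rw [hx, hB, Matrix.mul_assoc, Matrix.mul_assoc, Matrix.nonsing_inv_mul _ (hg j),
        Matrix.mul_one]

theorem isUnit_det_of_isEchelon_strict {n : ℕ} {i : Fin r → Fin n} (hi : StrictMono i)
    {x : Matrix (Fin r) (Fin n) k} (hx : IsEchelon i x) (hne : ∀ a, x a (i a) ≠ 0) :
    IsUnit (x.submatrix id i).det :=
  det_of_lowerTriangular_ne_zero (fun a b hab => hx a (i b) (hi hab)) hne

theorem varMem_rowSpan_iff {n : ℕ} {i : Fin r → Fin n} (hi : StrictMono i)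
    {g : Matrix (Fin n) (Fin n) k} (hg : IsUnit g.det) {A : Matrix (Fin r) (Fin n) k}
    (hA : LinearIndependent k A.row) (hB : IsUnit ((A * g⁻¹).submatrix id i).det) :
    varMem i (spanFlag k g.row) (rowSpan A) ↔
      IsEchelon i (((A * g⁻¹).submatrix id i)⁻¹ * (A * g⁻¹)) := by
  rw [varMem_spanFlag_iff hg hi]
  constructor
  · rintro ⟨w, hw, hwA, hech⟩
    obtain ⟨c, hc, rfl⟩ := exists_mul_eq_of_rowSpan_eq hw hwA.symm
    rw [Matrix.mul_assoc] at hech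
    set x := A * g⁻¹
    set B := x.submatrix id i with hBdef
    have ht : IsUnit (c * B).det := by rw [Matrix.det_mul]; exact hc.mul hB
    have htri : ∀ a b, a < b → (c * B) a b = 0 := fun a b hab => hech a (i b) (hi hab)
    have htri' := inv_lowerTriangular htri ht
    have : B⁻¹ * x = (c * B)⁻¹ * (c * x) := by
      rw [Matrix.mul_inv_rev, Matrix.mul_assoc, ← Matrix.mul_assoc c⁻¹,
        Matrix.nonsing_inv_mul _ hc, Matrix.one_mul]
    rw [this]
    intro a u hu
    rw [Matrix.mul_apply]
    refine Finset.sum_eq_zero fun b _ => ?_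
    rcases lt_or_ge a b with hab | hab
    · rw [htri' a b hab, zero_mul]
    · rw [hech b u ((hi.monotone hab).trans_lt hu), mul_zero]
  · intro h
    have hB' : IsUnit (((A * g⁻¹).submatrix id i)⁻¹).det := by
      rwa [Matrix.isUnit_nonsing_inv_det_iff]
    refine ⟨((A * g⁻¹).submatrix id i)⁻¹ * A, ?_, rowSpan_mul hB' A, by rwa [Matrix.mul_assoc]⟩
    refine linearIndependent_of_finrank_rowSpan ?_
    rw [rowSpan_mul hB', finrank_rowSpan hA]

theorem exists_fibrePoly (x : Fin s × Fin r × Fin r) :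
    ∃ p : MvPolynomial (FibreIndex K J) k, ∀ z, fibreFlags z x = MvPolynomial.eval z p := by
  classical
  have := Fintype.ofFinite (FibreIndex K J)
  refine mem_polyFun_pi.mp ?_
  obtain ⟨j, v, c⟩ := x
  have hR : ∀ (v : {u // u ∉ Set.range (K j)}) c,
      (fun z : FibreIndex K J → k => fibreRows z j v c) ∈ polyFun k (FibreIndex K J → k) :=
    fun v c => coord_mem_polyFun (β := FibreIndex K J) (.inr ⟨j, .inr (.inr (v, c))⟩)
  simp only [fibreFlags]
  split_ifs with h
  · refine Subalgebra.sub_mem _ (mul_mem_of_entries (fun a b => ?_) (fun a b => ?_) _ _) ?_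
    · exact coord_mem_polyFun (β := FibreIndex K J) (.inr ⟨j, .inr (.inl (a, b))⟩)
    · exact chartMat_mem J (fun c => coord_mem_polyFun (β := FibreIndex K J) (.inl c)) a b
    · have := Subalgebra.sum_mem (polyFun k (FibreIndex K J → k))
        (t := Finset.univ) (f := fun (u : {u // u ∉ Set.range (K j)}) z =>
          fibreEchelon z j (h.choose, u) * fibreRows z j u c) fun u _ => ?_
      · convert this using 1
        ext z
        simp
      · refine Subalgebra.mul_mem _ ?_ (hR u c)
        simp only [fibreEchelon]
        split_ifs
        · exact coord_mem_polyFun _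
        · exact Subalgebra.zero_mem _
  · exact hR _ _

/-- The polynomials defining `fibreFlags`. -/
def fibrePoly (k : Type) [Field k] (K : Fin s → Fin d → Fin r) (J : Fin d → Fin r)
    (x : Fin s × Fin r × Fin r) : MvPolynomial (FibreIndex K J) k :=
  (exists_fibrePoly x).choose

theorem eval_fibrePoly (x : Fin s × Fin r × Fin r) (z : FibreIndex K J → k) :
    MvPolynomial.eval z (fibrePoly k K J x) = fibreFlags z x :=
  ((exists_fibrePoly x).choose_spec z).symm

/-- The ideal of the fibre over a tuple of flags. -/
def fibreIdeal (K : Fin s → Fin d → Fin r) (J : Fin d → Fin r)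
    (y : Fin s × Fin r × Fin r → k) : Ideal (MvPolynomial (FibreIndex K J) k) :=
  Ideal.span (Set.range fun x => fibrePoly k K J x - MvPolynomial.C (y x))

theorem mem_zeroLocus_fibreIdeal {y : Fin s × Fin r × Fin r → k} {z : FibreIndex K J → k} :
    z ∈ MvPolynomial.zeroLocus k (fibreIdeal K J y) ↔ ∀ x, fibreFlags z x = y x := by
  simp only [fibreIdeal, MvPolynomial.zeroLocus_span, Set.mem_ofPred_eq, Set.forall_mem_range,
    map_sub, sub_eq_zero, MvPolynomial.aeval_eq_eval, eval_fibrePoly,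
    MvPolynomial.eval_C]

end fibre

section card
variable {s d r : ℕ}

theorem card_notMem_range {J : Fin d → Fin r} (hJ : Function.Injective J)
    [Fintype {u // u ∉ Set.range J}] : Fintype.card {u // u ∉ Set.range J} = r - d := by
  classical
  have h : Fintype.card (Set.range J) = d :=
    (Set.card_range_of_injective hJ).trans (Fintype.card_fin d)
  rw [Fintype.card_subtype_compl, Fintype.card_fin]
  exact congrArg _ h

theorem apply_le_of_strictMono {i : Fin d → Fin r} (hi : StrictMono i) (a : Fin d) :
    (i a : ℕ) ≤ r - d + a := by
  have h : StrictMono fun b : Fin d => (i b.rev).rev := fun a b hab =>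
    Fin.rev_lt_rev.mpr (hi (Fin.rev_lt_rev.mpr hab))
  have := le_apply_of_strictMono h a.rev
  simp only [Fin.rev_rev, Fin.val_rev] at this
  omega

theorem card_echelon_row {i : Fin d → Fin r} (hi : StrictMono i) (a : Fin d)
    [Fintype {u : Fin r // u ∉ Set.range i ∧ u < i a}] :
    Fintype.card {u : Fin r // u ∉ Set.range i ∧ u < i a} = i a - a := by
  classical
  rw [Fintype.card_subtype]
  have : (Finset.univ.filter fun u : Fin r => u ∉ Set.range i ∧ u < i a) =
      Finset.Iio (i a) \ (Finset.Iio a).image i := by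
    ext u
    simp only [Finset.mem_filter, Finset.mem_univ, true_and, Finset.mem_sdiff, Finset.mem_Iio,
      Finset.mem_image, Set.mem_range, not_exists, not_and]
    constructor
    · exact fun h => ⟨h.2, fun b _ => h.1 b⟩
    · refine fun h => ⟨fun b hb => h.2 b ?_ hb, h.1⟩
      rw [← hb] at h
      exact hi.lt_iff_lt.mp h.1
  rw [this, Finset.card_sdiff_of_subset, Finset.card_image_of_injective _ hi.injective,
    Fin.card_Iio, Fin.card_Iio]
  intro u
  simp only [Finset.mem_image, Finset.mem_Iio]
  rintro ⟨b, hb, rfl⟩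
  exact hi hb

theorem card_echelon {i : Fin d → Fin r} (hi : StrictMono i)
    [Fintype {x : Fin d × Fin r // x.2 ∉ Set.range i ∧ x.2 < i x.1}] :
    Fintype.card {x : Fin d × Fin r // x.2 ∉ Set.range i ∧ x.2 < i x.1} + codimN r d i =
      d * (r - d) := by
  classical
  let e : {x : Fin d × Fin r // x.2 ∉ Set.range i ∧ x.2 < i x.1} ≃
      Σ a : Fin d, {u : Fin r // u ∉ Set.range i ∧ u < i a} :=
    { toFun := fun x => ⟨x.1.1, x.1.2, x.2⟩
      invFun := fun x => ⟨(x.1, x.2.1), x.2.2⟩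
      left_inv := fun _ => rfl
      right_inv := fun _ => rfl }
  rw [Fintype.card_congr e, Fintype.card_sigma, codimN, ← Finset.sum_add_distrib]
  simp only [card_echelon_row hi]
  rw [Finset.sum_congr rfl (g := fun _ => r - d)]
  · simp
  · intro a _
    have h1 := apply_le_of_strictMono hi a
    have h2 := le_apply_of_strictMono hi a
    omega

theorem card_fibreIndex {K : Fin s → Fin d → Fin r} {J : Fin d → Fin r}
    (hK : ∀ j, StrictMono (K j)) (hJ : Function.Injective J) (hd : d ≤ r)
    [Fintype (FibreIndex K J)] :
    Fintype.card (FibreIndex K J) + ∑ j, codimN r d (K j) =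
      d * (r - d) + Fintype.card (Fin s × Fin r × Fin r) := by
  classical
  have h1 : Fintype.card (FibreIndex K J) = d * (r - d) + ∑ j : Fin s,
      (Fintype.card {x : Fin d × Fin r // x.2 ∉ Set.range (K j) ∧ x.2 < K j x.1} +
        (d * d + (r - d) * r)) := by
    rw [← Nat.card_eq_fintype_card, FibreIndex, Nat.card_sum, Nat.card_eq_fintype_card,
      Nat.card_eq_fintype_card, Fintype.card_prod,
      card_notMem_range hJ, Fintype.card_fin, Fintype.card_sigma]
    congr 1
    refine Finset.sum_congr rfl fun j _ => ?_
    rw [Fintype.card_sum, Fintype.card_sum, Fintype.card_prod, Fintype.card_prod,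
      card_notMem_range (hK j).injective, Fintype.card_fin, Fintype.card_fin]
  rw [h1, add_assoc, ← Finset.sum_add_distrib]
  congr 1
  rw [Finset.sum_congr rfl (g := fun _ => r * r)]
  · simp
  · intro j _
    have h2 := card_echelon (hK j)
    obtain ⟨e, rfl⟩ := Nat.exists_eq_add_of_le hd
    rw [Nat.add_sub_cancel_left] at h2 ⊢
    nlinarith

end card
end

section
open Topology
open Matrix

section assembly
variable {k : Type} [Field k] {s d r : ℕ} {K : Fin s → Fin d → Fin r} {J : Fin d → Fin r}
  {g : Fin s → Matrix (Fin r) (Fin r) k}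

theorem chartMat_mul_inv_mem (j : Fin s) (a : Fin d) (u : Fin r) :
    (fun ψ => (chartMat J ψ * (g j)⁻¹ : Matrix (Fin d) (Fin r) k) a u) ∈
      polyFun k (Fin d × {u // u ∉ Set.range J} → k) :=
  mul_mem_of_entries (F := fun ψ : Fin d × {u // u ∉ Set.range J} → k => chartMat J ψ)
    (G := fun _ => (g j)⁻¹) (chartMat_mem J coord_mem_polyFun) (fun _ _ => const_mem_polyFun _) a u

/-- The function whose nonvanishing locus is the domain of `fibreSection`. -/
def chartDenom (K : Fin s → Fin d → Fin r) (J : Fin d → Fin r)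
    (g : Fin s → Matrix (Fin r) (Fin r) k) :
    polyFun k (Fin d × {u // u ∉ Set.range J} → k) :=
  ⟨fun ψ => ∏ j, (chartBlock K J g ψ j).det, by
    have : (fun ψ => ∏ j, (chartBlock K J g ψ j).det) =
        ∏ j, fun ψ => (chartBlock K J g ψ j).det := by
      ext ψ
      simp
    rw [this]
    exact Subalgebra.prod_mem _ fun j _ => det_mem_of_entries fun a b =>
      chartMat_mul_inv_mem j a (K j b)⟩

theorem chartDenom_ne_zero_iff {ψ : Fin d × {u // u ∉ Set.range J} → k} :
    (chartDenom K J g).1 ψ ≠ 0 ↔ ∀ j, IsUnit (chartBlock K J g ψ j).det := by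
  simp [chartDenom, Finset.prod_ne_zero_iff]

theorem fibreSection_mem_ratFun (b : FibreIndex K J) :
    (fun ψ => fibreSection K J g ψ b) ∈ ratFun _ (chartDenom K J g) := by
  classical
  have hx := chartMat_mul_inv_mem (J := J) (g := g)
  have hB : ∀ j a b, (fun ψ => chartBlock K J g ψ j a b) ∈ polyFun k _ := fun j a b =>
    hx j a (K j b)
  have hinv : ∀ j a b, (fun ψ => (chartBlock K J g ψ j)⁻¹ a b) ∈
      ratFun _ (chartDenom K J g) := by
    intro j
    refine inv_mem_of_entries (fun a b => le_ratFun _ _ (hB j a b)) ?_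
    refine inv_mem_ratFun (E := ∏ i ∈ Finset.univ.erase j, fun ψ => (chartBlock K J g ψ i).det)
      (Subalgebra.prod_mem _ fun i _ => det_mem_of_entries (hB i)) fun ψ => ?_
    rw [Finset.prod_apply]
    exact (Finset.mul_prod_erase Finset.univ (fun i => (chartBlock K J g ψ i).det)
      (Finset.mem_univ j)).symm
  obtain c | ⟨j, x | x | x⟩ := b
  · exact le_ratFun _ _ (coord_mem_polyFun c)
  · exact mul_mem_of_entries (hinv j) (fun a u => le_ratFun _ _ (hx j a u)) _ _
  · exact hinv j _ _
  · exact le_ratFun _ _ (const_mem_polyFun _)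

theorem mem_zeroLocus_fibreIdeal_iff (hK : ∀ j, StrictMono (K j)) (hJ : Function.Injective J)
    (hg : ∀ j, IsUnit (g j).det) {z : FibreIndex K J → k} :
    z ∈ MvPolynomial.zeroLocus k (fibreIdeal K J fun x => g x.1 x.2.1 x.2.2) ↔
      (chartDenom K J g).1 (fibreChart z) ≠ 0 ∧
      (∀ j, varMem (K j) (spanFlag k (g j).row) (rowSpan (chartMat J (fibreChart z)))) ∧
      z = fibreSection K J g (fibreChart z) := by
  rw [mem_zeroLocus_fibreIdeal, fibreFlags_eq_iff_eq_fibreSection hK hg, chartDenom_ne_zero_iff]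
  refine and_congr_right fun h => and_congr_left fun _ => forall_congr' fun j => ?_
  exact (varMem_rowSpan_iff (hK j) (hg j) (linearIndependent_chartMat hJ _) (h j)).symm

theorem isInducing_fibreChart (hK : ∀ j, StrictMono (K j)) (hJ : Function.Injective J)
    (hg : ∀ j, IsUnit (g j).det) :
    @IsInducing _ _ (TopologicalSpace.induced Subtype.val (mZariski k (FibreIndex K J → k)))
      (mZariski k _)
      (fun z : MvPolynomial.zeroLocus k (fibreIdeal K J fun x => g x.1 x.2.1 x.2.2) =>
        fibreChart z.1) := by
  let _ := mZariski k (FibreIndex K J → k)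
  let _ := mZariski k (Fin d × {u // u ∉ Set.range J} → k)
  refine ⟨le_antisymm (Continuous.le_induced ?_) fun O hO => ?_⟩
  · refine Continuous.comp (g := fibreChart) ?_ continuous_subtype_val
    exact continuous_mZariski_of_dual_comp_mem (dual_comp_mem_pi fun c =>
      dual_comp_mem_self (coord_mem_polyFun (β := FibreIndex K J) (.inl c)))
  · obtain ⟨O, hO, rfl⟩ := hO
    refine isOpen_induced_iff.mpr ⟨_, isOpen_preimage_of_ratFun (Δ := chartDenom K J g)
      (F := fibreSection K J g) (dual_comp_mem_pi fun b => dual_comp_mem_self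
        (fibreSection_mem_ratFun b)) hO, ?_⟩
    ext ⟨z, hz⟩
    obtain ⟨h1, -, h3⟩ := (mem_zeroLocus_fibreIdeal_iff hK hJ hg).mp hz
    simp only [Set.mem_preimage, Set.mem_ofPred_eq]
    rw [← h3]
    exact and_iff_right h1

/-- The intersection of Schubert varieties associated with a tuple of bases. -/
abbrev schubertIntersection (K : Fin s → Fin d → Fin r) (g : Fin s → Matrix (Fin r) (Fin r) k) :
    Set (Submodule k (Fin r → k)) :=
  {S | ∀ j, varMem (K j) (spanFlag k (g j).row) S}

/-- The parametrization of an open subset of an intersection of Schubert varieties. -/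
def fibreToSchubert (hK : ∀ j, StrictMono (K j)) (hJ : Function.Injective J)
    (hg : ∀ j, IsUnit (g j).det)
    (z : MvPolynomial.zeroLocus k (fibreIdeal K J fun x => g x.1 x.2.1 x.2.2)) :
    schubertIntersection K g :=
  ⟨rowSpan (chartMat J (fibreChart z.1)),
    ((mem_zeroLocus_fibreIdeal_iff hK hJ hg).mp z.2).2.1⟩

theorem range_fibreToSchubert (hK : ∀ j, StrictMono (K j)) (hJ : Function.Injective J)
    (hg : ∀ j, IsUnit (g j).det) :
    Set.range (fibreToSchubert hK hJ hg) =
      Subtype.val ⁻¹' ((fun ψ => rowSpan (chartMat J ψ)) '' {ψ | (chartDenom K J g).1 ψ ≠ 0}) := by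
  ext ⟨S, hS⟩
  constructor
  · rintro ⟨⟨z, hz⟩, h⟩
    exact ⟨_, ((mem_zeroLocus_fibreIdeal_iff hK hJ hg).mp hz).1, congrArg Subtype.val h⟩
  · rintro ⟨ψ, hψ, rfl⟩
    exact ⟨⟨fibreSection K J g ψ, (mem_zeroLocus_fibreIdeal_iff hK hJ hg).mpr ⟨hψ, hS, rfl⟩⟩, rfl⟩

theorem isOpenEmbedding_fibreToSchubert (hK : ∀ j, StrictMono (K j)) (hJ : Function.Injective J)
    (hg : ∀ j, IsUnit (g j).det) :
    @IsOpenEmbedding _ _ (TopologicalSpace.induced Subtype.val (mZariski k (FibreIndex K J → k)))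
      (TopologicalSpace.induced Subtype.val (grTop k d)) (fibreToSchubert hK hJ hg) := by
  let _ := mZariski k (FibreIndex K J → k)
  let _ := mZariski k (Fin d × {u // u ∉ Set.range J} → k)
  let _ := grTop k (M := Fin r → k) d
  have hσ := isOpenEmbedding_rowSpan_chartMat (k := k) hJ
  have hπ := isInducing_fibreChart hK hJ hg
  refine ⟨⟨?_, ?_⟩, ?_⟩
  · rw [← IsInducing.of_comp_iff (g := Subtype.val) IsInducing.subtypeVal]
    exact hσ.isInducing.comp hπ
  · intro z z' h
    have h1 := hσ.injective (congrArg Subtype.val h)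
    have h2 := ((mem_zeroLocus_fibreIdeal_iff hK hJ hg).mp z.2).2.2
    have h3 := ((mem_zeroLocus_fibreIdeal_iff hK hJ hg).mp z'.2).2.2
    refine Subtype.ext ?_
    rw [h2, h3]
    exact congrArg _ h1
  · rw [range_fibreToSchubert]
    exact (hσ.isOpenMap _ (isOpen_ne_zero_of_mem_polyFun (chartDenom K J g).2)).preimage
      continuous_subtype_val

theorem chartBlock_isUnit_det {A : Matrix (Fin d) (Fin r) k}
    {q : Fin s → Matrix (Fin d) (Fin d) k} (hK : ∀ j, StrictMono (K j))
    (hJ : Function.Injective J)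
    (hA : ∀ j, IsEchelon (K j) (q j * A * (g j)⁻¹) ∧ ∀ a, (q j * A * (g j)⁻¹) a (K j a) ≠ 0)
    {ψ : Fin d × {u // u ∉ Set.range J} → k} (hψ : rowSpan (chartMat J ψ) = rowSpan A) (j : Fin s) :
    IsUnit (chartBlock K J g ψ j).det := by
  obtain ⟨c, hc, h⟩ := exists_mul_eq_of_rowSpan_eq (linearIndependent_chartMat hJ ψ) hψ.symm
  have h1 := isUnit_det_of_isEchelon_strict (hK j) (hA j).1 (hA j).2
  rw [Matrix.mul_assoc, mul_submatrix_id, Matrix.det_mul] at h1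
  rw [chartBlock, h, Matrix.mul_assoc, mul_submatrix_id, Matrix.det_mul]
  exact hc.mul (isUnit_of_mul_isUnit_right h1)

theorem exists_nat_of_add_natCast_eq {x : WithBot ℕ∞} {a b : ℕ}
    (h : x + (a : ℕ) = (b : ℕ)) : ∃ m : ℕ, x = (m : ℕ) ∧ m + a = b := by
  induction x with
  | bot => exact absurd h (by simp)
  | coe y =>
    induction y with
    | top => exact absurd (WithBot.coe_injective h : (⊤ : ℕ∞) + (a : ℕ∞) = (b : ℕ∞)) (by simp)
    | coe m => exact ⟨m, rfl, by exact_mod_cast h⟩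

theorem topologicalKrullDim_schubert_component [IsAlgClosed k] (hs : 0 < s) (hK : ∀ j, StrictMono (K j))
    (hg : ∀ j, IsUnit (g j).det) (e : WithBot ℕ∞)
    (hdim : ∀ J : Fin d → Fin r, Function.Injective J →
      ∀ P ∈ (fibreIdeal K J fun x => g x.1 x.2.1 x.2.2).minimalPrimes, ringKrullDim (_ ⧸ P) = e)
    (hdense : ∀ V, (∀ j, varMem (K j) (spanFlag k (g j).row) V) → ∀ U, IsOpen[grTop k d] U →
      V ∈ U → ∃ (A : Matrix (Fin d) (Fin r) k) (q : Fin s → Matrix (Fin d) (Fin d) k), rowSpan A ∈ U ∧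
        (∀ j, IsUnit (q j).det) ∧
        ∀ j, IsEchelon (K j) (q j * A * (g j)⁻¹) ∧ ∀ a, (q j * A * (g j)⁻¹) a (K j a) ≠ 0)
    (C : Set (schubertIntersection K g))
    (hC : C ∈ subComponents (grTop k d) (schubertIntersection K g)) :
    compDim (grTop k d) (schubertIntersection K g) C = e := by
  let _ : TopologicalSpace (Submodule k (Fin r → k)) := grTop k d
  let _ : ∀ J : Fin d → Fin r, TopologicalSpace (Fin d × {u // u ∉ Set.range J} → k) :=
    fun _ => mZariski k _
  let σ : ∀ J : Fin d → Fin r, (Fin d × {u // u ∉ Set.range J} → k) → Submodule k (Fin r → k) :=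
    fun J ψ => rowSpan (chartMat J ψ)
  have hσ : ∀ J, Function.Injective J → IsOpenEmbedding (σ J) := fun J hJ =>
    isOpenEmbedding_rowSpan_chartMat (k := k) hJ
  let U : {J : Fin d → Fin r // Function.Injective J} → Set (schubertIntersection K g) :=
    fun J => Subtype.val ⁻¹' Set.range (σ J.1)
  have hτU : ∀ J : {J : Fin d → Fin r // Function.Injective J},
      Set.range (fibreToSchubert hK J.2 hg) ⊆ U J := by
    rintro J _ ⟨z, rfl⟩
    exact ⟨_, rfl⟩
  let ζ : ∀ J : {J : Fin d → Fin r // Function.Injective J}, U J →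
      (Fin d × {u // u ∉ Set.range J.1} → k) := fun J x => x.2.choose
  have hζ : ∀ J (x : U J), σ J.1 (ζ J x) = x.1.1 := fun J x => x.2.choose_spec
  refine topologicalKrullDim_irreducibleComponent_eq
    (ι := {J : Fin d → Fin r // Function.Injective J}) (β := fun J => FibreIndex K J.1)
    (γ := fun J => Fin d × {u // u ∉ Set.range J.1})
    (fun J => fibreIdeal K J.1 fun x => g x.1 x.2.1 x.2.2) e (fun J => hdim J.1 J.2)
    (fun J => fibreToSchubert hK J.2 hg) (fun J => isOpenEmbedding_fibreToSchubert hK J.2 hg)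
    U (fun J => ?_) (fun x => ?_) hτU (fun J => ?_) ζ (fun J => ?_)
    (fun J c => MvPolynomial.X (.inl c)) (fun J z c => ?_) C hC
  · exact (hσ J.1 J.2).isOpen_range.preimage continuous_subtype_val
  · obtain ⟨w, hw, hwS, -⟩ := (varMem_spanFlag_iff (hg ⟨0, hs⟩) (hK ⟨0, hs⟩)).mp (x.2 ⟨0, hs⟩)
    obtain ⟨J, hJ, hu⟩ := exists_isUnit_submatrix_det hw
    exact ⟨⟨J, hJ⟩, chartCoord J w, (rowSpan_chartMat_chartCoord hJ hu).trans hwS⟩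
  · rintro ⟨V, hV⟩ hVU
    rw [_root_.mem_closure_iff]
    rintro o ⟨O, hO, rfl⟩ hVO
    obtain ⟨A, q, ⟨hAO, ψ, hψ⟩, hq, hA⟩ := hdense V hV _ (hO.inter (hσ J.1 J.2).isOpen_range)
      ⟨hVO, hVU⟩
    refine ⟨⟨rowSpan A, fun j => ?_⟩, hAO, ?_⟩
    · have hli := linearIndependent_of_strict_echelon (hg j) (hK j) (hA j).1 (hA j).2
      exact (varMem_spanFlag_iff (hg j) (hK j)).mpr ⟨q j * A, hli, rowSpan_mul (hq j) A, (hA j).1⟩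
    · rw [range_fibreToSchubert]
      exact ⟨ψ, chartDenom_ne_zero_iff.mpr (chartBlock_isUnit_det hK J.2 hA hψ), hψ⟩
  · rw [← IsInducing.of_comp_iff (hσ J.1 J.2).isInducing]
    have : σ J.1 ∘ ζ J = fun x => x.1.1 := funext (hζ J)
    rw [this]
    exact IsInducing.subtypeVal.comp IsInducing.subtypeVal
  · rw [MvPolynomial.eval_X]
    exact congrFun ((hσ J.1 J.2).injective (hζ J ⟨_, hτU J ⟨z, rfl⟩⟩)) c

/-- For a generic tuple of flags, the components of intersections of Schubert varieties have the
expected dimension. -/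
theorem exists_polyFun_schubert_dimension [IsAlgClosed k] (hs : 0 < s) (hd : d ≤ r)
    (hK : ∀ j, StrictMono (K j)) :
    ∃ f ∈ polyFun k (Fin s → Fin r → Fin r → k), (∃ y, f y ≠ 0) ∧
      ∀ g : Fin s → Matrix (Fin r) (Fin r) k, f (fun j => (g j).row) ≠ 0 →
        (∀ j, IsUnit (g j).det) →
        ∀ C ∈ subComponents (grTop k d) (schubertIntersection K g),
          compDim (grTop k d) (schubertIntersection K g) C +
            (((∑ j, codimN r d (K j)) : ℕ) : WithBot ℕ∞) = ((d * (r - d) : ℕ) : WithBot ℕ∞) := by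
  classical
  have : Infinite k := IsAlgClosed.instInfinite
  obtain ⟨f₀, hf₀, hf₀0, hdense⟩ := exists_dense_strict_echelon (k := k) hs hd hK
    (h := fun _ => 1) (const_mem_polyFun 1) ⟨0, one_ne_zero⟩
  choose p hp0 hp using fun J : Fin d → Fin r =>
    generic_fibre (k := k) (fibrePoly k K J) 1 one_ne_zero
  let L : (Fin s → Fin r → Fin r → k) →ₗ[k] (Fin s × Fin r × Fin r → k) :=
    { toFun := fun y x => y x.1 x.2.1 x.2.2
      map_add' := fun _ _ => rfl
      map_smul' := fun _ _ => rfl }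
  let F : Option (Fin d → Fin r) → (Fin s → Fin r → Fin r → k) → k
    | none => f₀
    | some J => fun y => MvPolynomial.eval (L y) (p J)
  have hFmem : ∀ i, F i ∈ polyFun k (Fin s → Fin r → Fin r → k) := by
    rintro (_ | J)
    · exact hf₀
    · exact comp_linear_mem_polyFun L (mem_polyFun_pi.mpr ⟨p J, fun _ => rfl⟩)
  have hFne : ∀ i, ∃ x, F i x ≠ 0 := by
    rintro (_ | J)
    · exact hf₀0
    · obtain ⟨x, hx⟩ : ∃ x, MvPolynomial.eval x (p J) ≠ 0 := by
        by_contra! h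
        exact hp0 J (MvPolynomial.funext fun x => by rw [h x, map_zero])
      exact ⟨fun j a b => x (j, a, b), hx⟩
  obtain ⟨f, hf, hfne, hfF⟩ := exists_polyFun_ne_zero_of_finite F hFmem hFne
  · refine ⟨f, hf, hfne, fun g hfg hg C hC => ?_⟩
    have hF := hfF _ hfg
    have hdim : ∀ J : Fin d → Fin r, ∀ P ∈ (fibreIdeal K J fun x => g x.1 x.2.1 x.2.2).minimalPrimes,
        ringKrullDim (MvPolynomial (FibreIndex K J) k ⧸ P) +
          (Fintype.card (Fin s × Fin r × Fin r) : ℕ) = (Fintype.card (FibreIndex K J) : ℕ) :=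
      fun J P hP => (hp J _ (hF (some J)) P hP).2
    have hden : ∀ V, (∀ j, varMem (K j) (spanFlag k (g j).row) V) → ∀ U, IsOpen[grTop k d] U →
      V ∈ U → ∃ (A : Matrix (Fin d) (Fin r) k) (q : Fin s → Matrix (Fin d) (Fin d) k), rowSpan A ∈ U ∧
        (∀ j, IsUnit (q j).det) ∧
        ∀ j, IsEchelon (K j) (q j * A * (g j)⁻¹) ∧ ∀ a, (q j * A * (g j)⁻¹) a (K j a) ≠ 0 := by
      intro V hV U hU hVU
      obtain ⟨A, q, h1, -, h2⟩ := hdense g (hF none) hg V hV U hU hVU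
      exact ⟨A, q, h1, h2⟩
    by_cases hc : ∑ j, codimN r d (K j) ≤ d * (r - d)
    · rw [topologicalKrullDim_schubert_component hs hK hg
        ((d * (r - d) - ∑ j, codimN r d (K j) : ℕ) : WithBot ℕ∞) ?_ hden C hC]
      · rw [← Nat.cast_add, Nat.sub_add_cancel hc]
      · intro J hJ P hP
        obtain ⟨m, hm, h1⟩ := exists_nat_of_add_natCast_eq (hdim J P hP)
        have h2 := card_fibreIndex hK hJ hd
        rw [hm]
        congr 1
        omega
    · have key : ∀ e : WithBot ℕ∞, compDim (grTop k d) (schubertIntersection K g) C = e := by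
        intro e
        refine topologicalKrullDim_schubert_component hs hK hg e ?_ hden C hC
        intro J hJ P hP
        obtain ⟨m, hm, h1⟩ := exists_nat_of_add_natCast_eq (hdim J P hP)
        have h2 := card_fibreIndex hK hJ hd
        omega
      exact absurd ((key 0).symm.trans (key 1)) zero_ne_one

end assembly
end

section
open Topology
open Matrix

section transport
variable {k : Type} [Field k]

theorem topologicalKrullDim_component_of_homeomorph {X Y : Type*} [TopologicalSpace X]
    [TopologicalSpace Y] (e : X ≃ₜ Y) {P : WithBot ℕ∞ → Prop}
    (h : ∀ C ∈ irreducibleComponents X, P (topologicalKrullDim C)) :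
    ∀ C ∈ irreducibleComponents Y, P (topologicalKrullDim C) := by
  intro C hC
  have hC' : e ⁻¹' C ∈ irreducibleComponents X :=
    preimage_mem_irreducibleComponents hC e.isOpenEmbedding (by
      rw [e.range_coe, Set.inter_univ]
      exact hC.1.1)
  have h1 := h _ hC'
  rwa [(e.subtype (p := (· ∈ e ⁻¹' C)) (q := (· ∈ C)) fun _ => Iff.rfl).isHomeomorph.topologicalKrullDim_eq]
    at h1

/-- Every component of the intersection of the Schubert varieties indexed by `K` in the flags `F`
has the expected dimension. -/
def HasSchubertDimension {M : Type} [AddCommGroup M] [Module k M] {s d r : ℕ}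
    (K : Fin s → Fin d → Fin r) (F : Fin s → ℕ → Submodule k M) : Prop :=
  ∀ C ∈ subComponents (grTop k d) {S : Submodule k M | ∀ j, varMem (K j) (F j) S},
    compDim (grTop k d) {S : Submodule k M | ∀ j, varMem (K j) (F j) S} C
      + (((∑ j : Fin s, codimN r d (K j)) : ℕ) : WithBot ℕ∞)
    = (((d * (r - d)) : ℕ) : WithBot ℕ∞)

variable {M N : Type} [AddCommGroup M] [Module k M] [AddCommGroup N] [Module k N]

theorem finrank_map_inf_equiv (θ : M ≃ₗ[k] N) (S T : Submodule k M) :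
    finrank k ↥(S.map θ.toLinearMap ⊓ T.map θ.toLinearMap) = finrank k ↥(S ⊓ T) := by
  rw [← Submodule.map_inf _ θ.injective]
  exact LinearEquiv.finrank_map_eq θ _

theorem varMem_map_iff {n r : ℕ} {i : Fin r → Fin n} (θ : M ≃ₗ[k] N) {E : ℕ → Submodule k M}
    {V : Submodule k M} :
    varMem i (fun u => (E u).map θ.toLinearMap) (V.map θ.toLinearMap) ↔ varMem i E V := by
  simp only [varMem, finrank_map_inf_equiv]
  rw [LinearEquiv.finrank_map_eq θ V]

theorem cellMem_map_iff {n r : ℕ} {i : Fin r → Fin n} (θ : M ≃ₗ[k] N) {E : ℕ → Submodule k M}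
    {V : Submodule k M} :
    cellMem i (fun u => (E u).map θ.toLinearMap) (V.map θ.toLinearMap) ↔ cellMem i E V := by
  simp only [cellMem, finrank_map_inf_equiv]
  rw [LinearEquiv.finrank_map_eq θ V]

theorem HasSchubertDimension.of_map {s d r : ℕ} {K : Fin s → Fin d → Fin r}
    {F : Fin s → ℕ → Submodule k M} (θ : M ≃ₗ[k] N) (h : HasSchubertDimension K F) :
    HasSchubertDimension K fun j a => (F j a).map θ.toLinearMap := by
  let _ := grTop k (M := M) d
  let _ := grTop k (M := N) d
  exact topologicalKrullDim_component_of_homeomorph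
    (P := fun c => c + (((∑ j : Fin s, codimN r d (K j)) : ℕ) : WithBot ℕ∞)
      = (((d * (r - d)) : ℕ) : WithBot ℕ∞))
    ((grHomeomorph θ d).subtype fun _ => forall_congr' fun _ => (varMem_map_iff θ).symm) h

theorem HasSchubertDimension.of_comap {s d r : ℕ} {K : Fin s → Fin d → Fin r}
    {F : Fin s → ℕ → Submodule k N} (θ : M ≃ₗ[k] N)
    (h : HasSchubertDimension K fun j a => (F j a).comap θ.toLinearMap) :
    HasSchubertDimension K F := by
  have := h.of_map θ
  simpa only [Submodule.map_comap_eq_of_surjective (f := θ.toLinearMap) θ.surjective] using this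

theorem spanFlag_comp {r : ℕ} (θ : M ≃ₗ[k] N) (b : Fin r → M) (m : ℕ) :
    spanFlag k (fun a => θ (b a)) m = (spanFlag k b m).map θ.toLinearMap := by
  rw [spanFlag, spanFlag, Submodule.map_span, ← Set.image_comp]
  rfl

theorem comap_indSub_map (θ : M ≃ₗ[k] N) (E : ℕ → Submodule k M) (V : Submodule k M) (a : ℕ) :
    (indSub (fun u => (E u).map θ.toLinearMap) (V.map θ.toLinearMap) a).comap
      (θ.submoduleMap V).toLinearMap = indSub E V a := by
  have h : ∀ u, (((E u).map θ.toLinearMap).comap (V.map θ.toLinearMap).subtype).comap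
      (θ.submoduleMap V).toLinearMap = (E u).comap V.subtype := by
    intro u
    ext x
    simp
  have hd : ∀ u, finrank k ↥(((E u).map θ.toLinearMap).comap (V.map θ.toLinearMap).subtype) =
      finrank k ↥((E u).comap V.subtype) := by
    intro u
    rw [← h u]
    exact (LinearEquiv.finrank_eq
      (LinearEquiv.ofSubmodule' (θ.submoduleMap V) _)).symm
  simp only [indSub, hd, Submodule.comap_iInf, h]

end transport

section generic
variable {k : Type} [Field k]

/-- A nondegenerate polynomial condition on tuples of flags holds for the flags induced on a
generic member of the intersection of Schubert cells. -/
theorem exists_polyFun_generic_induced [IsAlgClosed k] {s n r : ℕ} (hs : 0 < s) (hr : r ≤ n)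
    {I : Fin s → Fin r → Fin n} (hI : ∀ j, StrictMono (I j))
    {h : (Fin s → Fin r → Fin r → k) → k} (hh : h ∈ polyFun k _) (h0 : ∃ q, h q ≠ 0) :
    ∃ f ∈ polyFun k (Fin s → Fin n → Fin n → k), (∃ y, f y ≠ 0) ∧
      ∀ g : Fin s → Matrix (Fin n) (Fin n) k, f (fun j => (g j).row) ≠ 0 →
        (∀ j, IsUnit (g j).det) →
        ∃ U, IsOpen[grTop k r] U ∧
          (∀ V, (∀ j, cellMem (I j) (spanFlag k (g j).row) V) →
            ∀ U', IsOpen[grTop k r] U' → V ∈ U' →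
              ∃ V' ∈ U', V' ∈ U ∧ ∀ j, cellMem (I j) (spanFlag k (g j).row) V') ∧
          ∀ V ∈ U, (∀ j, cellMem (I j) (spanFlag k (g j).row) V) →
            ∃ (θ : (Fin r → k) ≃ₗ[k] V) (q : Fin s → Matrix (Fin r) (Fin r) k),
              h (fun j => (q j).row) ≠ 0 ∧ (∀ j, IsUnit (q j).det) ∧
              ∀ j a, (indSub (spanFlag k (g j).row) V a).comap θ.toLinearMap =
                spanFlag k (q j).row a := by
  obtain ⟨f, hf, hf0, hdense⟩ := exists_dense_strict_echelon (k := k) hs hr hI hh h0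
  refine ⟨f, hf, hf0, fun g hfg hg => ?_⟩
  let B : Fin s → Matrix (Fin r) (Fin n) k → Matrix (Fin r) (Fin r) k := fun j A =>
    (A * (g j)⁻¹).submatrix id (I j)
  let T : Set (Fin s → Matrix (Fin r) (Fin r) k) :=
    {t | ∀ j, (∀ a b, a < b → t j a b = 0) ∧ IsUnit (t j).det}
  let Φ : (Fin s → Matrix (Fin r) (Fin r) k) → (Fin r → Fin n → k) → k := fun t A =>
    (∏ j, (B j (Matrix.of A)).det) * h fun j => (t j * (B j (Matrix.of A)).adjugate).row
  have hBmem : ∀ j a b, (fun A : Fin r → Fin n → k => B j (Matrix.of A) a b) ∈ polyFun k _ :=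
    fun j a b => mul_mem_of_entries (F := fun A : Fin r → Fin n → k => Matrix.of A)
      (G := fun _ => (g j)⁻¹) (fun a b => entry_mem_polyFun a b)
      (fun _ _ => const_mem_polyFun _) a (I j b)
  have hΦ : ∀ t, Φ t ∈ polyFun k (Fin r → Fin n → k) := by
    intro t
    refine mul_mem ?_ ?_
    · have : (fun A : Fin r → Fin n → k => ∏ j, (B j (Matrix.of A)).det) =
          ∏ j, fun A : Fin r → Fin n → k => (B j (Matrix.of A)).det := by
        ext A
        simp
      rw [this]
      exact prod_mem fun j _ => det_mem_of_entries (hBmem j)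
    · refine comp_mem_of_mem_polyFun (F := fun A : Fin r → Fin n → k => fun j =>
        (t j * (B j (Matrix.of A)).adjugate).row) (fun l => ?_) hh
      refine dual_comp_mem_pi (fun j => dual_comp_mem_pi fun a => dual_comp_mem_pi fun b => ?_) l
      exact dual_comp_mem_self (mul_mem_of_entries (F := fun _ => t j)
        (G := fun A : Fin r → Fin n → k => (B j (Matrix.of A)).adjugate)
        (fun _ _ => const_mem_polyFun _) (adjugate_mem_of_entries (hBmem j)) a b)
  let Ω : Set (Fin r → Fin n → k) := ⋃ t ∈ T, {A | Φ t A ≠ 0}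
  have hΩ : IsOpen[mZariski k (Fin r → Fin n → k)] Ω := by
    let _ := mZariski k (Fin r → Fin n → k)
    exact isOpen_biUnion fun t _ => isOpen_ne_zero_of_mem_polyFun (hΦ t)
  have hdet : ∀ t A, Φ t A ≠ 0 → ∀ j, IsUnit (B j (Matrix.of A)).det := fun t A hA j =>
    isUnit_iff_ne_zero.mpr (Finset.prod_ne_zero_iff.mp (left_ne_zero_of_mul hA) j
      (Finset.mem_univ j))
  have hli' : ∀ j (A : Matrix (Fin r) (Fin n) k), IsUnit (B j A).det →
      LinearIndependent k A.row := by
    intro j A hA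
    rw [← Matrix.vecMul_injective_iff]
    intro x y hxy
    refine Matrix.vecMul_injective_iff.mpr (linearIndependent_of_submatrix hA) ?_
    change x ᵥ* A = y ᵥ* A at hxy
    change x ᵥ* (A * (g j)⁻¹) = y ᵥ* (A * (g j)⁻¹)
    rw [← Matrix.vecMul_vecMul, ← Matrix.vecMul_vecMul, hxy]
  have hli : ∀ A ∈ Ω, LinearIndependent k A := by
    intro A hA
    obtain ⟨t, -, hA⟩ := Set.mem_iUnion₂.mp hA
    exact hli' ⟨0, hs⟩ (Matrix.of A) (hdet t A hA _)
  refine ⟨_, isOpen_rowSpan_image hΩ hli, fun V hV U' hU' hVU' => ?_, ?_⟩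
  · obtain ⟨A, q, hAU, hq, hqdet, hech⟩ := hdense g hfg hg V
      (fun j => varMem_of_cellMem (hI j) (hV j)) U' hU' hVU'
    refine ⟨rowSpan A, hAU, ⟨A, ?_, rfl⟩, fun j => ?_⟩
    · have hx : ∀ j, (q j * A * (g j)⁻¹).submatrix id (I j) = q j * B j A := by
        intro j
        rw [Matrix.mul_assoc, mul_submatrix_id]
      have hxdet : ∀ j, IsUnit (q j * B j A).det := fun j =>
        hx j ▸ isUnit_det_of_isEchelon_strict (hI j) (hech j).1 (hech j).2
      have hBdet : ∀ j, IsUnit (B j A).det := fun j =>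
        isUnit_of_mul_isUnit_right (Matrix.det_mul (q j) (B j A) ▸ hxdet j)
      refine Set.mem_iUnion₂.mpr ⟨fun j => (B j A).det⁻¹ • (q j * B j A), fun j => ⟨?_, ?_⟩, ?_⟩
      · intro a b hab
        change ((B j A).det⁻¹ • (q j * B j A)) a b = 0
        rw [Matrix.smul_apply, ← hx j]
        exact smul_eq_zero_of_right _ ((hech j).1 a (I j b) (hI j hab))
      · rw [Matrix.det_smul]
        exact (((isUnit_iff_ne_zero.mpr (inv_ne_zero (hBdet j).ne_zero)).pow _).mul (hxdet j))
      · have hqj : ∀ j, (B j A).det⁻¹ • (q j * B j A) * (B j A).adjugate = q j := by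
          intro j
          rw [Matrix.smul_mul, Matrix.mul_assoc, Matrix.mul_adjugate, Matrix.mul_smul,
            Matrix.mul_one, smul_smul, inv_mul_cancel₀ (hBdet j).ne_zero, one_smul]
        refine mul_ne_zero (Finset.prod_ne_zero_iff.mpr fun j _ => (hBdet j).ne_zero) ?_
        change h (fun j => ((B j A).det⁻¹ • (q j * B j A) * (B j A).adjugate).row) ≠ 0
        simpa only [hqj] using hq
    · rw [← rowSpan_mul (hqdet j) A]
      exact cellMem_rowSpan (hg j) (hI j) (hech j).1 (hech j).2
  · rintro _ ⟨A, hA, rfl⟩ hV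
    obtain ⟨t, ht, hA⟩ := Set.mem_iUnion₂.mp hA
    have hB := hdet t A hA
    have hAli : LinearIndependent k (Matrix.of A).row := hli' ⟨0, hs⟩ _ (hB _)
    obtain ⟨θ, hθ⟩ := exists_rowSpan_equiv hAli rfl
    refine ⟨θ, fun j => t j * (B j (Matrix.of A)).adjugate, right_ne_zero_of_mul hA,
      fun j => ?_, fun j a => ?_⟩
    · rw [Matrix.det_mul]
      refine (ht j).2.mul ?_
      rw [Matrix.det_adjugate]
      exact (hB j).pow _
    · obtain ⟨w, hw, hwV, hech, hne⟩ := exists_strict_echelon_of_cellMem (hg j) (hI j) (hV j)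
      obtain ⟨c, hc, rfl⟩ := exists_mul_eq_of_rowSpan_eq hw hwV.symm
      rw [comap_indSub_spanFlag (hg j) (hI j) hc hech hne rfl θ hθ a]
      have hx : (c * Matrix.of A * (g j)⁻¹).submatrix id (I j) = c * B j (Matrix.of A) := by
        rw [Matrix.mul_assoc, mul_submatrix_id]
      have hxdet : IsUnit (c * B j (Matrix.of A)).det :=
        hx ▸ isUnit_det_of_isEchelon_strict (hI j) hech hne
      have hlow : ∀ a b, a < b → (c * B j (Matrix.of A)) a b = 0 := by
        intro a b hab
        rw [← hx]
        exact hech a (I j b) (hI j hab)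
      have hadj : c * B j (Matrix.of A) * (B j (Matrix.of A)).adjugate =
          (B j (Matrix.of A)).det • c := by
        rw [Matrix.mul_assoc, Matrix.mul_adjugate, Matrix.mul_smul, Matrix.mul_one]
      have hdetne := (hB j).ne_zero
      rw [spanFlag_mul_of_lowerTriangular (ht j).1 (ht j).2,
        ← spanFlag_mul_of_lowerTriangular hlow hxdet (q := (B j (Matrix.of A)).adjugate), hadj,
        ← Matrix.one_mul c, ← Matrix.smul_mul,
        spanFlag_mul_of_lowerTriangular (t := (B j (Matrix.of A)).det • 1), Matrix.one_mul]
      · intro a b hab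
        rw [Matrix.smul_apply, Matrix.one_apply_ne hab.ne, smul_zero]
      · rw [Matrix.det_smul, Matrix.det_one, mul_one]
        exact (hB j).pow _

/-- A generic tuple of flags is generic for intersection theory. -/
theorem exists_polyFun_hasSchubertDimension [IsAlgClosed k] {s r : ℕ} (hs : 0 < s) :
    ∃ f ∈ polyFun k (Fin s → Fin r → Fin r → k), (∃ y, f y ≠ 0) ∧
      ∀ g : Fin s → Matrix (Fin r) (Fin r) k, f (fun j => (g j).row) ≠ 0 →
        (∀ j, IsUnit (g j).det) → ∀ (d : ℕ) (K : Fin s → Fin d → Fin r),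
          (∀ j, StrictMono (K j)) → HasSchubertDimension K fun j => spanFlag k (g j).row := by
  have : Infinite k := IsAlgClosed.instInfinite
  let ι := Σ d : Fin (r + 1), {K : Fin s → Fin d → Fin r // ∀ j, StrictMono (K j)}
  choose F hF hF0 hFg using fun x : ι => exists_polyFun_schubert_dimension (k := k) hs
    (Nat.lt_succ_iff.mp x.1.2) x.2.2
  obtain ⟨f, hf, hf0, hfF⟩ := exists_polyFun_ne_zero_of_finite F hF hF0
  refine ⟨f, hf, hf0, fun g hfg hg d K hK => ?_⟩
  have hd : d ≤ r := by
    simpa using Fintype.card_le_of_injective _ (hK ⟨0, hs⟩).injective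
  exact hFg ⟨⟨d, Nat.lt_succ_iff.mpr hd⟩, K, hK⟩ g (hfF _ hfg _) hg

end generic
end

/-- Proposition `neww`.  For a generic `𝓔 ∈ Fl(W)^s`, the
intersection `∩_j Ω°_{I^j}(E^j_•)` has a (relatively) open dense subset `O` such that
for every `V ∈ O` the induced tuple of flags `𝓔(V) ∈ Fl(V)^s` is generic for
intersection theory in `V`: for every `s`-tuple of subsets `K^j ⊆ [r]` of common
cardinality `d`, every irreducible component of `∩_j Ω_{K^j}(E^j_•(V)) ⊆ Gr(d,V)`
has the expected dimension `dim Gr(d,r) - ∑_j codim ω_{K^j}` (stated additively: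
`dim C + ∑_j codim ω_{K^j} = d(r-d)`). -/
theorem stmt19 (k : Type) [Field k] [IsAlgClosed k]
    {W : Type} [AddCommGroup W] [Module k W] [FiniteDimensional k W]
    (n r s : ℕ) (hs : 0 < s) (hW : Module.finrank k W = n)
    (I : Fin s → Fin r → Fin n) (hI : ∀ j, StrictMono (I j)) :
    GenericFlags k s n (fun E =>
      ∃ O : Set (Submodule k W),
        O ⊆ {V : Submodule k W | ∀ j, cellMem (I j) (E j) V} ∧
        (∃ U : Set (Submodule k W), @IsOpen _ (grTop k r) U ∧
          O = U ∩ {V : Submodule k W | ∀ j, cellMem (I j) (E j) V}) ∧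
        (∀ V ∈ {V : Submodule k W | ∀ j, cellMem (I j) (E j) V},
          ∀ U : Set (Submodule k W), @IsOpen _ (grTop k r) U → V ∈ U →
            (U ∩ O).Nonempty) ∧
        ∀ V ∈ O, ∀ (d : ℕ) (K : Fin s → Fin d → Fin r), (∀ j, StrictMono (K j)) →
          ∀ C ∈ subComponents (grTop k d)
              {S : Submodule k ↥V | ∀ j, varMem (K j) (indSub (E j) V) S},
            compDim (grTop k d)
                {S : Submodule k ↥V | ∀ j, varMem (K j) (indSub (E j) V) S} C
              + (((∑ j : Fin s, codimN r d (K j)) : ℕ) : WithBot ℕ∞)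
            = (((d * (r - d)) : ℕ) : WithBot ℕ∞)) := by
  have : Infinite k := IsAlgClosed.instInfinite
  have hr : r ≤ n := by
    simpa using Fintype.card_le_of_injective _ (hI ⟨0, hs⟩).injective
  obtain ⟨h, hh, h0, hsch⟩ := exists_polyFun_hasSchubertDimension (k := k) (r := r) hs
  obtain ⟨f, hf, hf0, hgen⟩ := exists_polyFun_generic_induced (k := k) hs hr hI hh h0
  let e : W ≃ₗ[k] (Fin n → k) := LinearEquiv.ofFinrankEq _ _ (by rw [hW, Module.finrank_fin_fun])
  let L : (Fin s → Fin n → W) ≃ₗ[k] (Fin s → Fin n → Fin n → k) :=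
    LinearEquiv.piCongrRight fun _ => LinearEquiv.piCongrRight fun _ => e
  refine ⟨{b | f (L b) ≠ 0}, isOpen_ne_zero_of_mem_polyFun
    (comp_linear_mem_polyFun L.toLinearMap hf), ?_, fun b hb hli => ?_⟩
  · have hD : (fun y : Fin s → Fin n → Fin n → k => ∏ j, (Matrix.of (y j)).det) ∈ polyFun k _ := by
      have : (fun y : Fin s → Fin n → Fin n → k => ∏ j, (Matrix.of (y j)).det) =
          ∏ j, fun y : Fin s → Fin n → Fin n → k => (Matrix.of (y j)).det := by
        ext y
        simp
      rw [this]
      exact prod_mem fun j _ => det_mem_of_entries fun a b =>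
        comp_linear_mem_polyFun (LinearMap.proj (R := k) (φ := fun _ => Fin n → Fin n → k) j)
          (entry_mem_polyFun a b)
    obtain ⟨y, hfy, hDy⟩ := exists_mul_ne_zero_of_polyFun hf hD hf0
      ⟨fun _ => (1 : Matrix (Fin n) (Fin n) k).row, by
        refine Finset.prod_ne_zero_iff.mpr fun j _ => ?_
        change (1 : Matrix (Fin n) (Fin n) k).det ≠ 0
        rw [Matrix.det_one]
        exact one_ne_zero⟩
    refine ⟨L.symm y, by simpa using hfy, fun j => ?_⟩
    have hy : LinearIndependent k (y j) := Matrix.linearIndependent_rows_of_det_ne_zero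
      (A := Matrix.of (y j)) (Finset.prod_ne_zero_iff.mp hDy j (Finset.mem_univ j))
    exact hy.map' e.symm.toLinearMap e.symm.ker
  · let g : Fin s → Matrix (Fin n) (Fin n) k := fun j => Matrix.of (L b j)
    have hg : ∀ j, IsUnit (g j).det := fun j =>
      (Matrix.isUnit_iff_isUnit_det _).mp (Matrix.linearIndependent_rows_iff_isUnit.mp
        ((hli j).map' e.toLinearMap e.ker))
    have hflag : ∀ j, spanFlag k (g j).row = fun u => (spanFlag k (b j) u).map e.toLinearMap :=
      fun j => funext fun u => spanFlag_comp e (b j) u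
    obtain ⟨U, hU, hdense, hind⟩ := hgen g hb hg
    simp only [hflag] at hdense hind
    refine ⟨Submodule.map e.toLinearMap ⁻¹' U ∩ {V | ∀ j, cellMem (I j) (spanFlag k (b j)) V},
      Set.inter_subset_right, ⟨_, ?_, rfl⟩, ?_, ?_⟩
    · let _ := grTop k (M := W) r
      let _ := grTop k (M := Fin n → k) r
      exact hU.preimage (continuous_map_grTop e r)
    · intro V hV U' hU' hVU'
      obtain ⟨V', hV'U', hV'U, hV'⟩ := hdense (V.map e.toLinearMap)
        (fun j => (cellMem_map_iff e).mpr (hV j)) (Submodule.map e.symm.toLinearMap ⁻¹' U')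
        (by
          let _ := grTop k (M := W) r
          let _ := grTop k (M := Fin n → k) r
          exact hU'.preimage (continuous_map_grTop e.symm r))
        (by
          change (V.map e.toLinearMap).map e.symm.toLinearMap ∈ U'
          rw [← Submodule.map_comp]
          simpa using hVU')
      have hmap : (V'.map e.symm.toLinearMap).map e.toLinearMap = V' := by
        rw [← Submodule.map_comp]
        simp
      refine ⟨V'.map e.symm.toLinearMap, hV'U', ?_, fun j => ?_⟩
      · change (V'.map e.symm.toLinearMap).map e.toLinearMap ∈ U
        rwa [hmap]
      · rw [← cellMem_map_iff e, hmap]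
        exact hV' j
    · rintro V ⟨hVU, hV⟩ d K hK
      obtain ⟨θ, q, hq, hqdet, hθ⟩ := hind (V.map e.toLinearMap) hVU
        fun j => (cellMem_map_iff e).mpr (hV j)
      refine HasSchubertDimension.of_comap (θ.trans (e.submoduleMap V).symm) ?_
      convert hsch q hq hqdet d K hK using 3 with j a
      rw [← hθ, ← comap_indSub_map e]
      ext x
      simp

end
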